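/- Let K be a number field with r₁ real embeddings and r₂ pairs of complex embeddings. Let Z be the set of squarefree ideals of 𝒪_K all of whose prime factors divide 2𝒪_K, let R be the (finite) set of possible even parts 𝔔 of relative discriminants of quadratic extensions of K, and for 𝔔 ∈ R let ρ_𝔔 be the density of quadratic extensions with even part of discriminant equal to 𝔔, ordered by the norm of the odd part of the discriminant. Then (2^{r₁+r₂} · #Z) · ∏_{𝔮 | 2𝒪_K, 𝔮 prime} (N(𝔮)/(1 + N(𝔮))) · Σ_{𝔔 ∈ R} (ρ_𝔔/N(𝔔)) = 1/2^{r₂}. -/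

import Mathlib

open NumberField Filter

noncomputable section

/-- The relative discriminant ideal of `L/K`. -/
def relDisc (K L : Type*) [Field K] [NumberField K] [Field L] [Algebra K L] :
    Ideal (𝓞 K) :=
  Ideal.span {d : 𝓞 K | ∃ b : Module.Basis (Fin (Module.finrank K L)) K L,
    (∀ i, IsIntegral ℤ (b i)) ∧ algebraMap (𝓞 K) K d = Algebra.discr K ⇑b}

/-- `I = Lp * F` where `Lp` is the even part (supported on primes dividing `l = 2𝒪_K`)
and `F` is the odd part (coprime to `l`). -/
def IsLPartition {R : Type*} [CommRing R] (l I Lp F : Ideal R) : Prop :=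
  I = Lp * F ∧ (∀ p : Ideal R, p.IsPrime → p ∣ Lp → p ∣ l) ∧
    (∀ p : Ideal R, p.IsPrime → p ∣ F → ¬ p ∣ l)

/-- The set of possible even parts of relative discriminants of quadratic extensions
of `K`. -/
def evenDiscParts (K : Type*) [Field K] [NumberField K] : Set (Ideal (𝓞 K)) :=
  {𝔔 | ∃ L : IntermediateField K (AlgebraicClosure K), Module.finrank K L = 2 ∧
    ∃ F : Ideal (𝓞 K), IsLPartition (Ideal.span {(2 : 𝓞 K)}) (relDisc K L) 𝔔 F}

open Topology

section GeometryOfNumbers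

open MeasureTheory Pointwise

/-- A segment with exactly one endpoint in a set meets the frontier of that set. -/
theorem exists_mem_segment_mem_frontier {E : Type*} [NormedAddCommGroup E] [NormedSpace ℝ E]
    {s : Set E} {x y : E} (hx : x ∈ s) (hy : y ∉ s) : ∃ z ∈ segment ℝ x y, z ∈ frontier s := by
  by_contra! h
  have hpre : IsPreconnected (segment ℝ x y) := (convex_segment x y).isPreconnected
  have hcov : segment ℝ x y ⊆ interior s ∪ (closure s)ᶜ := by
    intro z hz
    have := h z hz
    rw [frontier, Set.mem_sdiff, not_and_not_right] at this
    by_cases hc : z ∈ closure s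
    · exact Or.inl (this hc)
    · exact Or.inr hc
  have hxi : x ∈ interior s := by
    rcases hcov (left_mem_segment ℝ x y) with h | h
    · exact h
    · exact absurd (subset_closure hx) h
  have hyi : y ∈ (closure s)ᶜ := by
    rcases hcov (right_mem_segment ℝ x y) with h | h
    · exact absurd (interior_subset h) hy
    · exact h
  obtain ⟨z, -, hz₁, hz₂⟩ := hpre _ _ isOpen_interior isClosed_closure.isOpen_compl hcov
    ⟨x, left_mem_segment ℝ x y, hxi⟩ ⟨y, right_mem_segment ℝ x y, hyi⟩
  exact hz₂ (subset_closure (interior_subset hz₁))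

theorem mem_thickening_frontier_of_mem_of_notMem {E : Type*} [NormedAddCommGroup E]
    [NormedSpace ℝ E] {s : Set E} {x y : E} {ε : ℝ} (hx : x ∈ s) (hy : y ∉ s)
    (hxy : dist x y < ε) :
    x ∈ Metric.thickening ε (frontier s) ∧ y ∈ Metric.thickening ε (frontier s) := by
  obtain ⟨z, hz, hzs⟩ := exists_mem_segment_mem_frontier hx hy
  have := dist_add_dist_of_mem_segment hz
  refine ⟨Metric.mem_thickening_iff.2 ⟨z, hzs, ?_⟩, Metric.mem_thickening_iff.2 ⟨z, hzs, ?_⟩⟩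
  · have := dist_nonneg (x := z) (y := y)
    linarith
  · have := dist_nonneg (x := x) (y := z)
    rw [dist_comm]
    linarith

theorem finite_lattice_inter_smul_add {E : Type*} [NormedAddCommGroup E]
    [InnerProductSpace ℝ E] [FiniteDimensional ℝ E] (L : Submodule ℤ E) [DiscreteTopology L]
    {s : Set E} (hs : Bornology.IsBounded s) (v : E)
    {r : ℝ} (hr : r ≠ 0) : {x : E | x ∈ L ∧ r • (v + x) ∈ s}.Finite := by
  have hb : Bornology.IsBounded ((fun y : E => r⁻¹ • y - v) '' s) := by
    refine ((lipschitzWith_smul r⁻¹).sub (LipschitzWith.const v)).isBounded_image hs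
  have : DiscreteTopology L.toAddSubgroup := (inferInstance : DiscreteTopology L)
  refine (Metric.finite_isBounded_inter_isClosed (s := (L.toAddSubgroup : Set E))
    DiscreteTopology.isDiscrete hb inferInstance).subset ?_
  rintro x ⟨hx, hxs⟩
  refine ⟨⟨_, hxs, ?_⟩, hx⟩
  simp [smul_smul, inv_mul_cancel₀ hr]

section Lattice

variable {E : Type*} [NormedAddCommGroup E] [InnerProductSpace ℝ E] [FiniteDimensional ℝ E]
  [MeasurableSpace E] [BorelSpace E]
variable (L : Submodule ℤ E) [DiscreteTopology L] [IsZLattice ℝ L]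

theorem tendsto_card_lattice_inter {s : Set E} (hs₁ : Bornology.IsBounded s)
    (hs₂ : MeasurableSet s) (hs₃ : volume (frontier s) = 0) :
    Tendsto (fun n : ℕ ↦ (Nat.card {x : E | x ∈ L ∧ (n : ℝ)⁻¹ • x ∈ s} : ℝ) /
      n ^ Module.finrank ℝ E) atTop (𝓝 (volume.real s / ZLattice.covolume L)) := by
  refine (ZLattice.covolume.tendsto_card_div_pow' L hs₁ hs₂ hs₃).congr' ?_
  filter_upwards [eventually_gt_atTop 0] with n hn
  congr 2
  have hn0 : (n : ℝ)⁻¹ ≠ 0 := inv_ne_zero (Nat.cast_ne_zero.2 hn.ne')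
  have himg : (s ∩ (n : ℝ)⁻¹ • (L : Set E) : Set E) =
      (fun x => (n : ℝ)⁻¹ • x) '' {x : E | x ∈ L ∧ (n : ℝ)⁻¹ • x ∈ s} := by
    ext y
    constructor
    · rintro ⟨hy, x, hx, rfl⟩
      exact ⟨x, ⟨hx, hy⟩, rfl⟩
    · rintro ⟨x, ⟨hx, hy⟩, rfl⟩
      exact ⟨hy, x, hx, rfl⟩
  rw [himg]
  exact Nat.card_image_of_injective (smul_right_injective E hn0) _

/-- Counting points of a translated lattice in the dilates of a bounded set. -/
theorem tendsto_card_translate_lattice_inter {s : Set E} (hs₁ : Bornology.IsBounded s)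
    (hs₂ : MeasurableSet s) (hs₃ : volume (frontier s) = 0) (v : E) :
    Tendsto (fun n : ℕ ↦ (Nat.card {x : E | x ∈ L ∧ (n : ℝ)⁻¹ • (v + x) ∈ s} : ℝ) /
      n ^ Module.finrank ℝ E) atTop (𝓝 (volume.real s / ZLattice.covolume L)) := by
  have hA := tendsto_card_lattice_inter L hs₁ hs₂ hs₃
  rw [Metric.tendsto_atTop] at hA ⊢
  intro η hη
  have hcov : 0 < ZLattice.covolume L := ZLattice.covolume_pos L volume
  have hfb : Bornology.IsBounded (frontier s) := hs₁.closure.subset frontier_subset_closure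
  have hth : Tendsto (fun r => volume (Metric.thickening r (frontier s))) (𝓝[>] 0)
      (𝓝 (volume (closure (frontier s)))) :=
    tendsto_measure_thickening ⟨1, one_pos, hfb.thickening.measure_lt_top.ne⟩
  rw [isClosed_frontier.closure_eq, hs₃] at hth
  have hpos : (0 : ENNReal) < ENNReal.ofReal (η / 4 * ZLattice.covolume L) := by
    rw [ENNReal.ofReal_pos]; positivity
  obtain ⟨δ, hδ, hδs⟩ : ∃ δ > (0 : ℝ), ∀ r ∈ Set.Ioo (0 : ℝ) δ,
      volume (Metric.thickening r (frontier s)) < ENNReal.ofReal (η / 4 * ZLattice.covolume L) := by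
    have := hth.eventually (gt_mem_nhds hpos)
    rw [eventually_nhdsWithin_iff, Metric.eventually_nhds_iff] at this
    obtain ⟨δ, hδ, h⟩ := this
    refine ⟨δ, hδ, fun r hr => h ?_ hr.1⟩
    rw [Real.dist_eq, sub_zero, abs_of_pos hr.1]
    exact hr.2
  obtain ⟨ε, hε, hεf⟩ := exists_null_frontier_thickening volume (frontier s) hδ
  have hC := tendsto_card_lattice_inter L (hfb.thickening (δ := ε))
    Metric.isOpen_thickening.measurableSet hεf
  have hvolε : volume.real (Metric.thickening ε (frontier s)) / ZLattice.covolume L < η / 2 := by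
    rw [div_lt_iff₀ hcov]
    have h1 : volume.real (Metric.thickening ε (frontier s)) < η / 4 * ZLattice.covolume L := by
      rw [Measure.real]
      exact (ENNReal.lt_ofReal_iff_toReal_lt hfb.thickening.measure_lt_top.ne).1 (hδs ε hε)
    nlinarith
  obtain ⟨N₁, hN₁⟩ := hA (η / 2) (by positivity)
  obtain ⟨N₂, hN₂⟩ := eventually_atTop.1 (hC.eventually (gt_mem_nhds hvolε))
  obtain ⟨N₃, hN₃⟩ := exists_nat_gt (‖v‖ / ε)
  refine ⟨max (max N₁ N₂) (max N₃ 1), fun n hn => ?_⟩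
  have hn1 : N₁ ≤ n := le_trans (le_trans (le_max_left _ _) (le_max_left _ _)) hn
  have hn2 : N₂ ≤ n := le_trans (le_trans (le_max_right _ _) (le_max_left _ _)) hn
  have hn3 : N₃ ≤ n := le_trans (le_trans (le_max_left _ _) (le_max_right _ _)) hn
  have hn4 : 1 ≤ n := le_trans (le_trans (le_max_right _ _) (le_max_right _ _)) hn
  have hn0 : (0 : ℝ) < n := by exact_mod_cast hn4
  have hr : (n : ℝ)⁻¹ ≠ 0 := inv_ne_zero hn0.ne'
  have hdist : ∀ x : E, dist ((n : ℝ)⁻¹ • x) ((n : ℝ)⁻¹ • (v + x)) < ε := by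
    intro x
    rw [smul_add, dist_eq_norm, sub_add_eq_sub_sub_swap, sub_self, zero_sub, norm_neg, norm_smul,
      norm_inv, Real.norm_natCast, inv_mul_lt_iff₀ hn0, mul_comm]
    have : ‖v‖ / ε < n := hN₃.trans_le (by exact_mod_cast hn3)
    rw [div_lt_iff₀ hε.1] at this
    linarith
  set A : Set E := {x : E | x ∈ L ∧ (n : ℝ)⁻¹ • x ∈ s}
  set B : Set E := {x : E | x ∈ L ∧ (n : ℝ)⁻¹ • (v + x) ∈ s}
  set C : Set E := {x : E | x ∈ L ∧ (n : ℝ)⁻¹ • x ∈ Metric.thickening ε (frontier s)}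
  have hAf : A.Finite := by simpa using finite_lattice_inter_smul_add L hs₁ 0 hr
  have hBf : B.Finite := finite_lattice_inter_smul_add L hs₁ v hr
  have hCf : C.Finite := by
    simpa using finite_lattice_inter_smul_add L (hfb.thickening (δ := ε)) 0 hr
  have hAB : A ⊆ B ∪ C := by
    rintro x ⟨hx, hxs⟩
    by_cases h : (n : ℝ)⁻¹ • (v + x) ∈ s
    · exact Or.inl ⟨hx, h⟩
    · exact Or.inr ⟨hx, (mem_thickening_frontier_of_mem_of_notMem hxs h (hdist x)).1⟩
  have hBA : B ⊆ A ∪ C := by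
    rintro x ⟨hx, hxs⟩
    by_cases h : (n : ℝ)⁻¹ • x ∈ s
    · exact Or.inl ⟨hx, h⟩
    · refine Or.inr ⟨hx, (mem_thickening_frontier_of_mem_of_notMem hxs h ?_).2⟩
      rw [dist_comm]
      exact hdist x
  have hABc : (Nat.card A : ℝ) ≤ Nat.card B + Nat.card C := by
    rw [Nat.card_coe_set_eq, Nat.card_coe_set_eq, Nat.card_coe_set_eq]
    exact_mod_cast (Set.ncard_le_ncard hAB (hBf.union hCf)).trans (Set.ncard_union_le _ _)
  have hBAc : (Nat.card B : ℝ) ≤ Nat.card A + Nat.card C := by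
    rw [Nat.card_coe_set_eq, Nat.card_coe_set_eq, Nat.card_coe_set_eq]
    exact_mod_cast (Set.ncard_le_ncard hBA (hAf.union hCf)).trans (Set.ncard_union_le _ _)
  have hd : (0 : ℝ) < n ^ Module.finrank ℝ E := by positivity
  have h1 := hN₁ n hn1
  have h2 := hN₂ n hn2
  rw [Real.dist_eq, abs_lt] at h1 ⊢
  have h3 : (Nat.card A : ℝ) / n ^ Module.finrank ℝ E ≤
      Nat.card B / n ^ Module.finrank ℝ E + Nat.card C / n ^ Module.finrank ℝ E := by
    rw [← add_div]; gcongr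
  have h4 : (Nat.card B : ℝ) / n ^ Module.finrank ℝ E ≤
      Nat.card A / n ^ Module.finrank ℝ E + Nat.card C / n ^ Module.finrank ℝ E := by
    rw [← add_div]; gcongr
  constructor <;> linarith

/-- A monotone function with `f (n ^ d) ∼ a * n ^ d` along the naturals satisfies `f c ∼ a * c`. -/
theorem tendsto_div_of_tendsto_pow_div {f : ℝ → ℝ} (hf : Monotone f) (hf0 : ∀ x, 0 ≤ f x) {d : ℕ}
    (hd : d ≠ 0) {a : ℝ} (h : Tendsto (fun n : ℕ => f ((n : ℝ) ^ d) / (n : ℝ) ^ d) atTop (𝓝 a)) :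
    Tendsto (fun c => f c / c) atTop (𝓝 a) := by
  set m : ℝ → ℕ := fun c => ⌊c ^ (d : ℝ)⁻¹⌋₊
  have hdpos : 0 < (d : ℝ)⁻¹ := inv_pos.2 (Nat.cast_pos.2 (Nat.pos_of_ne_zero hd))
  have hm : Tendsto m atTop atTop := tendsto_nat_floor_atTop.comp (tendsto_rpow_atTop hdpos)
  have hm1 : Tendsto (fun c => m c + 1) atTop atTop := (tendsto_add_atTop_nat 1).comp hm
  have hratio : Tendsto (fun n : ℕ => ((n : ℝ) / (n + 1)) ^ d) atTop (𝓝 1) := by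
    simpa using (tendsto_natCast_div_add_atTop (𝕜 := ℝ) 1).pow d
  have hratio' : Tendsto (fun n : ℕ => (((n : ℝ) / (n + 1)) ^ d)⁻¹) atTop (𝓝 1) := by
    simpa using hratio.inv₀ one_ne_zero
  have hlow : Tendsto (fun c => f ((m c : ℝ) ^ d) / (m c : ℝ) ^ d * ((m c : ℝ) / (m c + 1)) ^ d)
      atTop (𝓝 a) := by
    simpa using (h.comp hm).mul (hratio.comp hm)
  have hupp : Tendsto (fun c => f (((m c + 1 : ℕ) : ℝ) ^ d) / ((m c + 1 : ℕ) : ℝ) ^ d *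
      (((m c : ℝ) / (m c + 1)) ^ d)⁻¹) atTop (𝓝 a) := by
    simpa using (h.comp hm1).mul (hratio'.comp hm)
  have hbounds : ∀ᶠ c in atTop, 0 < (m c : ℝ) ∧ (m c : ℝ) ^ d ≤ c ∧ c ≤ ((m c : ℝ) + 1) ^ d := by
    filter_upwards [eventually_gt_atTop 0, hm.eventually (eventually_gt_atTop 0)] with c hc hmc
    have hc' : (c ^ (d : ℝ)⁻¹) ^ d = c := Real.rpow_inv_natCast_pow hc.le hd
    refine ⟨by exact_mod_cast hmc, ?_, ?_⟩
    · calc (m c : ℝ) ^ d ≤ (c ^ (d : ℝ)⁻¹) ^ d := by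
            gcongr; exact Nat.floor_le (Real.rpow_nonneg hc.le _)
        _ = c := hc'
    · calc c = (c ^ (d : ℝ)⁻¹) ^ d := hc'.symm
        _ ≤ ((m c : ℝ) + 1) ^ d := by
            gcongr; exact (Nat.lt_floor_add_one _).le
  refine tendsto_of_tendsto_of_tendsto_of_le_of_le' hlow hupp ?_ ?_
  · filter_upwards [hbounds, eventually_gt_atTop 0] with c ⟨h0, h1, h2⟩ hc
    rw [div_pow, div_mul_div_cancel₀ (by positivity)]
    exact div_le_div₀ (hf0 _) (hf h1) hc h2
  · filter_upwards [hbounds, eventually_gt_atTop 0] with c ⟨h0, h1, h2⟩ hc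
    push_cast
    rw [div_pow, inv_div, div_mul_div_cancel₀ (by positivity)]
    exact div_le_div₀ (hf0 _) (hf h2) (by positivity) h1

/-- Counting points of a translated lattice in a cone, bounded by a homogeneous function. -/
theorem tendsto_card_translate_lattice_cone [Nontrivial E] {X : Set E} {F : E → ℝ}
    (hX : ∀ ⦃x⦄ ⦃r : ℝ⦄, x ∈ X → 0 < r → r • x ∈ X)
    (h₁ : ∀ x ⦃r : ℝ⦄, 0 ≤ r → F (r • x) = r ^ Module.finrank ℝ E * (F x))
    (h₂ : Bornology.IsBounded {x | x ∈ X ∧ F x ≤ 1}) (h₃ : MeasurableSet {x | x ∈ X ∧ F x ≤ 1})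
    (h₄ : volume (frontier {x | x ∈ X ∧ F x ≤ 1}) = 0) (v : E) :
    (∀ c : ℝ, {x : E | x ∈ L ∧ v + x ∈ X ∧ F (v + x) ≤ c}.Finite) ∧
    Tendsto (fun c : ℝ ↦ (Nat.card {x : E | x ∈ L ∧ v + x ∈ X ∧ F (v + x) ≤ c} : ℝ) / c)
      atTop (𝓝 (volume.real {x | x ∈ X ∧ F x ≤ 1} / ZLattice.covolume L)) := by
  have hd : Module.finrank ℝ E ≠ 0 := Module.finrank_pos.ne'
  have hscale : ∀ n : ℕ, 0 < n → {x : E | x ∈ L ∧ v + x ∈ X ∧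
      F (v + x) ≤ (n : ℝ) ^ Module.finrank ℝ E} =
      {x : E | x ∈ L ∧ (n : ℝ)⁻¹ • (v + x) ∈ {x | x ∈ X ∧ F x ≤ 1}} := by
    intro n hn
    have hn0 : (0 : ℝ) < n := Nat.cast_pos.2 hn
    ext x
    refine and_congr_right fun _ => and_congr ?_ ?_
    · refine ⟨fun h => hX h (inv_pos.2 hn0), fun h => ?_⟩
      simpa [smul_smul, mul_inv_cancel₀ hn0.ne'] using hX h hn0
    · rw [h₁ _ (inv_pos.2 hn0).le, inv_pow, inv_mul_le_iff₀ (by positivity), mul_one]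
  have hfin : ∀ c : ℝ, {x : E | x ∈ L ∧ v + x ∈ X ∧ F (v + x) ≤ c}.Finite := by
    intro c
    obtain ⟨n, hn⟩ := exists_nat_ge (max c 1)
    have hn1 : (1 : ℝ) ≤ n := (le_max_right _ _).trans hn
    have hn0 : 0 < n := by
      rw [← Nat.cast_pos (α := ℝ)]
      linarith
    refine Set.Finite.subset (s := {x : E | x ∈ L ∧ v + x ∈ X ∧
      F (v + x) ≤ (n : ℝ) ^ Module.finrank ℝ E}) ?_ ?_
    · rw [hscale n hn0]
      exact finite_lattice_inter_smul_add L h₂ v (inv_ne_zero (Nat.cast_ne_zero.2 hn0.ne'))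
    · rintro x ⟨hx, hxX, hxF⟩
      refine ⟨hx, hxX, hxF.trans (((le_max_left _ _).trans hn).trans ?_)⟩
      exact le_self_pow₀ hn1 hd
  refine ⟨hfin, tendsto_div_of_tendsto_pow_div
    (f := fun c => (Nat.card {x : E | x ∈ L ∧ v + x ∈ X ∧ F (v + x) ≤ c} : ℝ)) ?_
    (fun _ => Nat.cast_nonneg _) hd ?_⟩
  · intro c c' hcc
    simp only [Nat.cast_le]
    exact Nat.card_mono (hfin c') fun x hx => ⟨hx.1, hx.2.1, hx.2.2.trans hcc⟩
  · refine (tendsto_card_translate_lattice_inter L h₂ h₃ h₄ v).congr' ?_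
    filter_upwards [eventually_gt_atTop 0] with n hn
    rw [hscale n hn]
    rfl

end Lattice

open NumberField.mixedEmbedding in
/-- The algebraic integers whose mixed embedding lies in the fundamental cone. -/
def coneIntegers (K : Type*) [Field K] [NumberField K] : Set (𝓞 K) :=
  {β | mixedEmbedding K β ∈ fundamentalCone K}

open NumberField.mixedEmbedding NumberField.mixedEmbedding.euclidean
  NumberField.mixedEmbedding.fundamentalCone in
open scoped Classical in
/-- Integers of the fundamental cone are equidistributed among the cosets of an ideal. -/
theorem exists_tendsto_card_coneIntegers_coset (K : Type*) [Field K] [NumberField K] :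
    ∃ κ : ℝ, 0 < κ ∧ ∀ J : Ideal (𝓞 K), J ≠ ⊥ → ∀ v : 𝓞 K,
      (∀ c : ℝ, {β : 𝓞 K | β ∈ coneIntegers K ∧ β - v ∈ J ∧
        (Ideal.absNorm (Ideal.span {β}) : ℝ) ≤ c}.Finite) ∧
      Tendsto (fun c : ℝ => (Nat.card {β : 𝓞 K | β ∈ coneIntegers K ∧ β - v ∈ J ∧
        (Ideal.absNorm (Ideal.span {β}) : ℝ) ≤ c} : ℝ) / c) atTop
        (𝓝 (κ / Ideal.absNorm J)) := by
  set X : Set (euclidean.mixedSpace K) := (toMixed K) ⁻¹' (fundamentalCone K)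
  set F : euclidean.mixedSpace K → ℝ := fun x ↦ mixedEmbedding.norm (toMixed K x)
  have h₀ : {x | x ∈ fundamentalCone K ∧ mixedEmbedding.norm x ≤ 1} = normLeOne K := by
    ext; simp
  have hXF : {x | x ∈ X ∧ F x ≤ 1} = toMixed K ⁻¹' normLeOne K := by rw [← h₀]; rfl
  have hX : ∀ ⦃x⦄ ⦃r : ℝ⦄, x ∈ X → 0 < r → r • x ∈ X := by
    intro x r hx hr
    rwa [Set.mem_preimage, map_smul, smul_mem_iff_mem hr.ne']
  have h₁ : ∀ x ⦃r : ℝ⦄, 0 ≤ r →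
      F (r • x) = r ^ Module.finrank ℝ (euclidean.mixedSpace K) * (F x) := by
    intro x r hr
    simp only [F]
    rw [map_smul, mixedEmbedding.norm_smul, euclidean.finrank, abs_of_nonneg hr]
  have h₂ : Bornology.IsBounded {x | x ∈ X ∧ F x ≤ 1} := by
    rw [hXF]
    exact (toMixed K).antilipschitz.isBounded_preimage (isBounded_normLeOne K)
  have h₃ : MeasurableSet {x | x ∈ X ∧ F x ≤ 1} := by
    rw [hXF]
    exact (toMixed K).continuous.measurable (measurableSet_normLeOne K)
  have h₄ : volume (frontier {x | x ∈ X ∧ F x ≤ 1}) = 0 := by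
    rw [hXF, ← (toMixed K).coe_toHomeomorph, ← Homeomorph.preimage_frontier,
      (toMixed K).coe_toHomeomorph, (volumePreserving_toMixed K).measure_preimage
      measurableSet_frontier.nullMeasurableSet, volume_frontier_normLeOne]
  have hvol : 0 < volume.real {x | x ∈ X ∧ F x ≤ 1} := by
    rw [hXF, measureReal_def, (volumePreserving_toMixed K).measure_preimage
      (measurableSet_normLeOne K).nullMeasurableSet, volume_normLeOne]
    have := Units.regulator_pos K
    have := Real.pi_pos
    simp only [ENNReal.toReal_mul, ENNReal.toReal_pow, ENNReal.toReal_ofNat,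
      ENNReal.coe_toReal, NNReal.coe_real_pi, ENNReal.toReal_ofReal (Units.regulator_pos K).le]
    positivity
  have hdisc : (0 : ℝ) < (2 : ℝ)⁻¹ ^ InfinitePlace.nrComplexPlaces K * √|discr K| := by
    have : (0 : ℝ) < |(discr K : ℝ)| := abs_pos.2 (Int.cast_ne_zero.2 (discr_ne_zero K))
    positivity
  refine ⟨volume.real {x | x ∈ X ∧ F x ≤ 1} /
    ((2 : ℝ)⁻¹ ^ InfinitePlace.nrComplexPlaces K * √|discr K|), div_pos hvol hdisc, ?_⟩
  intro J hJ v
  set J' : nonZeroDivisors (Ideal (𝓞 K)) := ⟨J, mem_nonZeroDivisors_of_ne_zero hJ⟩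
  set L := ZLattice.comap ℝ (mixedEmbedding.idealLattice K (FractionalIdeal.mk0 K J'))
    (toMixed K).toLinearMap
  have hcov : ZLattice.covolume L =
      Ideal.absNorm J * ((2 : ℝ)⁻¹ ^ InfinitePlace.nrComplexPlaces K * √|discr K|) := by
    rw [ZLattice.covolume_comap _ _ _ (volumePreserving_toMixed K), covolume_idealLattice,
      FractionalIdeal.coe_mk0, FractionalIdeal.coeIdeal_absNorm, Rat.cast_natCast]
    ring
  obtain ⟨hfin, htend⟩ := tendsto_card_translate_lattice_cone L hX h₁ h₂ h₃ h₄
    ((toMixed K).symm (mixedEmbedding K v))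
  set φ : 𝓞 K → euclidean.mixedSpace K := fun β =>
    (toMixed K).symm (mixedEmbedding K ((β - v : 𝓞 K) : K))
  have hφ : Function.Injective φ := by
    intro a b hab
    have := mixedEmbedding_injective K ((toMixed K).symm.injective hab)
    simpa using this
  have himg : ∀ c : ℝ, φ '' {β : 𝓞 K | β ∈ coneIntegers K ∧ β - v ∈ J ∧
        (Ideal.absNorm (Ideal.span {β}) : ℝ) ≤ c} =
      {x | x ∈ L ∧ (toMixed K).symm (mixedEmbedding K v) + x ∈ X ∧
        F ((toMixed K).symm (mixedEmbedding K v) + x) ≤ c} := by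
    intro c
    have hsum : ∀ β : 𝓞 K, toMixed K ((toMixed K).symm (mixedEmbedding K v) + φ β) =
        mixedEmbedding K β := by
      intro β
      simp [φ]
    have hnorm : ∀ β : 𝓞 K, mixedEmbedding.norm (mixedEmbedding K β) =
        (Ideal.absNorm (Ideal.span {β}) : ℝ) := by
      intro β
      rw [norm_eq_norm, Ideal.absNorm_span_singleton, ← Algebra.coe_norm_int]
      simp [Nat.cast_natAbs]
    ext x
    constructor
    · rintro ⟨β, ⟨hβ₁, hβ₂, hβ₃⟩, rfl⟩
      refine ⟨?_, ?_, ?_⟩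
      · change toMixed K (φ β) ∈ mixedEmbedding.idealLattice K (FractionalIdeal.mk0 K J')
        rw [mem_idealLattice]
        exact ⟨_, (FractionalIdeal.mem_coeIdeal _).2 ⟨_, hβ₂, rfl⟩, by simp [φ]⟩
      · rw [Set.mem_preimage, hsum]
        exact hβ₁
      · simp only [F]
        rwa [hsum, hnorm]
    · rintro ⟨hx₁, hx₂, hx₃⟩
      change toMixed K x ∈ mixedEmbedding.idealLattice K (FractionalIdeal.mk0 K J') at hx₁
      rw [mem_idealLattice] at hx₁
      obtain ⟨_, hy, hyx⟩ := hx₁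
      obtain ⟨y, hyJ, rfl⟩ := (FractionalIdeal.mem_coeIdeal _).1 hy
      have hxφ : φ (y + v) = x := by
        simp only [φ]
        rw [add_sub_cancel_right, hyx]
        simp
      rw [← hxφ] at hx₂ hx₃
      simp only [F] at hx₃
      rw [Set.mem_preimage] at hx₂
      rw [hsum] at hx₂ hx₃
      rw [hnorm] at hx₃
      refine ⟨y + v, ⟨hx₂, by simpa using hyJ, hx₃⟩, hxφ⟩
  refine ⟨fun c => ?_, ?_⟩
  · refine Set.Finite.of_finite_image ?_ hφ.injOn
    rw [himg]
    exact hfin c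
  · convert htend using 2
    · congr 2
      rw [← himg, Nat.card_image_of_injective hφ]
    · rw [hcov, div_div, mul_comm]

section Cone

variable {K : Type*} [Field K] [NumberField K]

theorem ne_zero_of_mem_coneIntegers {β : 𝓞 K} (h : β ∈ coneIntegers K) : β ≠ 0 := by
  rintro rfl
  exact h.2 (by simp)

theorem units_mul_mem_coneIntegers_iff {β : 𝓞 K} (h : β ∈ coneIntegers K) (u : (𝓞 K)ˣ) :
    (u : 𝓞 K) * β ∈ coneIntegers K ↔ u ∈ Units.torsion K := by
  rw [← mixedEmbedding.fundamentalCone.unit_smul_mem_iff_mem_torsion h u]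
  simp [coneIntegers, mixedEmbedding.unitSMul_smul]

theorem exists_units_mul_mem_coneIntegers {α : 𝓞 K} (h : α ≠ 0) :
    ∃ u : (𝓞 K)ˣ, (u : 𝓞 K) * α ∈ coneIntegers K := by
  have h0 : mixedEmbedding.norm (mixedEmbedding K (α : K)) ≠ 0 := by
    rw [mixedEmbedding.norm_eq_norm]
    simpa [Algebra.norm_eq_zero_iff] using h
  obtain ⟨u, hu⟩ := mixedEmbedding.fundamentalCone.exists_unit_smul_mem h0
  exact ⟨u, by simpa [coneIntegers, mixedEmbedding.unitSMul_smul] using hu⟩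

/-- Two integers of the cone generating the same ideal differ by a root of unity. -/
theorem exists_torsion_of_span_eq {β γ : 𝓞 K} (hβ : β ∈ coneIntegers K)
    (hγ : γ ∈ coneIntegers K) (h : Ideal.span {β} = Ideal.span {γ}) :
    ∃ u : Units.torsion K, ((u : (𝓞 K)ˣ) : 𝓞 K) * β = γ := by
  obtain ⟨u, hu⟩ := Ideal.span_singleton_eq_span_singleton.1 h
  rw [mul_comm] at hu
  exact ⟨⟨u, (units_mul_mem_coneIntegers_iff hβ u).1 (hu ▸ hγ)⟩, hu⟩

theorem card_coneIntegers_span_eq_le (s : Finset (𝓞 K)) (hs : ∀ β ∈ s, β ∈ coneIntegers K)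
    (I : Ideal (𝓞 K)) [DecidablePred fun β : 𝓞 K => Ideal.span {β} = I] :
    (s.filter fun β => Ideal.span {β} = I).card ≤ Units.torsionOrder K := by
  classical
  rcases (s.filter fun β => Ideal.span {β} = I).eq_empty_or_nonempty with h | ⟨β₀, h₀⟩
  · simp [h]
  rw [Finset.mem_filter] at h₀
  have : Fintype (Units.torsion K) := Fintype.ofFinite _
  rw [Units.torsionOrder, Nat.card_eq_fintype_card, ← Finset.card_univ]
  refine (Finset.card_le_card (t := Finset.univ.image fun u : Units.torsion K =>
    ((u : (𝓞 K)ˣ) : 𝓞 K) * β₀) fun β hβ => ?_).trans Finset.card_image_le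
  rw [Finset.mem_filter] at hβ
  obtain ⟨u, hu⟩ := exists_torsion_of_span_eq (hs _ h₀.1) (hs _ hβ.1) (h₀.2.trans hβ.2.symm)
  exact Finset.mem_image.2 ⟨u, Finset.mem_univ _, hu⟩

end Cone

theorem Ideal.one_le_absNorm {K : Type*} [Field K] [NumberField K] {I : Ideal (𝓞 K)} (h : I ≠ ⊥) :
    (1 : ℝ) ≤ Ideal.absNorm I := by
  exact_mod_cast Nat.one_le_iff_ne_zero.2 (mt Ideal.absNorm_eq_zero_iff.1 h)

/-- The number of nonzero ideals of norm at most `x` is `O(x)`, uniformly in `x`. -/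
theorem exists_card_absNorm_le_bound (K : Type*) [Field K] [NumberField K] :
    ∃ B : ℝ, 0 < B ∧ ∀ x : ℝ, 0 ≤ x → ∀ s : Finset (Ideal (𝓞 K)),
      (∀ I ∈ s, I ≠ ⊥ ∧ (Ideal.absNorm I : ℝ) ≤ x) → (s.card : ℝ) ≤ B * x := by
  have h := NumberField.Ideal.tendsto_norm_le_div_atTop K
  obtain ⟨L, hL⟩ : ∃ L, Tendsto (fun s : ℝ ↦
    (Nat.card {I : Ideal (𝓞 K) // (Ideal.absNorm I : ℝ) ≤ s} : ℝ) / s) atTop (𝓝 L) := ⟨_, h⟩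
  obtain ⟨x₀, hx₀⟩ := eventually_atTop.1 (hL.eventually (gt_mem_nhds (lt_add_one L)))
  have hfin : ∀ x : ℝ, Finite {I : Ideal (𝓞 K) // (Ideal.absNorm I : ℝ) ≤ x} := by
    intro x
    refine ((Ideal.finite_setOfPred_absNorm_le (S := 𝓞 K) ⌊x⌋₊).subset fun I hI => ?_).to_subtype
    exact Nat.le_floor hI
  have key : ∀ x : ℝ, ∀ s : Finset (Ideal (𝓞 K)), (∀ I ∈ s, (Ideal.absNorm I : ℝ) ≤ x) →
      s.card ≤ Nat.card {I : Ideal (𝓞 K) // (Ideal.absNorm I : ℝ) ≤ x} := by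
    intro x s hs
    have := hfin x
    have h1 := Nat.card_le_card_of_injective
      (fun I : s => (⟨I.1, hs I.1 I.2⟩ : {I : Ideal (𝓞 K) // (Ideal.absNorm I : ℝ) ≤ x}))
      fun I J h => Subtype.ext (by simpa using h)
    simpa using h1
  set y := max x₀ 1
  set N := Nat.card {I : Ideal (𝓞 K) // (Ideal.absNorm I : ℝ) ≤ y}
  refine ⟨|L| + 1 + N, by positivity, fun x hx s hs => ?_⟩
  rcases lt_or_ge x 1 with h1 | h1
  · have : s = ∅ := by
      refine Finset.eq_empty_of_forall_notMem fun I hI => ?_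
      linarith [(hs I hI).2, Ideal.one_le_absNorm (hs I hI).1]
    simp only [this, Finset.card_empty, Nat.cast_zero]
    positivity
  rcases lt_or_ge x y with h2 | h2
  · have h3 := key y s fun I hI => (hs I hI).2.trans h2.le
    calc (s.card : ℝ) ≤ N := by exact_mod_cast h3
      _ ≤ (N : ℝ) * x := le_mul_of_one_le_right (by positivity) h1
      _ ≤ (|L| + 1 + N) * x := by
        gcongr
        have := abs_nonneg L
        linarith
  · have h3 := hx₀ x ((le_max_left _ _).trans h2)
    rw [div_lt_iff₀ (by linarith)] at h3
    calc (s.card : ℝ) ≤ _ := by exact_mod_cast key x s fun I hI => (hs I hI).2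
      _ ≤ (L + 1) * x := h3.le
      _ ≤ (|L| + 1 + N) * x := by
        refine mul_le_mul_of_nonneg_right ?_ hx
        linarith [le_abs_self L, (Nat.cast_nonneg N : (0 : ℝ) ≤ N)]

/-- The series `∑ N(I)⁻²` over the nonzero ideals converges. -/
theorem summable_absNorm_inv_sq (K : Type*) [Field K] [NumberField K] :
    Summable fun I : {I : Ideal (𝓞 K) // I ≠ ⊥} => ((Ideal.absNorm I.1 : ℝ) ^ 2)⁻¹ := by
  classical
  obtain ⟨B, hB, hcard⟩ := exists_card_absNorm_le_bound K
  refine summable_of_sum_le (c := 2 * B * ∑' j : ℕ, (1 / 2 : ℝ) ^ j) (fun _ => by positivity)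
    fun s => ?_
  set f : {I : Ideal (𝓞 K) // I ≠ ⊥} → ℕ := fun I => Nat.log 2 (Ideal.absNorm I.1)
  rw [← Finset.sum_fiberwise_of_maps_to (t := s.image f) (g := f)
    (fun I hI => Finset.mem_image_of_mem f hI), mul_assoc, ← tsum_mul_left, ← tsum_mul_left]
  have hsum : Summable fun j : ℕ => 2 * (B * (1 / 2 : ℝ) ^ j) :=
    ((summable_geometric_of_lt_one (by norm_num) (by norm_num)).mul_left B).mul_left 2
  refine le_trans (Finset.sum_le_sum fun j _ => ?_) (hsum.sum_le_tsum _ fun _ _ => by positivity)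
  have hne : ∀ I : {I : Ideal (𝓞 K) // I ≠ ⊥}, Ideal.absNorm I.1 ≠ 0 := fun I =>
    mt Ideal.absNorm_eq_zero_iff.1 I.2
  have h1 : ∀ I ∈ s.filter (fun I => f I = j), ((Ideal.absNorm I.1 : ℝ) ^ 2)⁻¹ ≤ (4 ^ j)⁻¹ := by
    intro I hI
    rw [Finset.mem_filter] at hI
    have : 2 ^ j ≤ Ideal.absNorm I.1 := hI.2 ▸ Nat.pow_log_le_self 2 (hne I)
    gcongr
    rw [show (4 : ℝ) = 2 ^ 2 by norm_num, ← pow_mul, mul_comm, pow_mul]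
    gcongr
    exact_mod_cast this
  refine (Finset.sum_le_card_nsmul _ _ _ h1).trans ?_
  rw [nsmul_eq_mul]
  have h2 := hcard (2 ^ (j + 1)) (by positivity)
    ((s.filter (fun I => f I = j)).map ⟨Subtype.val, Subtype.val_injective⟩) (by
      intro I hI
      simp only [Finset.mem_map, Finset.mem_filter, Function.Embedding.coeFn_mk] at hI
      obtain ⟨I, ⟨-, hI⟩, rfl⟩ := hI
      refine ⟨I.2, ?_⟩
      have h3 := (Nat.lt_pow_succ_log_self one_lt_two (Ideal.absNorm I.1)).le
      rw [show Nat.log 2 (Ideal.absNorm I.1) = j from hI] at h3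
      exact_mod_cast h3)
  rw [Finset.card_map] at h2
  calc _ ≤ B * 2 ^ (j + 1) * (4 ^ j)⁻¹ := by gcongr
    _ = 2 * (B * (1 / 2) ^ j) := by
      rw [show (4 : ℝ) = 2 * 2 by norm_num, mul_pow, pow_succ, one_div, inv_pow]
      field_simp

section Sieve

theorem natCard_setOf_and_eq_card_filter {α : Type*} {s : Set α} (hs : s.Finite) (Q : α → Prop)
    [DecidablePred Q] : Nat.card {x | x ∈ s ∧ Q x} = (hs.toFinset.filter Q).card := by
  rw [Nat.card_coe_set_eq, ← Set.ncard_coe_finset]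
  congr 1
  ext x
  simp

variable {K : Type*} [Field K] [NumberField K]

theorem Ideal.finite_setOf_dvd {J : Ideal (𝓞 K)} (hJ : J ≠ ⊥) :
    {I : Ideal (𝓞 K) | I ∣ J}.Finite := by
  classical
  have := UniqueFactorizationMonoid.fintypeSubtypeDvd J hJ
  exact Set.finite_coe_iff.1 (inferInstanceAs (Finite {I : Ideal (𝓞 K) // I ∣ J}))

theorem Ideal.isCoprime_of_not_dvd {p A : Ideal (𝓞 K)} (hp : p.IsPrime) (hp0 : p ≠ ⊥)
    (h : ¬ p ∣ A) : IsCoprime A p := by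
  rw [Ideal.isCoprime_iff_sup_eq, sup_comm]
  by_contra h1
  have h2 := (hp.isMaximal hp0).eq_of_le h1 le_sup_left
  exact h (Ideal.dvd_iff_le.2 (h2 ▸ le_sup_right))

/-- Intersecting a coset of `A * M` with a submodule `M * E`, `E` coprime to `A`. -/
theorem Ideal.sub_mem_mul_iff_of_coprime {R : Type*} [CommRing R] {A E M : Ideal R} {a e v β : R}
    (ha : a ∈ A) (he : e ∈ E) (hae : a + e = 1) (hv : v ∈ M) :
    (β - v ∈ A * M ∧ β ∈ M * E) ↔ β - e * v ∈ A * M * E := by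
  have hv' : e * v = v - a * v := by linear_combination v * hae
  constructor
  · rintro ⟨h1, h2⟩
    have h3 : β - e * v ∈ A * M := by
      rw [show β - e * v = (β - v) + a * v by linear_combination -v * hae]
      exact add_mem h1 (Ideal.mul_mem_mul ha hv)
    have h4 : β - e * v ∈ M * E := sub_mem h2 (by rw [mul_comm e]; exact Ideal.mul_mem_mul hv he)
    rw [show β - e * v = a * (β - e * v) + (β - e * v) * e by linear_combination -(β - e * v) * hae]
    exact add_mem (by rw [mul_assoc]; exact Ideal.mul_mem_mul ha h4) (Ideal.mul_mem_mul h3 he)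
  · intro h
    have h1 : A * M * E ≤ A * M := Ideal.mul_le_left
    have h2 : A * M * E ≤ M * E := by rw [mul_assoc]; exact Ideal.mul_le_right
    constructor
    · rw [show β - v = (β - e * v) - a * v by linear_combination v * hae]
      exact sub_mem (h1 h) (Ideal.mul_mem_mul ha hv)
    · rw [show β = (β - e * v) + v * e by ring]
      exact add_mem (h2 h) (Ideal.mul_mem_mul hv he)

theorem Ideal.squarefree_iff_forall_prime {F : Ideal (𝓞 K)} (hF : F ≠ ⊥) :
    Squarefree F ↔ ∀ p : Ideal (𝓞 K), p.IsPrime → p ≠ ⊥ → ¬ p ^ 2 ∣ F := by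
  rw [squarefree_iff_irreducible_sq_not_dvd_of_ne_zero hF]
  refine forall_congr' fun p => ?_
  rw [pow_two]
  constructor
  · exact fun h h1 h2 => h (Ideal.prime_of_isPrime h2 h1).irreducible
  · intro h h1
    have := h1.prime
    exact h (Ideal.isPrime_of_prime this) this.ne_zero

/-- The squarefree sieve: among the integers `β` of the cone lying in a fixed residue class modulo
`A * M` which generates `M / (A * M)`, those with `(β) / M` squarefree have a density which does not
depend on `M` nor on the class. -/
theorem exists_tendsto_card_squarefree (K : Type*) [Field K] [NumberField K] (A : Ideal (𝓞 K))
    (hA : A ≠ ⊥) : ∃ κ : ℝ, 0 < κ ∧ ∀ M : Ideal (𝓞 K), M ≠ ⊥ → ∀ v : 𝓞 K,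
      Ideal.span {v} ⊔ A * M = M →
      (∀ X : ℝ, {β : 𝓞 K | β ∈ coneIntegers K ∧ β - v ∈ A * M ∧ ∃ F, Ideal.span {β} = M * F ∧
        Squarefree F ∧ (Ideal.absNorm F : ℝ) ≤ X}.Finite) ∧
      Tendsto (fun X : ℝ => (Nat.card {β : 𝓞 K | β ∈ coneIntegers K ∧ β - v ∈ A * M ∧
        ∃ F, Ideal.span {β} = M * F ∧ Squarefree F ∧ (Ideal.absNorm F : ℝ) ≤ X} : ℝ) / X) atTop
        (𝓝 κ) := by
  classical
  obtain ⟨κ, hκ, hcoset⟩ := exists_tendsto_card_coneIntegers_coset K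
  obtain ⟨B, hB, hbound⟩ := exists_card_absNorm_le_bound K
  let P := {p : Ideal (𝓞 K) // p.IsPrime ∧ p ≠ ⊥ ∧ ¬ p ∣ A}
  let f : P → ℝ := fun p => -((Ideal.absNorm p.1 : ℝ) ^ 2)⁻¹
  let E : Finset P → Ideal (𝓞 K) := fun T => (∏ p ∈ T, p.1) ^ 2
  have hPprime : ∀ p : P, Prime p.1 := fun p => Ideal.prime_of_isPrime p.2.2.1 p.2.1
  have hE0 : ∀ T, E T ≠ ⊥ := fun T =>
    pow_ne_zero 2 (Finset.prod_ne_zero_iff.2 fun p _ => (hPprime p).ne_zero)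
  have hf : Summable fun p => ‖f p‖ := by
    have h := (summable_absNorm_inv_sq K).comp_injective
      (i := fun p : P => (⟨p.1, p.2.2.1⟩ : {I : Ideal (𝓞 K) // I ≠ ⊥}))
      (fun p q h => Subtype.ext (by simpa using h))
    refine h.congr fun p => ?_
    simp [f]
  have hfE : ∀ T : Finset P, ∏ p ∈ T, f p = (-1) ^ T.card * (Ideal.absNorm (E T) : ℝ)⁻¹ := by
    intro T
    simp only [f, E, map_pow, map_prod, Nat.cast_pow, Nat.cast_prod]
    rw [Finset.prod_neg, Finset.prod_inv_distrib, Finset.prod_pow]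
  have hnorm : ∀ T : Finset P, ‖∏ p ∈ T, f p‖ = (Ideal.absNorm (E T) : ℝ)⁻¹ := by
    intro T; rw [hfE]; simp
  have hsumf : Summable fun T : Finset P => ∏ p ∈ T, f p := summable_finsetProd_of_summable_norm hf
  have hS : 0 < ∑' T : Finset P, ∏ p ∈ T, f p := by
    rw [← tprod_one_add hsumf]
    have hpos : ∀ p, 0 < 1 + f p := by
      intro p
      have h1 : (1 : ℝ) < Ideal.absNorm p.1 := by
        have h2 : Ideal.absNorm p.1 ≠ 1 := fun h => p.2.1.ne_top (Ideal.absNorm_eq_one_iff.1 h)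
        have h3 : Ideal.absNorm p.1 ≠ 0 := mt Ideal.absNorm_eq_zero_iff.1 p.2.2.1
        exact_mod_cast (by omega : 1 < Ideal.absNorm p.1)
      have : ((Ideal.absNorm p.1 : ℝ) ^ 2)⁻¹ < 1 := inv_lt_one_of_one_lt₀ (by nlinarith)
      simp only [f]; linarith
    refine lt_of_le_of_ne ?_ (tprod_one_add_ne_zero_of_summable (fun p => (hpos p).ne') hf).symm
    exact ge_of_tendsto (multipliable_one_add_of_summable hf).hasProd
      (Eventually.of_forall fun s => Finset.prod_nonneg fun p _ => (hpos p).le)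
  have hNA : (0 : ℝ) < Ideal.absNorm A := by linarith [Ideal.one_le_absNorm hA]
  refine ⟨κ / Ideal.absNorm A * ∑' T : Finset P, ∏ p ∈ T, f p, by positivity, fun M hM v hv => ?_⟩
  have hNM : (0 : ℝ) < Ideal.absNorm M := by linarith [Ideal.one_le_absNorm hM]
  have hvM : v ∈ M := by
    rw [← hv]; exact Ideal.mem_sup_left (Ideal.mem_span_singleton_self v)
  have hAM : A * M ≠ ⊥ := mul_ne_zero hA hM
  -- the integers of the class, up to a given norm
  let s : ℝ → Set (𝓞 K) := fun X => {β | β ∈ coneIntegers K ∧ β - v ∈ A * M ∧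
    (Ideal.absNorm (Ideal.span {β}) : ℝ) ≤ X * Ideal.absNorm M}
  have hsfin : ∀ X, (s X).Finite := fun X => (hcoset _ hAM v).1 _
  have hAM_le : A * M ≤ M := Ideal.mul_le_right
  have hmem : ∀ β, β - v ∈ A * M → β ∈ M := fun β h => by
    rw [← sub_add_cancel β v]; exact add_mem (hAM_le h) hvM
  have hfactor : ∀ β : 𝓞 K, β ∈ coneIntegers K → β - v ∈ A * M →
      ∃ F, Ideal.span {β} = M * F ∧ F ≠ ⊥ ∧ ∀ p : Ideal (𝓞 K), p.IsPrime → p ∣ F → ¬ p ∣ A := by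
    intro β h1 h2
    obtain ⟨F, hF⟩ := Ideal.dvd_span_singleton.2 (hmem β h2)
    refine ⟨F, hF, ?_, ?_⟩
    · rintro rfl
      exact ne_zero_of_mem_coneIntegers h1 (by simpa using hF)
    · intro p hp hpF hpA
      have h3 : M ≤ M * p := by
        have h4 : β ∈ M * p := by
          have : β ∈ M * F := hF ▸ Ideal.mem_span_singleton_self β
          exact Ideal.mul_mono_right (Ideal.le_of_dvd hpF) this
        have h5 : A * M ≤ M * p := by
          rw [mul_comm]; exact Ideal.mul_mono_right (Ideal.le_of_dvd hpA)
        have h6 : v ∈ M * p := by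
          rw [show v = β - (β - v) by ring]; exact sub_mem h4 (h5 h2)
        calc M = Ideal.span {v} ⊔ A * M := hv.symm
          _ ≤ M * p := sup_le ((Ideal.span_singleton_le_iff_mem _).2 h6) h5
      have h7 : M * p ∣ M * 1 := by rw [mul_one]; exact Ideal.dvd_iff_le.2 h3
      have := (mul_dvd_mul_iff_left hM).1 h7
      exact hp.ne_top (Ideal.isUnit_iff.1 (isUnit_of_dvd_one this))
  -- the primes whose square divides `(β) / M`
  let D : 𝓞 K → Set P := fun β => {p | β ∈ M * p.1 ^ 2}
  have hDfin : ∀ β : 𝓞 K, β ≠ 0 → (D β).Finite := by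
    intro β hβ
    refine Set.Finite.of_finite_image (f := fun p : P => p.1) ?_ Subtype.val_injective.injOn
    refine (Ideal.finite_setOf_dvd (J := Ideal.span {β}) (by simpa using hβ)).subset ?_
    rintro _ ⟨p, hp, rfl⟩
    exact ((dvd_pow_self p.1 two_ne_zero).mul_left M).trans (Ideal.dvd_span_singleton.2 hp)
  have hsq : ∀ (X : ℝ) (β : 𝓞 K), (β ∈ coneIntegers K ∧ β - v ∈ A * M ∧ ∃ F,
      Ideal.span {β} = M * F ∧ Squarefree F ∧ (Ideal.absNorm F : ℝ) ≤ X) ↔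
      β ∈ s X ∧ D β = ∅ := by
    intro X β
    constructor
    · rintro ⟨h1, h2, F, hF, hsqf, hX⟩
      refine ⟨⟨h1, h2, ?_⟩, ?_⟩
      · rw [hF, map_mul, mul_comm]; push_cast; gcongr
      · refine Set.eq_empty_of_forall_notMem fun p hp => ?_
        have hp' : M * p.1 ^ 2 ∣ M * F := hF ▸ Ideal.dvd_span_singleton.2 hp
        rw [mul_dvd_mul_iff_left hM, pow_two] at hp'
        exact (hPprime p).not_isUnit (hsqf _ hp')
    · rintro ⟨⟨h1, h2, h3⟩, h4⟩
      obtain ⟨F, hF, hF0, hFA⟩ := hfactor β h1 h2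
      refine ⟨h1, h2, F, hF, ?_, ?_⟩
      · rw [Ideal.squarefree_iff_forall_prime hF0]
        intro p hp hp0 hpF
        have hpA := hFA p hp ((dvd_pow_self p two_ne_zero).trans hpF)
        have h5 : β ∈ M * p ^ 2 := by
          refine Ideal.dvd_span_singleton.1 ?_
          rw [hF]; exact mul_dvd_mul_left M hpF
        exact h4.subset (show (⟨p, hp, hp0, hpA⟩ : P) ∈ D β from h5)
      · rw [hF, map_mul, mul_comm] at h3; push_cast at h3
        exact le_of_mul_le_mul_right h3 hNM
  have hsubset : ∀ X, {β : 𝓞 K | β ∈ coneIntegers K ∧ β - v ∈ A * M ∧ ∃ F,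
      Ideal.span {β} = M * F ∧ Squarefree F ∧ (Ideal.absNorm F : ℝ) ≤ X} ⊆ s X :=
    fun X β hβ => ((hsq X β).1 hβ).1
  refine ⟨fun X => (hsfin X).subset (hsubset X), ?_⟩
  have hTD : ∀ (T : Finset P) (β : 𝓞 K), β - v ∈ A * M → (β ∈ M * E T ↔ ∀ p ∈ T, p ∈ D β) := by
    intro T β hβ
    obtain ⟨F, hF⟩ := Ideal.dvd_span_singleton.2 (hmem β hβ)
    have h1 : ∀ I, β ∈ M * I ↔ I ∣ F := fun I => by
      rw [← Ideal.dvd_span_singleton, hF, mul_dvd_mul_iff_left hM]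
    simp only [D, Set.mem_ofPred_eq, h1, E]
    constructor
    · exact fun h p hp => (pow_dvd_pow_of_dvd (Finset.dvd_prod_of_mem _ hp) 2).trans h
    · intro h
      rw [← Finset.prod_pow]
      refine Finset.prod_dvd_of_coprime ?_ h
      intro p hp q hq hpq
      refine IsCoprime.pow ?_
      have := p.2.1.isMaximal p.2.2.1
      have := q.2.1.isMaximal q.2.2.1
      exact Ideal.isCoprime_of_isMaximal (fun h => hpq (Subtype.ext h))
  let c : ℝ → Finset P → ℝ := fun X T =>
    (Nat.card {β : 𝓞 K | β ∈ s X ∧ β ∈ M * E T} : ℝ)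
  have hcount : ∀ X, (Nat.card {β : 𝓞 K | β ∈ coneIntegers K ∧ β - v ∈ A * M ∧ ∃ F,
      Ideal.span {β} = M * F ∧ Squarefree F ∧ (Ideal.absNorm F : ℝ) ≤ X} : ℝ) =
      ∑' T : Finset P, (-1) ^ T.card * c X T := by
    intro X
    have hc : ∀ T, c X T = ∑ β ∈ (hsfin X).toFinset, if β ∈ M * E T then (1 : ℝ) else 0 := by
      intro T
      simp only [c]
      rw [Finset.sum_boole]
      rw [natCard_setOf_and_eq_card_filter]
    have hzero : ∀ β ∈ (hsfin X).toFinset, ∃ t : Finset P, (t : Set P) = D β ∧ ∀ T : Finset P,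
        (β ∈ M * E T ↔ T ∈ t.powerset) := by
      intro β hβ
      have hβ := (hsfin X).mem_toFinset.1 hβ
      have hfin := hDfin β (ne_zero_of_mem_coneIntegers hβ.1)
      refine ⟨hfin.toFinset, hfin.coe_toFinset, fun T => ?_⟩
      rw [hTD T β hβ.2.1, Finset.mem_powerset]
      exact ⟨fun h p hp => hfin.mem_toFinset.2 (h p hp), fun h p hp => hfin.mem_toFinset.1 (h hp)⟩
    simp_rw [hc, Finset.mul_sum]
    rw [Summable.tsum_finsetSum]
    · rw [show {β : 𝓞 K | β ∈ coneIntegers K ∧ β - v ∈ A * M ∧ ∃ F,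
        Ideal.span {β} = M * F ∧ Squarefree F ∧ (Ideal.absNorm F : ℝ) ≤ X} =
        {β | β ∈ s X ∧ D β = ∅} from Set.ext (hsq X), natCard_setOf_and_eq_card_filter (hsfin X),
        ← Finset.sum_boole]
      refine Finset.sum_congr rfl fun β hβ => ?_
      obtain ⟨t, ht, hT⟩ := hzero β hβ
      simp_rw [hT]
      rw [tsum_eq_sum (s := t.powerset) fun T hT => by rw [if_neg hT, mul_zero]]
      have h1 : (∑ T ∈ t.powerset, (-1 : ℝ) ^ T.card) = if t = ∅ then 1 else 0 := by
        exact_mod_cast congrArg (Int.cast : ℤ → ℝ) (Finset.sum_powerset_neg_one_pow_card (x := t))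
      rw [Finset.sum_congr rfl fun T hT => by rw [if_pos hT, mul_one], h1, ← ht]
      simp
    · intro β hβ
      obtain ⟨t, ht, hT⟩ := hzero β hβ
      refine summable_of_ne_finset_zero (s := t.powerset) fun T hT' => ?_
      rw [if_neg (mt (hT T).1 hT'), mul_zero]
  simp_rw [hcount]
  have hdct := tendsto_tsum_of_dominated_convergence (𝓕 := atTop)
    (f := fun (X : ℝ) (T : Finset P) => (-1) ^ T.card * c X T / X)
    (g := fun T => κ / Ideal.absNorm A * ∏ p ∈ T, f p)
    (bound := fun T => Units.torsionOrder K * B * ‖∏ p ∈ T, f p‖) ?_ ?_ ?_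
  · simp_rw [tsum_div_const, tsum_mul_left] at hdct
    exact hdct
  · exact hsumf.norm.mul_left _
  · intro T
    have hcop : A ⊔ E T = ⊤ := by
      rw [← Ideal.isCoprime_iff_sup_eq]
      refine IsCoprime.pow_right (IsCoprime.prod_right fun p _ => ?_)
      exact Ideal.isCoprime_of_not_dvd p.2.1 p.2.2.1 p.2.2.2
    obtain ⟨a, ha, e, he, hae⟩ := Submodule.mem_sup.1 ((Ideal.eq_top_iff_one _).1 hcop)
    have hAME : A * M * E T ≠ ⊥ := mul_ne_zero hAM (hE0 T)
    have h1 := ((hcoset _ hAME (e * v)).2.comp (tendsto_id.atTop_mul_const hNM)).const_mul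
      ((-1) ^ T.card * (Ideal.absNorm M : ℝ))
    rw [hfE]
    convert h1 using 2 with X
    · have h2 : {β : 𝓞 K | β ∈ s X ∧ β ∈ M * E T} = {β | β ∈ coneIntegers K ∧
          β - e * v ∈ A * M * E T ∧
          (Ideal.absNorm (Ideal.span {β}) : ℝ) ≤ X * Ideal.absNorm M} := by
        ext β
        simp only [s, Set.mem_ofPred_eq]
        rw [← Ideal.sub_mem_mul_iff_of_coprime ha he hae hvM]
        tauto
      simp only [c, h2, Function.comp_apply, id]
      field_simp
    · simp only [map_mul, Nat.cast_mul]
      field_simp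
  · filter_upwards [eventually_gt_atTop 0] with X hX T
    have hNE : (0 : ℝ) < Ideal.absNorm (E T) := by linarith [Ideal.one_le_absNorm (hE0 T)]
    rw [hnorm, norm_div, norm_mul, norm_pow, norm_neg, norm_one, one_pow, one_mul,
      Real.norm_of_nonneg hX.le, div_le_iff₀ hX]
    simp only [c]
    rw [natCard_setOf_and_eq_card_filter (hsfin X), Real.norm_natCast]
    set t := (hsfin X).toFinset.filter (· ∈ M * E T)
    have ht : ∀ β ∈ t, (β ∈ coneIntegers K ∧ β - v ∈ A * M ∧
        (Ideal.absNorm (Ideal.span {β}) : ℝ) ≤ X * Ideal.absNorm M) ∧ β ∈ M * E T := by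
      intro β hβ
      rw [Finset.mem_filter, (hsfin X).mem_toFinset] at hβ
      exact hβ
    have h1 : t.card ≤ Units.torsionOrder K * (t.image fun β => Ideal.span {β}).card :=
      Finset.card_le_mul_card_image _ _ fun I _ =>
        card_coneIntegers_span_eq_le _ (fun β hβ => (ht β hβ).1.1) I
    have h2 : ∀ I ∈ t.image fun β => Ideal.span {β}, ∃ H, I = M * E T * H ∧ H ≠ ⊥ ∧
        (Ideal.absNorm H : ℝ) ≤ X * (Ideal.absNorm (E T) : ℝ)⁻¹ := by
      intro I hI
      obtain ⟨β, hβ, rfl⟩ := Finset.mem_image.1 hI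
      obtain ⟨h3, h4⟩ := ht β hβ
      obtain ⟨H, hH⟩ := Ideal.dvd_span_singleton.2 h4
      refine ⟨H, hH, ?_, ?_⟩
      · rintro rfl
        exact ne_zero_of_mem_coneIntegers h3.1 (by simpa using hH)
      · have h5 := h3.2.2
        rw [hH] at h5
        simp only [map_mul, Nat.cast_mul] at h5
        rw [← div_eq_mul_inv, le_div_iff₀ hNE]
        refine le_of_mul_le_mul_right ?_ hNM
        linarith
    choose! H hH using h2
    have h3 : (t.image fun β => Ideal.span {β}).card ≤
        ((t.image fun β => Ideal.span {β}).image H).card := by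
      refine (Finset.card_image_of_injOn (f := H) ?_).ge
      intro I hI J hJ hIJ
      rw [(hH I hI).1, (hH J hJ).1]
      exact congrArg _ hIJ
    have h4 := hbound (X * (Ideal.absNorm (E T) : ℝ)⁻¹) (by positivity)
      ((t.image fun β => Ideal.span {β}).image H) (by
        intro J hJ
        obtain ⟨I, hI, rfl⟩ := Finset.mem_image.1 hJ
        exact (hH I hI).2)
    calc (t.card : ℝ) ≤ Units.torsionOrder K * (t.image fun β => Ideal.span {β}).card := by
          exact_mod_cast h1
      _ ≤ Units.torsionOrder K * ((t.image fun β => Ideal.span {β}).image H).card := by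
          gcongr
      _ ≤ Units.torsionOrder K * (B * (X * (Ideal.absNorm (E T) : ℝ)⁻¹)) := by gcongr
      _ = _ := by ring

end Sieve

end GeometryOfNumbers

section QuadraticField

variable {K L : Type*} [Field K] [Field L] [Algebra K L] {a : K} {θ : L}

theorem isIntegral_algebraMap_int_iff {x : K} :
    IsIntegral ℤ (algebraMap K L x) ↔ IsIntegral ℤ x :=
  isIntegral_algebraMap_iff (algebraMap K L).injective

theorem minpoly_add_mul_sqrt (hθ : θ ^ 2 = algebraMap K L a)
    (hθK : θ ∉ Set.range (algebraMap K L)) (u : K) {v : K} (hv : v ≠ 0) :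
    minpoly K (algebraMap K L u + algebraMap K L v * θ) =
      Polynomial.X ^ 2 - Polynomial.C (2 * u) * Polynomial.X +
        Polynomial.C (u ^ 2 - a * v ^ 2) := by
  open Polynomial in
  set q : K[X] := X ^ 2 - C (2 * u) * X + C (u ^ 2 - a * v ^ 2)
  have hq : q.Monic := by simp only [q]; monicity!
  have hdeg : q.natDegree = 2 := by simp only [q]; compute_degree!
  have hroot : aeval (algebraMap K L u + algebraMap K L v * θ) q = 0 := by
    simp only [q, map_add, map_sub, map_mul, map_pow, aeval_X, aeval_C, map_ofNat]
    linear_combination (algebraMap K L v) ^ 2 * hθ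
  have hintegral : IsIntegral K (algebraMap K L u + algebraMap K L v * θ) := ⟨q, hq, hroot⟩
  have h2 : 2 ≤ (minpoly K (algebraMap K L u + algebraMap K L v * θ)).natDegree := by
    rw [minpoly.two_le_natDegree_iff hintegral]
    rintro ⟨z, hz⟩
    refine hθK ⟨(z - u) / v, ?_⟩
    have hv' : algebraMap K L v ≠ 0 := by simpa using hv
    rw [map_div₀, map_sub, hz]
    field_simp
    ring
  refine (Polynomial.eq_of_monic_of_dvd_of_natDegree_le (minpoly.monic hintegral) hq
    (minpoly.dvd K _ hroot) (by omega)).symm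

/-- The conjugate of an integral element of a quadratic extension is integral. -/
theorem IsIntegral.sub_mul_sqrt (hθ : θ ^ 2 = algebraMap K L a)
    (hθK : θ ∉ Set.range (algebraMap K L)) {u v : K}
    (h : IsIntegral ℤ (algebraMap K L u + algebraMap K L v * θ)) :
    IsIntegral ℤ (algebraMap K L u - algebraMap K L v * θ) := by
  open Polynomial in
  rcases eq_or_ne v 0 with rfl | hv
  · simpa using h
  obtain ⟨p, hp, hp0⟩ := h
  refine ⟨p, hp, ?_⟩
  have h1 : minpoly K (algebraMap K L u + algebraMap K L v * θ) ∣ p.map (algebraMap ℤ K) := by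
    refine minpoly.dvd _ _ ?_
    rw [aeval_map_algebraMap]; exact hp0
  obtain ⟨r, hr⟩ := h1
  have h2 : aeval (algebraMap K L u - algebraMap K L v * θ) (p.map (algebraMap ℤ K)) = 0 := by
    rw [hr, minpoly_add_mul_sqrt hθ hθK u hv, map_mul]
    convert! zero_mul _
    simp only [map_add, map_sub, map_mul, map_pow, aeval_X, aeval_C, map_ofNat]
    linear_combination (algebraMap K L v) ^ 2 * hθ
  rw [aeval_map_algebraMap] at h2
  exact h2

theorem isIntegral_add_mul_sqrt_iff (hθ : θ ^ 2 = algebraMap K L a)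
    (hθK : θ ∉ Set.range (algebraMap K L)) {u v : K} :
    IsIntegral ℤ (algebraMap K L u + algebraMap K L v * θ) ↔
      IsIntegral ℤ (2 * u) ∧ IsIntegral ℤ (u ^ 2 - a * v ^ 2) := by
  constructor
  · intro h
    have h' := IsIntegral.sub_mul_sqrt hθ hθK h
    constructor
    · rw [← isIntegral_algebraMap_int_iff (L := L)]
      convert! h.add h' using 1
      simp only [map_mul, map_ofNat]; ring
    · rw [← isIntegral_algebraMap_int_iff (L := L)]
      convert! h.mul h' using 1
      simp only [map_sub, map_mul, map_pow]
      linear_combination (algebraMap K L v) ^ 2 * hθ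
  · rintro ⟨h1, h2⟩
    rw [← isIntegral_algebraMap_int_iff (L := L)] at h1 h2
    set γ := algebraMap K L u + algebraMap K L v * θ
    have h3 : γ ^ 2 - algebraMap K L (2 * u) * γ + algebraMap K L (u ^ 2 - a * v ^ 2) = 0 := by
      simp only [γ, map_sub, map_mul, map_pow, map_ofNat]
      linear_combination (algebraMap K L v) ^ 2 * hθ
    set A := integralClosure ℤ L
    suffices IsIntegral A γ from isIntegral_trans (R := ℤ) (A := A) γ this
    refine ⟨Polynomial.X ^ 2 - Polynomial.C ⟨_, h1⟩ * Polynomial.X + Polynomial.C ⟨_, h2⟩, ?_, ?_⟩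
    · monicity!
    · simpa using h3

theorem exists_eq_add_mul_sqrt (hL : Module.finrank K L = 2)
    (hθK : θ ∉ Set.range (algebraMap K L)) :
    ∃ b : Module.Basis (Fin 2) K L, b 0 = 1 ∧ b 1 = θ := by
  have hli : LinearIndependent K ![(1 : L), θ] := by
    rw [LinearIndependent.pair_iff' one_ne_zero]
    intro x hx
    exact hθK ⟨x, by rw [← hx, Algebra.smul_def, mul_one]⟩
  have : Nonempty (Fin 2) := ⟨0⟩
  refine ⟨basisOfLinearIndependentOfCardEqFinrank hli (by simp [hL]), ?_, ?_⟩ <;> simp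

theorem trace_sqrt_eq_zero (hL : Module.finrank K L = 2) (hθ : θ ^ 2 = algebraMap K L a)
    (hθK : θ ∉ Set.range (algebraMap K L)) : Algebra.trace K L θ = 0 := by
  obtain ⟨b, h0, h1⟩ := exists_eq_add_mul_sqrt hL hθK
  rw [Algebra.trace_eq_matrix_trace b, Matrix.trace_fin_two]
  simp only [Algebra.leftMulMatrix_eq_repr_mul, h0, h1]
  have e1 : θ * 1 = b 1 := by rw [h1, mul_one]
  have e2 : θ * θ = a • b 0 := by rw [h0, Algebra.smul_def, mul_one, ← hθ, pow_two]
  rw [e1, e2]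
  simp

theorem discr_one_sqrt (hL : Module.finrank K L = 2) (hθ : θ ^ 2 = algebraMap K L a)
    (hθK : θ ∉ Set.range (algebraMap K L)) : Algebra.discr K ![(1 : L), θ] = 4 * a := by
  rw [Algebra.discr_def, Matrix.det_fin_two]
  simp only [Algebra.traceMatrix_apply, Algebra.traceForm_apply, Matrix.cons_val_zero,
    Matrix.cons_val_one, mul_one, one_mul, trace_sqrt_eq_zero hL hθ hθK]
  rw [← pow_two, hθ, Algebra.trace_algebraMap, hL, ← map_one (algebraMap K L),
    Algebra.trace_algebraMap, hL]
  simp only [nsmul_eq_mul]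
  push_cast
  ring

theorem discr_pair (hL : Module.finrank K L = 2) (hθ : θ ^ 2 = algebraMap K L a)
    (hθK : θ ∉ Set.range (algebraMap K L)) (u v : Fin 2 → K) :
    Algebra.discr K (fun i => algebraMap K L (u i) + algebraMap K L (v i) * θ) =
      4 * a * (u 0 * v 1 - u 1 * v 0) ^ 2 := by
  have h := Algebra.discr_of_matrix_vecMul (A := K) ![(1 : L), θ] !![u 0, u 1; v 0, v 1]
  rw [discr_one_sqrt hL hθ hθK, Matrix.det_fin_two_of] at h
  rw [show 4 * a * (u 0 * v 1 - u 1 * v 0) ^ 2 = (u 0 * v 1 - u 1 * v 0) ^ 2 * (4 * a) by ring, ← h]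
  congr 1
  funext i
  fin_cases i <;> simp [Matrix.vecMul, dotProduct, Fin.sum_univ_two, mul_comm]

end QuadraticField

section DedekindIdeals

variable {R : Type*} [CommRing R] [IsDedekindDomain R]

theorem Ideal.exists_coprime_factors {I J : Ideal R} (h : I ≠ ⊥) :
    ∃ G I' J', G ≠ ⊥ ∧ I = G * I' ∧ J = G * J' ∧ IsCoprime I' J' := by
  have hG : I ⊔ J ≠ ⊥ := fun h' => h (by rw [sup_eq_bot_iff] at h'; exact h'.1)
  obtain ⟨I', hI⟩ := Ideal.dvd_iff_le.2 (le_sup_left : I ≤ I ⊔ J)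
  obtain ⟨J', hJ⟩ := Ideal.dvd_iff_le.2 (le_sup_right : J ≤ I ⊔ J)
  refine ⟨I ⊔ J, I', J', hG, hI, hJ, ?_⟩
  rw [Ideal.isCoprime_iff_sup_eq]
  have h1 : (I ⊔ J) * (I' ⊔ J') = (I ⊔ J) * ⊤ := by
    rw [Ideal.mul_sup, ← hI, ← hJ, Ideal.mul_top]
  exact mul_left_cancel₀ hG h1

theorem Ideal.dvd_of_sq_dvd_squarefree_mul_sq {A I J : Ideal R} (hA : Squarefree A) (hI : I ≠ ⊥)
    (h : I ^ 2 ∣ A * J ^ 2) : I ∣ J := by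
  obtain ⟨G, I', J', hG, rfl, rfl, hc⟩ := Ideal.exists_coprime_factors (J := J) hI
  rw [mul_pow, mul_pow, mul_left_comm, mul_dvd_mul_iff_left (pow_ne_zero 2 hG)] at h
  have h1 : I' ^ 2 ∣ A := hc.pow.dvd_of_dvd_mul_right h
  rw [pow_two] at h1
  exact mul_dvd_mul_left G ((hA _ h1).dvd)

theorem Ideal.dvd_of_sq_dvd_sq {I J : Ideal R} (hI : I ≠ ⊥) (h : I ^ 2 ∣ J ^ 2) : I ∣ J :=
  Ideal.dvd_of_sq_dvd_squarefree_mul_sq squarefree_one hI (by rwa [one_mul])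

theorem Ideal.exists_span_eq_mul_not_dvd {I p : Ideal R} (hI : I ≠ ⊥) (hp : ¬ IsUnit p) :
    ∃ w ∈ I, ∃ J, Ideal.span {w} = I * J ∧ ¬ p ∣ J := by
  by_contra! h
  apply hp
  have h1 : I ≤ I * p := by
    intro w hw
    obtain ⟨J, hJ⟩ := Ideal.dvd_span_singleton.2 hw
    have := mul_dvd_mul_left I (h w hw J hJ)
    rw [← hJ] at this
    exact Ideal.dvd_span_singleton.1 this
  have h2 : I * p ∣ I * 1 := by rw [mul_one]; exact Ideal.dvd_iff_le.2 h1
  exact isUnit_of_dvd_one ((mul_dvd_mul_iff_left hI).1 h2)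

/-- In a Dedekind domain the square of an ideal is generated by squares. -/
theorem Ideal.span_sq_eq_sq (I : Ideal R) : Ideal.span {d : R | ∃ w ∈ I, d = w ^ 2} = I ^ 2 := by
  rcases eq_or_ne I ⊥ with rfl | hI
  · rw [← Ideal.zero_eq_bot, zero_pow two_ne_zero, Ideal.zero_eq_bot, Ideal.span_eq_bot]
    rintro d ⟨w, hw, rfl⟩
    simp [(Ideal.mem_bot).1 hw]
  have hle : Ideal.span {d : R | ∃ w ∈ I, d = w ^ 2} ≤ I ^ 2 := by
    rw [Ideal.span_le]
    rintro d ⟨w, hw, rfl⟩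
    exact Ideal.pow_mem_pow hw 2
  obtain ⟨H, hH⟩ := Ideal.dvd_iff_le.2 hle
  suffices IsUnit H by rw [hH, Ideal.isUnit_iff.1 this, Ideal.mul_top]
  by_contra hunit
  have hH0 : H ≠ ⊤ := fun h => hunit (Ideal.isUnit_iff.2 h)
  obtain ⟨p, hp, hHp⟩ := Ideal.exists_le_maximal H hH0
  obtain ⟨w, hw, J, hJ, hpJ⟩ := Ideal.exists_span_eq_mul_not_dvd (p := p) hI
    (fun h => hp.ne_top (Ideal.isUnit_iff.1 h))
  have h1 : w ^ 2 ∈ I ^ 2 * H := by rw [← hH]; exact Ideal.subset_span ⟨w, hw, rfl⟩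
  have h2 : I ^ 2 * H ∣ I ^ 2 * J ^ 2 := by
    rw [← mul_pow, ← hJ, Ideal.span_singleton_pow]; exact Ideal.dvd_span_singleton.2 h1
  rw [mul_dvd_mul_iff_left (pow_ne_zero 2 hI)] at h2
  have h3 : J ^ 2 ≤ p := (Ideal.le_of_dvd h2).trans hHp
  exact hpJ (Ideal.dvd_iff_le.2 (hp.isPrime.le_of_pow_le h3))

/-- An ideal is generated modulo any multiple by a single element. -/
theorem Ideal.exists_span_eq_mul_coprime {I N : Ideal R} (hI : I ≠ ⊥) (hN : N ≠ ⊥) :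
    ∃ y ∈ I, ∃ Y, Ideal.span {y} = I * Y ∧ IsCoprime Y N := by
  obtain ⟨y, hy⟩ := IsDedekindDomain.exists_sup_span_eq (I := I * N) (J := I) Ideal.mul_le_left
    (mul_ne_zero hI hN)
  have hyI : y ∈ I := by
    rw [← hy]; exact Ideal.mem_sup_right (Ideal.mem_span_singleton_self y)
  obtain ⟨Y, hY⟩ := Ideal.dvd_span_singleton.2 hyI
  refine ⟨y, hyI, Y, hY, ?_⟩
  rw [Ideal.isCoprime_iff_sup_eq, sup_comm]
  have h1 : I * (N ⊔ Y) = I * ⊤ := by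
    rw [Ideal.mul_sup, ← hY, Ideal.mul_top]; exact hy
  exact mul_left_cancel₀ hI h1

end DedekindIdeals

section RelDisc

variable {K L : Type*} [Field K] [NumberField K] [Field L] [Algebra K L] {θ : L} {α : 𝓞 K}

theorem relDisc_eq_span (hL : Module.finrank K L = 2) (hθ : θ ^ 2 = algebraMap K L α)
    (hθK : θ ∉ Set.range (algebraMap K L)) :
    relDisc K L = Ideal.span {d : 𝓞 K | ∃ u v : K,
      IsIntegral ℤ (algebraMap K L u + algebraMap K L v * θ) ∧ (d : K) = 4 * α * v ^ 2} := by
  obtain ⟨B, hB0, hB1⟩ := exists_eq_add_mul_sqrt hL hθK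
  have hrepr : ∀ γ : L, ∃ u v : K, γ = algebraMap K L u + algebraMap K L v * θ := by
    intro γ
    refine ⟨B.repr γ 0, B.repr γ 1, ?_⟩
    conv_lhs => rw [← B.sum_repr γ]
    rw [Fin.sum_univ_two, hB0, hB1, Algebra.smul_def, Algebra.smul_def, mul_one]
  apply le_antisymm
  · rw [relDisc, Ideal.span_le]
    rintro d ⟨b, hb, hd⟩
    refine Ideal.subset_span ?_
    choose u v huv using fun i => hrepr (b ((finCongr hL).symm i))
    have h1 : Algebra.discr K b = 4 * (α : K) * (u 0 * v 1 - u 1 * v 0) ^ 2 := by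
      rw [← discr_pair hL hθ hθK, ← Algebra.discr_reindex K b (finCongr hL)]
      congr 1
      funext i
      exact huv i
    refine ⟨u 0 * u 1 - α * (v 0 * v 1), u 0 * v 1 - u 1 * v 0, ?_, ?_⟩
    · have h0 := hb ((finCongr hL).symm 0)
      have h1 := hb ((finCongr hL).symm 1)
      rw [huv] at h0 h1
      convert! (IsIntegral.sub_mul_sqrt hθ hθK h0).mul h1 using 1
      simp only [map_sub, map_mul]
      linear_combination algebraMap K L (v 0) * algebraMap K L (v 1) * hθ
    · rw [← h1]; exact hd
  · rw [Ideal.span_le]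
    rintro d ⟨u, v, huv, hd⟩
    rcases eq_or_ne v 0 with rfl | hv
    · have : d = 0 := by
        apply RingOfIntegers.coe_injective (K := K)
        simpa using hd
      rw [this]; exact zero_mem _
    refine Ideal.subset_span ?_
    have hli : LinearIndependent K ![(1 : L), algebraMap K L u + algebraMap K L v * θ] := by
      rw [LinearIndependent.pair_iff' one_ne_zero]
      intro x hx
      refine hθK ⟨(x - u) / v, ?_⟩
      have hv' : algebraMap K L v ≠ 0 := by simpa using hv
      rw [Algebra.smul_def, mul_one] at hx
      rw [map_div₀, map_sub, hx]
      field_simp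
      ring
    let b := (basisOfLinearIndependentOfCardEqFinrank hli (by simp [hL])).reindex
      (finCongr hL).symm
    have hb : ⇑b ∘ (finCongr hL).symm = ![(1 : L), algebraMap K L u + algebraMap K L v * θ] := by
      funext i
      simp [b]
    refine ⟨b, ?_, ?_⟩
    · intro i
      have : b i = ![(1 : L), algebraMap K L u + algebraMap K L v * θ] (finCongr hL i) := by
        rw [← hb]; simp
      rw [this]
      generalize finCongr hL i = j
      fin_cases j
      · exact isIntegral_one
      · exact huv
    · rw [← Algebra.discr_reindex K b (finCongr hL), hb]
      have h2 := discr_pair hL hθ hθK ![1, u] ![0, v]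
      have h3 : (fun i => algebraMap K L ((![1, u] : Fin 2 → K) i) +
          algebraMap K L ((![0, v] : Fin 2 → K) i) * θ) =
          ![(1 : L), algebraMap K L u + algebraMap K L v * θ] := by
        funext i
        fin_cases i <;> simp
      rw [h3] at h2
      rw [h2]
      simpa using hd

end RelDisc

section DiscriminantFormula

variable {K L : Type*} [Field K] [NumberField K] [Field L] [Algebra K L] {θ : L} {α : 𝓞 K}

theorem two_ne_zero_ringOfIntegers : (2 : 𝓞 K) ≠ 0 := two_ne_zero

theorem not_isUnit_two : ¬ IsUnit (2 : 𝓞 K) := by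
  intro h
  have h1 := Ideal.absNorm_eq_one_iff.2 (Ideal.span_singleton_eq_top.2 h)
  rw [Ideal.absNorm_span_singleton, show (2 : 𝓞 K) = algebraMap ℤ (𝓞 K) 2 by simp,
    Algebra.norm_algebraMap, Int.natAbs_pow] at h1
  have h2 : Module.finrank ℤ (𝓞 K) ≠ 0 := by
    rw [RingOfIntegers.rank]; exact Module.finrank_pos.ne'
  exact h2 (by simpa using h1)

/-- The ideal of numerators `w` such that some `u + (w / (2 * g)) θ` is integral. -/
def sqrtNumerators (g : 𝓞 K) (θ : L) : Ideal (𝓞 K) where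
  carrier := {w | ∃ u : K, IsIntegral ℤ (algebraMap K L u + algebraMap K L (w / (2 * g)) * θ)}
  zero_mem' := ⟨0, by simpa using isIntegral_zero⟩
  add_mem' := by
    rintro w₁ w₂ ⟨u₁, h₁⟩ ⟨u₂, h₂⟩
    refine ⟨u₁ + u₂, ?_⟩
    convert! h₁.add h₂ using 1
    simp only [map_add, add_div]
    ring
  smul_mem' := by
    rintro r w ⟨u, h⟩
    refine ⟨r * u, ?_⟩
    convert! (isIntegral_algebraMap_int_iff (L := L).2 r.isIntegral_coe).mul h using 1
    simp only [smul_eq_mul, map_mul, mul_div_assoc]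
    ring

theorem mem_sqrtNumerators_iff (hθ : θ ^ 2 = algebraMap K L α)
    (hθK : θ ∉ Set.range (algebraMap K L)) {g : 𝓞 K} (hg : g ≠ 0) {w : 𝓞 K} :
    w ∈ sqrtNumerators g θ ↔ ∃ t : 𝓞 K, 4 * g ^ 2 ∣ g ^ 2 * t ^ 2 - α * w ^ 2 := by
  have hg' : (g : K) ≠ 0 := by simpa using hg
  have key : ∀ t : 𝓞 K, IsIntegral ℤ ((t / 2 : K) ^ 2 - α * (w / (2 * g) : K) ^ 2) ↔
      4 * g ^ 2 ∣ g ^ 2 * t ^ 2 - α * w ^ 2 := by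
    intro t
    constructor
    · intro h
      refine ⟨⟨_, h⟩, ?_⟩
      apply RingOfIntegers.coe_injective (K := K)
      simp only [map_sub, map_mul, map_pow]
      change _ = 4 * (g : K) ^ 2 * ((t / 2 : K) ^ 2 - α * (w / (2 * g) : K) ^ 2)
      field_simp
      ring
    · rintro ⟨c, hc⟩
      convert! c.isIntegral_coe using 1
      have := congrArg (fun x : 𝓞 K => (x : K)) hc
      simp only [map_sub, map_mul, map_pow, map_ofNat] at this
      field_simp
      linear_combination this
  constructor
  · rintro ⟨u, hu⟩
    rw [isIntegral_add_mul_sqrt_iff hθ hθK] at hu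
    refine ⟨⟨2 * u, hu.1⟩, (key _).1 ?_⟩
    change IsIntegral ℤ ((2 * u / 2 : K) ^ 2 - _)
    rw [mul_div_cancel_left₀ u two_ne_zero]
    exact hu.2
  · rintro ⟨t, ht⟩
    refine ⟨t / 2, (isIntegral_add_mul_sqrt_iff hθ hθK).2 ⟨?_, (key t).2 ht⟩⟩
    rw [mul_div_cancel₀ _ two_ne_zero]
    exact t.isIntegral_coe

/-- Integrality bounds the denominator of the coefficient of the square root. -/
theorem exists_numerator (hθ : θ ^ 2 = algebraMap K L α)
    (hθK : θ ∉ Set.range (algebraMap K L)) {g : 𝓞 K} (hg : g ≠ 0) {𝔞 𝔟 𝔟' : Ideal (𝓞 K)}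
    (h𝔞 : Squarefree 𝔞) (hα : Ideal.span {α} = 𝔞 * 𝔟 ^ 2) (hgb : Ideal.span {g} = 𝔟 * 𝔟')
    {u v : K} (h : IsIntegral ℤ (algebraMap K L u + algebraMap K L v * θ)) :
    ∃ w ∈ 𝔟', v = w / (2 * g) := by
  have hg' : (g : K) ≠ 0 := by simpa using hg
  have hbb : 𝔟 * 𝔟' ≠ ⊥ := by rw [← hgb]; simpa using hg
  have hb : 𝔟 ≠ 0 := left_ne_zero_of_mul hbb
  have hb' : 𝔟' ≠ 0 := right_ne_zero_of_mul hbb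
  obtain ⟨h1, h2⟩ := (isIntegral_add_mul_sqrt_iff hθ hθK).1 h
  have h3 : IsIntegral ℤ (4 * (α : K) * v ^ 2) := by
    have h4 : IsIntegral ℤ (4 : K) := by
      simpa using isIntegral_algebraMap (R := ℤ) (A := K) (x := 4)
    convert! (h1.pow 2).sub (h4.mul h2) using 1
    ring
  obtain ⟨r, s, hs, hrs⟩ := IsFractionRing.div_surjective (A := 𝓞 K) (2 * g * v)
  have hs0 : s ≠ 0 := nonZeroDivisors.ne_zero hs
  have hs' : (s : K) ≠ 0 := by simpa using hs0
  have hrs' : (r : K) = 2 * g * v * s := (div_eq_iff hs').1 hrs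
  obtain ⟨e, he⟩ : ∃ e : 𝓞 K, (e : K) = 4 * (α : K) * v ^ 2 := ⟨⟨_, h3⟩, rfl⟩
  have h5 : r ^ 2 * α = e * g ^ 2 * s ^ 2 := by
    apply RingOfIntegers.coe_injective (K := K)
    simp only [map_mul, map_pow]
    change (r : K) ^ 2 * α = (e : K) * g ^ 2 * s ^ 2
    rw [hrs', he]; ring
  have h6 : (𝔟' * Ideal.span {s}) ^ 2 ∣ 𝔞 * Ideal.span {r} ^ 2 := by
    have h7 := congrArg (fun x : 𝓞 K => Ideal.span {x}) h5
    simp only [← Ideal.span_singleton_mul_span_singleton, ← Ideal.span_singleton_pow, hα, hgb] at h7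
    rw [← mul_dvd_mul_iff_right (pow_ne_zero 2 hb)]
    refine ⟨Ideal.span {e}, ?_⟩
    calc _ = Ideal.span {r} ^ 2 * (𝔞 * 𝔟 ^ 2) := by ring
      _ = _ := h7
      _ = _ := by ring
  have h8 := Ideal.dvd_of_sq_dvd_squarefree_mul_sq h𝔞
    (mul_ne_zero hb' (by simpa using hs0)) h6
  obtain ⟨w, hw⟩ := (Ideal.span_singleton_le_span_singleton).1
    (Ideal.le_of_dvd (dvd_of_mul_left_dvd h8))
  refine ⟨w, ?_, ?_⟩
  · rw [hw, ← Ideal.span_singleton_mul_span_singleton, mul_comm,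
      mul_dvd_mul_iff_left (by simpa using hs0)] at h8
    exact Ideal.dvd_span_singleton.1 h8
  · have hw' : (r : K) = s * w := by rw [hw]; exact map_mul _ _ _
    have hw2 : (w : K) = 2 * g * v :=
      mul_left_cancel₀ hs' (by rw [← hw', hrs']; ring)
    rw [hw2]
    field_simp

/-- The relative discriminant of `K(√α)`, where `(α) = 𝔞 𝔟²` with `𝔞` squarefree and `𝔟` odd. -/
theorem exists_relDisc_eq (hL : Module.finrank K L = 2) (hθ : θ ^ 2 = algebraMap K L α)
    (hθK : θ ∉ Set.range (algebraMap K L)) {𝔞 𝔟 : Ideal (𝓞 K)} (h𝔞 : Squarefree 𝔞)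
    (h𝔟 : IsCoprime 𝔟 (Ideal.span {2})) (hα : Ideal.span {α} = 𝔞 * 𝔟 ^ 2) :
    ∃ 𝔪 𝔠 : Ideal (𝓞 K), 𝔪 * 𝔠 = Ideal.span {2} ∧ relDisc K L = 𝔞 * 𝔪 ^ 2 ∧
      ∀ 𝔡, 𝔡 ∣ Ideal.span {2} → (𝔡 ∣ 𝔠 ↔ ∃ x : 𝓞 K, x ^ 2 - α ∈ 𝔡 ^ 2) := by
  have h2 : (Ideal.span {(2 : 𝓞 K)}) ≠ 0 := by simp
  have h4 : (Ideal.span {(2 : 𝓞 K)}) ^ 2 = Ideal.span {4} := by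
    rw [Ideal.span_singleton_pow]; norm_num
  -- an element `g ≡ 1 mod 4` of `𝔟`
  obtain ⟨g, hg𝔟, e, he, hge⟩ := Submodule.mem_sup.1 ((Ideal.eq_top_iff_one _).1
    ((Ideal.isCoprime_iff_sup_eq).1 (h𝔟.pow_right (n := 2))))
  rw [h4, Ideal.mem_span_singleton] at he
  obtain ⟨e, rfl⟩ := he
  have hg : g ≠ 0 := by
    rintro rfl
    refine not_isUnit_two (K := K) (IsUnit.of_mul_eq_one (2 * e) ?_)
    linear_combination hge
  obtain ⟨𝔟', hgb⟩ := Ideal.dvd_span_singleton.2 hg𝔟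
  have hbb : 𝔟 * 𝔟' ≠ ⊥ := by rw [← hgb]; simpa using hg
  have hb : 𝔟 ≠ 0 := left_ne_zero_of_mul hbb
  have hb' : 𝔟' ≠ 0 := right_ne_zero_of_mul hbb
  have hg𝔟' : g ∈ 𝔟' := Ideal.dvd_span_singleton.1 (hgb ▸ dvd_mul_left _ _)
  have h4g : IsCoprime (4 : 𝓞 K) (g ^ 2) := IsCoprime.pow_right ⟨e, 1, by linear_combination hge⟩
  set W := sqrtNumerators g θ
  have hWmem : ∀ w, w ∈ W ↔ ∃ t : 𝓞 K, 4 * g ^ 2 ∣ g ^ 2 * t ^ 2 - α * w ^ 2 := fun w =>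
    mem_sqrtNumerators_iff hθ hθK hg
  have hg' : (g : K) ≠ 0 := by simpa using hg
  have hdivg : ∀ b ∈ 𝔟', g ^ 2 ∣ α * b ^ 2 := by
    intro b hb
    rw [← Ideal.mem_span_singleton, ← Ideal.span_singleton_pow, hgb, mul_pow]
    have : α ∈ 𝔟 ^ 2 := Ideal.dvd_span_singleton.1 (hα ▸ dvd_mul_left _ _)
    exact Ideal.mul_mem_mul this (Ideal.pow_mem_pow hb 2)
  have hWb' : 𝔟' ∣ W := by
    refine Ideal.dvd_iff_le.2 ?_
    rintro w ⟨u, hu⟩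
    obtain ⟨w', hw', h⟩ := exists_numerator hθ hθK hg h𝔞 hα hgb hu
    have : w = w' := by
      apply RingOfIntegers.coe_injective (K := K)
      field_simp at h
      exact h
    rwa [this]
  obtain ⟨𝔪, hm⟩ := hWb'
  have hm2 : 𝔪 ∣ Ideal.span {2} := by
    rw [← mul_dvd_mul_iff_left hb', ← hm, Ideal.dvd_iff_le, Ideal.mul_le]
    intro b hb x hx
    rw [Ideal.mem_span_singleton] at hx
    obtain ⟨x, rfl⟩ := hx
    rw [hWmem]
    obtain ⟨c, hc⟩ := hdivg b hb
    exact ⟨0, -x ^ 2 * c, by linear_combination (-4 * x ^ 2) * hc⟩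
  obtain ⟨𝔠, hc⟩ := hm2
  have hm0 : 𝔪 ≠ 0 := fun h => h2 (by rw [hc, h, zero_mul])
  have hc0 : 𝔠 ≠ 0 := fun h => h2 (by rw [hc, h, mul_zero])
  refine ⟨𝔪, 𝔠, hc.symm, ?_, ?_⟩
  · have h5 : Ideal.span {g} ^ 2 * relDisc K L = Ideal.span {α} * W ^ 2 := by
      rw [relDisc_eq_span hL hθ hθK, ← Ideal.span_sq_eq_sq W, Ideal.span_singleton_pow,
        Ideal.span_mul_span', Ideal.span_mul_span']
      congr 1
      ext d
      simp only [Set.mem_mul, Set.mem_singleton_iff, exists_eq_left, Set.mem_ofPred_eq]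
      constructor
      · rintro ⟨d, ⟨u, v, huv, hd⟩, rfl⟩
        obtain ⟨w, hw, rfl⟩ := exists_numerator hθ hθK hg h𝔞 hα hgb huv
        refine ⟨_, ⟨w, ⟨u, huv⟩, rfl⟩, ?_⟩
        apply RingOfIntegers.coe_injective (K := K)
        simp only [map_mul, map_pow]
        change (α : K) * w ^ 2 = g ^ 2 * (d : K)
        rw [hd]
        field_simp
        ring
      · rintro ⟨_, ⟨w, ⟨u, huv⟩, rfl⟩, rfl⟩
        obtain ⟨w', hw', h⟩ := exists_numerator hθ hθK hg h𝔞 hα hgb huv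
        have hww : w = w' := by
          apply RingOfIntegers.coe_injective (K := K)
          field_simp at h
          exact h
        obtain ⟨c, hc⟩ := hdivg w (hww ▸ hw')
        refine ⟨c, ⟨u, _, huv, ?_⟩, hc.symm⟩
        have := congrArg (fun x : 𝓞 K => (x : K)) hc
        simp only [map_mul, map_pow] at this
        field_simp
        linear_combination -4 * this
    rw [hgb, hα, hm] at h5
    refine mul_left_cancel₀ (pow_ne_zero 2 (mul_ne_zero hb hb')) (h5.trans ?_)
    ring
  · intro 𝔡 h𝔡
    obtain ⟨𝔫, hn⟩ := h𝔡
    have hd0 : 𝔡 ≠ 0 := fun h => h2 (by rw [hn, h, zero_mul])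
    have hn0 : 𝔫 ≠ 0 := fun h => h2 (by rw [hn, h, mul_zero])
    have h41 : Ideal.span {(4 : 𝓞 K)} = 𝔡 ^ 2 * 𝔫 ^ 2 := by rw [← h4, hn, mul_pow]
    have hdc : 𝔡 ∣ 𝔠 ↔ 𝔟' * 𝔫 ≤ W := by
      rw [← Ideal.dvd_iff_le, hm, mul_dvd_mul_iff_left hb', ← mul_dvd_mul_iff_right hn0, ← hn, hc,
        mul_comm 𝔪, mul_dvd_mul_iff_left hc0]
    rw [hdc]
    constructor
    · intro h
      obtain ⟨y, hy, Y, hY, hYc⟩ := Ideal.exists_span_eq_mul_coprime hn0 h2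
      obtain ⟨t, ht⟩ := (hWmem (g * y)).1 (h (Ideal.mul_mem_mul hg𝔟' hy))
      have ht4 : 4 ∣ t ^ 2 - α * y ^ 2 := by
        refine (mul_dvd_mul_iff_right (pow_ne_zero 2 hg)).1 (ht.trans (dvd_of_eq ?_))
        ring
      have htn : t ∈ 𝔫 := by
        refine Ideal.dvd_span_singleton.1 (Ideal.dvd_of_sq_dvd_sq hn0 ?_)
        rw [Ideal.span_singleton_pow, Ideal.dvd_span_singleton]
        rw [show t ^ 2 = (t ^ 2 - α * y ^ 2) + α * y ^ 2 by ring]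
        refine add_mem ?_ (Ideal.mul_mem_left _ _ (Ideal.pow_mem_pow hy 2))
        rw [← Ideal.dvd_span_singleton]
        exact (h41 ▸ dvd_mul_left _ _ : 𝔫 ^ 2 ∣ Ideal.span {4}).trans
          (Ideal.dvd_iff_le.2 (Ideal.span_singleton_le_span_singleton.2 ht4))
      have hny : Ideal.span {y} ⊔ 𝔫 * Ideal.span {2} = 𝔫 := by
        rw [hY, ← Ideal.mul_sup, (Ideal.isCoprime_iff_sup_eq).1 hYc, Ideal.mul_top]
      rw [← hny] at htn
      obtain ⟨a, ha, c, hc', hac⟩ := Submodule.mem_sup.1 htn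
      obtain ⟨x, rfl⟩ := Ideal.mem_span_singleton.1 ha
      obtain ⟨z, rfl⟩ := Ideal.mem_span_singleton.1 (Ideal.mul_le_right hc' : c ∈ Ideal.span {2})
      refine ⟨x, ?_⟩
      have h6 : 4 ∣ (x ^ 2 - α) * y ^ 2 := by
        obtain ⟨k, hk⟩ := ht4
        refine ⟨k - y * x * z - z ^ 2, ?_⟩
        rw [← hac] at hk
        linear_combination hk
      rw [← Ideal.dvd_span_singleton]
      have h7 := Ideal.dvd_iff_le.2 (Ideal.span_singleton_le_span_singleton.2 h6)
      rw [h41, ← Ideal.span_singleton_mul_span_singleton, ← Ideal.span_singleton_pow, hY, mul_pow,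
        mul_left_comm, mul_comm, mul_dvd_mul_iff_left (pow_ne_zero 2 hn0)] at h7
      refine IsCoprime.dvd_of_dvd_mul_right ?_ h7
      refine IsCoprime.pow (hYc.symm.of_isCoprime_of_dvd_left ?_)
      rw [hn]; exact dvd_mul_right _ _
    · rintro ⟨x, hx⟩
      rw [Ideal.mul_le]
      intro b hb n hn'
      rw [hWmem]
      refine ⟨n * x * b, h4g.mul_dvd ?_ ?_⟩
      · have h8 : 4 ∣ n ^ 2 * (x ^ 2 - α) := by
          rw [← Ideal.mem_span_singleton, h41, mul_comm (n ^ 2)]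
          exact Ideal.mul_mem_mul hx (Ideal.pow_mem_pow hn' 2)
        obtain ⟨k, hk⟩ := h8
        refine ⟨b ^ 2 * k - n ^ 2 * x ^ 2 * b ^ 2 * (e * (1 + g)), ?_⟩
        have hg2 : g ^ 2 = 1 - 4 * e * (1 + g) := by linear_combination (1 + g) * hge
        rw [hg2]
        linear_combination b ^ 2 * hk
      · obtain ⟨k, hk⟩ := hdivg b hb
        refine ⟨(n * x * b) ^ 2 - n ^ 2 * k, ?_⟩
        linear_combination (-n ^ 2) * hk

end DiscriminantFormula

section FiniteRings

theorem exists_isIdempotentElem_pow {M : Type*} [Monoid M] [Finite M] (a : M) :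
    ∃ n, IsIdempotentElem (a ^ (n + 1)) := by
  obtain ⟨i, j, hij, h⟩ := Finite.exists_ne_map_eq_of_infinite (fun n : ℕ => a ^ n)
  wlog hlt : i < j generalizing i j
  · exact this j i hij.symm h.symm (by omega)
  obtain ⟨p, rfl⟩ := Nat.exists_eq_add_of_lt hlt
  have h1 : ∀ m k, a ^ (i + m + k * (p + 1)) = a ^ (i + m) := by
    intro m k
    induction k with
    | zero => simp
    | succ k ih =>
      rw [show i + m + (k + 1) * (p + 1) = (i + p + 1) + (m + k * (p + 1)) by ring, pow_add]
      rw [← h, ← pow_add, ← add_assoc, ih]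
  refine ⟨i + p * (i + 1), ?_⟩
  rw [IsIdempotentElem, ← pow_add]
  have h2 := h1 (1 + p * (i + 1)) (i + 1)
  rw [show i + (1 + p * (i + 1)) = i + p * (i + 1) + 1 by ring] at h2
  rw [← h2]
  congr 1
  ring

/-- A surjection from a finite commutative ring is surjective on units. -/
theorem Units.map_surjective_of_finite {A B : Type*} [CommRing A] [Finite A] [CommRing B]
    (f : A →+* B) (hf : Function.Surjective f) : Function.Surjective (Units.map (f : A →* B)) := by
  intro b
  obtain ⟨a, ha⟩ := hf b
  obtain ⟨n, hn⟩ := exists_isIdempotentElem_pow a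
  have hfe : f (a ^ (n + 1)) = 1 := by
    have h1 : IsUnit (f (a ^ (n + 1))) := by rw [map_pow, ha]; exact b.isUnit.pow _
    refine h1.mul_left_cancel ?_
    rw [← map_mul, hn.eq, mul_one]
  have hn' : a ^ (n + 1) * a ^ (n + 1) = a ^ (n + 1) := hn
  refine ⟨Units.mkOfMulEqOne (a * a ^ (n + 1) + (1 - a ^ (n + 1)))
    (a ^ n * a ^ (n + 1) + (1 - a ^ (n + 1))) ?_, ?_⟩
  · generalize he : a ^ (n + 1) = e at hn' ⊢
    have h2 : a * a ^ n = e := by rw [← he, pow_succ']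
    linear_combination (e ^ 2 ) * h2 + (e + 2 - a - a ^ n) * hn'
  · ext
    simp [hfe, ha]

theorem index_range_powMonoidHom {G : Type*} [CommGroup G] [Finite G] (n : ℕ) :
    (powMonoidHom n : G →* G).range.index = Nat.card (powMonoidHom n : G →* G).ker := by
  have h1 := Subgroup.card_mul_index (powMonoidHom n : G →* G).range
  have h2 := Subgroup.card_mul_index (powMonoidHom n : G →* G).ker
  rw [Subgroup.index_ker] at h2
  have h3 : 0 < Nat.card (powMonoidHom n : G →* G).range := Nat.card_pos
  refine Nat.eq_of_mul_eq_mul_left h3 ?_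
  rw [h1, mul_comm, h2]

theorem card_ker_sq_units_eq {A B : Type*} [CommRing A] [CommRing B] (f : A →+* B)
    (h : ∀ a, f a = 0 → a ^ 2 = 0 ∧ 2 * a = 0) (h' : ∀ x, x ^ 2 = 1 → f x = 1) :
    Nat.card (powMonoidHom 2 : Aˣ →* Aˣ).ker = Nat.card f.toAddMonoidHom.ker := by
  symm
  have hk : ∀ a : f.toAddMonoidHom.ker, (a : A) ^ 2 = 0 ∧ 2 * (a : A) = 0 := fun a => h a a.2
  refine Nat.card_eq_of_bijective (fun a => ⟨Units.mkOfMulEqOne (1 + a) (1 - a) ?_, ?_⟩) ⟨?_, ?_⟩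
  · linear_combination -(hk a).1
  · rw [MonoidHom.mem_ker]
    ext
    simp only [powMonoidHom_apply, Units.val_pow_eq_pow_val, Units.val_mkOfMulEqOne, Units.val_one]
    linear_combination (hk a).1 + (hk a).2
  · intro a b hab
    have h3 := congrArg Units.val (congrArg Subtype.val hab)
    simp only [Units.val_mkOfMulEqOne] at h3
    exact Subtype.ext (add_left_cancel h3)
  · rintro ⟨x, hx⟩
    refine ⟨⟨x - 1, ?_⟩, ?_⟩
    · rw [MonoidHom.mem_ker] at hx
      have h3 := h' x (by simpa using congrArg Units.val hx)
      change f (x - 1) = 0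
      rw [map_sub, h3, map_one, sub_self]
    · ext
      simp only [Units.val_mkOfMulEqOne]
      ring

end FiniteRings

section Residues

variable {K : Type*} [Field K] [NumberField K]

theorem sq_sub_one_mem_sq_iff {𝔡 : Ideal (𝓞 K)} (h𝔡 : 𝔡 ∣ Ideal.span {2}) {x : 𝓞 K} :
    x ^ 2 - 1 ∈ 𝔡 ^ 2 ↔ x - 1 ∈ 𝔡 := by
  have h2 : (2 : 𝓞 K) ∈ 𝔡 := Ideal.dvd_span_singleton.1 h𝔡
  have h𝔡0 : 𝔡 ≠ ⊥ := by
    rintro rfl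
    exact two_ne_zero_ringOfIntegers ((Ideal.mem_bot).1 h2)
  constructor
  · intro h
    set I := Ideal.span {x - 1} ⊔ 𝔡
    have hI : I ≠ 0 := fun h' => h𝔡0 (le_bot_iff.1 ((le_sup_right : 𝔡 ≤ I).trans_eq h'))
    have h1 : I * I ≤ 𝔡 * I := by
      rw [Ideal.sup_mul, Ideal.mul_sup]
      refine sup_le (sup_le ?_ ?_) le_rfl
      · rw [Ideal.span_singleton_mul_span_singleton, Ideal.span_singleton_le_iff_mem,
          show (x - 1) * (x - 1) = (x ^ 2 - 1) - 2 * (x - 1) by ring]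
        refine sub_mem ?_ (Ideal.mul_mem_mul h2 ?_)
        · rw [pow_two 𝔡] at h
          exact Ideal.mul_mono_right le_sup_right h
        · exact Ideal.mem_sup_left (Ideal.mem_span_singleton_self _)
      · rw [mul_comm]
        exact Ideal.mul_mono_right le_sup_left
    rw [← Ideal.dvd_iff_le, mul_dvd_mul_iff_right hI, Ideal.dvd_iff_le] at h1
    exact h1 (Ideal.mem_sup_left (Ideal.mem_span_singleton_self _))
  · intro h
    rw [show x ^ 2 - 1 = (x - 1) * (x - 1) + 2 * (x - 1) by ring, pow_two]
    exact add_mem (Ideal.mul_mem_mul h h) (Ideal.mul_mem_mul h2 h)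

theorem finite_quotient {I : Ideal (𝓞 K)} (h : I ≠ ⊥) : Finite (𝓞 K ⧸ I) :=
  Ideal.finiteQuotientOfFreeOfNeBot I h

theorem card_ker_sq_units {𝔡 : Ideal (𝓞 K)} (h𝔡 : 𝔡 ∣ Ideal.span {2}) :
    Nat.card (powMonoidHom 2 : (𝓞 K ⧸ 𝔡 ^ 2)ˣ →* _).ker = Ideal.absNorm 𝔡 := by
  have h2 : (2 : 𝓞 K) ∈ 𝔡 := Ideal.dvd_span_singleton.1 h𝔡
  have h𝔡0 : 𝔡 ≠ 0 := by
    rintro rfl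
    exact two_ne_zero_ringOfIntegers ((Ideal.mem_bot).1 h2)
  have hle : 𝔡 ^ 2 ≤ 𝔡 := Ideal.pow_le_self two_ne_zero
  obtain ⟨f, hf, hfmk⟩ : ∃ f : (𝓞 K ⧸ 𝔡 ^ 2) →+* (𝓞 K ⧸ 𝔡), Function.Surjective f ∧
      ∀ a, f (Ideal.Quotient.mk _ a) = Ideal.Quotient.mk _ a :=
    ⟨Ideal.Quotient.factor hle, Ideal.Quotient.factor_surjective hle, fun _ => rfl⟩
  have := finite_quotient h𝔡0
  have := finite_quotient (pow_ne_zero 2 h𝔡0 : 𝔡 ^ 2 ≠ ⊥)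
  have hcard : Nat.card f.toAddMonoidHom.ker = Ideal.absNorm 𝔡 := by
    have h1 := AddSubgroup.card_mul_index f.toAddMonoidHom.ker
    rw [AddSubgroup.index_ker, (AddMonoidHom.range_eq_top (f := f.toAddMonoidHom)).2 hf,
      AddSubgroup.card_top] at h1
    change _ * Ideal.absNorm 𝔡 = Ideal.absNorm (𝔡 ^ 2) at h1
    rw [map_pow, pow_two (Ideal.absNorm 𝔡)] at h1
    exact Nat.eq_of_mul_eq_mul_right
      (Nat.pos_of_ne_zero (by simpa [Ideal.absNorm_eq_zero_iff] using h𝔡0)) h1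
  rw [← hcard]
  refine card_ker_sq_units_eq f ?_ ?_
  · intro a ha
    obtain ⟨a, rfl⟩ := Ideal.Quotient.mk_surjective a
    rw [hfmk, Ideal.Quotient.eq_zero_iff_mem] at ha
    constructor
    · rw [← map_pow, Ideal.Quotient.eq_zero_iff_mem]
      exact Ideal.pow_mem_pow ha 2
    · rw [← map_ofNat (Ideal.Quotient.mk (𝔡 ^ 2)) 2, ← map_mul, Ideal.Quotient.eq_zero_iff_mem,
        pow_two 𝔡]
      exact Ideal.mul_mem_mul h2 ha
  · intro x hx
    obtain ⟨x, rfl⟩ := Ideal.Quotient.mk_surjective x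
    rw [← map_pow, ← map_one (Ideal.Quotient.mk (𝔡 ^ 2)), Ideal.Quotient.eq,
      sq_sub_one_mem_sq_iff h𝔡] at hx
    rw [hfmk, ← map_one (Ideal.Quotient.mk 𝔡), Ideal.Quotient.eq]
    exact hx

theorem isUnit_mk_iff_isCoprime {R : Type*} [CommRing R] {I : Ideal R} {x : R} :
    IsUnit (Ideal.Quotient.mk I x) ↔ IsCoprime (Ideal.span {x}) I := by
  rw [Ideal.isCoprime_iff_exists, isUnit_iff_exists_inv]
  constructor
  · rintro ⟨b, hb⟩
    obtain ⟨b, rfl⟩ := Ideal.Quotient.mk_surjective b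
    rw [← map_mul, ← map_one (Ideal.Quotient.mk I), Ideal.Quotient.eq] at hb
    refine ⟨x * b, Ideal.mem_span_singleton.2 (dvd_mul_right _ _), 1 - x * b, ?_, by ring⟩
    rw [← neg_sub]
    exact neg_mem hb
  · rintro ⟨i, hi, j, hj, hij⟩
    obtain ⟨b, rfl⟩ := Ideal.mem_span_singleton.1 hi
    refine ⟨Ideal.Quotient.mk I b, ?_⟩
    rw [← map_mul, ← map_one (Ideal.Quotient.mk I), Ideal.Quotient.eq, ← hij]
    simpa using hj

/-- Among the units modulo `4`, a proportion `1 / N(𝔡)` become a square modulo `𝔡²` after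
multiplication by a fixed number prime to `𝔡`. -/
theorem absNorm_mul_card_units_sq {𝔡 : Ideal (𝓞 K)} (h𝔡 : 𝔡 ∣ Ideal.span {2}) {c : 𝓞 K}
    (hc : IsCoprime (Ideal.span {c}) 𝔡) :
    Nat.card {x : (𝓞 K ⧸ Ideal.span {(4 : 𝓞 K)})ˣ // ∃ y : 𝓞 K,
      y ^ 2 - c * Quotient.out (x : 𝓞 K ⧸ Ideal.span {(4 : 𝓞 K)}) ∈ 𝔡 ^ 2} * Ideal.absNorm 𝔡 =
      Nat.card (𝓞 K ⧸ Ideal.span {(4 : 𝓞 K)})ˣ := by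
  have h2 : (2 : 𝓞 K) ∈ 𝔡 := Ideal.dvd_span_singleton.1 h𝔡
  have h𝔡0 : 𝔡 ≠ 0 := by
    rintro rfl
    exact two_ne_zero_ringOfIntegers ((Ideal.mem_bot).1 h2)
  have hle : Ideal.span {(4 : 𝓞 K)} ≤ 𝔡 ^ 2 := by
    rw [Ideal.span_singleton_le_iff_mem, show (4 : 𝓞 K) = 2 ^ 2 by norm_num]
    exact Ideal.pow_mem_pow h2 2
  have := finite_quotient (pow_ne_zero 2 h𝔡0 : 𝔡 ^ 2 ≠ ⊥)
  have := finite_quotient (I := Ideal.span {(4 : 𝓞 K)}) (by simp)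
  obtain ⟨f, hf, hfmk⟩ : ∃ f : (𝓞 K ⧸ Ideal.span {(4 : 𝓞 K)}) →+* (𝓞 K ⧸ 𝔡 ^ 2),
      Function.Surjective f ∧ ∀ a, f (Ideal.Quotient.mk _ a) = Ideal.Quotient.mk _ a :=
    ⟨Ideal.Quotient.factor hle, Ideal.Quotient.factor_surjective hle, fun _ => rfl⟩
  obtain ⟨φ, hφ, hφv⟩ : ∃ φ : (𝓞 K ⧸ Ideal.span {(4 : 𝓞 K)})ˣ →* (𝓞 K ⧸ 𝔡 ^ 2)ˣ,
      Function.Surjective φ ∧ ∀ x, (φ x : 𝓞 K ⧸ 𝔡 ^ 2) = f x :=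
    ⟨Units.map f, Units.map_surjective_of_finite f hf, fun _ => rfl⟩
  obtain ⟨cu, hcu⟩ := isUnit_mk_iff_isCoprime.2 (hc.pow_right (n := 2))
  set H := (powMonoidHom 2 : (𝓞 K ⧸ 𝔡 ^ 2)ˣ →* _).range with hH
  have hidx : (H.comap φ).index = Ideal.absNorm 𝔡 := by
    rw [Subgroup.index_comap_of_surjective _ hφ, hH, index_range_powMonoidHom,
      card_ker_sq_units h𝔡]
  rw [← Subgroup.card_mul_index (H.comap φ), hidx]
  congr 1
  obtain ⟨x₀, hx₀⟩ := hφ cu⁻¹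
  have key : ∀ x : (𝓞 K ⧸ Ideal.span {(4 : 𝓞 K)})ˣ, (∃ y : 𝓞 K,
      y ^ 2 - c * Quotient.out (x : 𝓞 K ⧸ Ideal.span {(4 : 𝓞 K)}) ∈ 𝔡 ^ 2) ↔
      x₀⁻¹ * x ∈ H.comap φ := by
    intro x
    rw [Subgroup.mem_comap, map_mul, map_inv, hx₀, inv_inv, hH, MonoidHom.mem_range]
    have hval : Ideal.Quotient.mk (𝔡 ^ 2)
        (c * Quotient.out (x : 𝓞 K ⧸ Ideal.span {(4 : 𝓞 K)})) =
          ((cu * φ x : _ˣ) : 𝓞 K ⧸ 𝔡 ^ 2) := by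
      rw [map_mul, ← hfmk (Quotient.out _), Ideal.Quotient.mk_out, Units.val_mul, hcu, hφv]
    constructor
    · rintro ⟨y, hy⟩
      rw [← Ideal.Quotient.eq, hval, map_pow] at hy
      have hyu : IsUnit (Ideal.Quotient.mk (𝔡 ^ 2) y) := by
        rw [← isUnit_pow_iff two_ne_zero, hy]
        exact Units.isUnit _
      refine ⟨hyu.unit, Units.ext ?_⟩
      simpa using hy
    · rintro ⟨y, hy⟩
      obtain ⟨a, ha⟩ := Ideal.Quotient.mk_surjective (y : 𝓞 K ⧸ 𝔡 ^ 2)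
      refine ⟨a, ?_⟩
      rw [← Ideal.Quotient.eq, hval, map_pow, ha, ← hy]
      simp
  exact Nat.card_congr ((Equiv.mulLeft x₀⁻¹).subtypeEquiv key)

end Residues

section ResidueCount

theorem Ideal.span_singleton_sup_eq_of_sub_mem {R : Type*} [CommRing R] {I : Ideal R} {a b : R}
    (h : a - b ∈ I) : Ideal.span {a} ⊔ I = Ideal.span {b} ⊔ I := by
  refine le_antisymm (sup_le ?_ le_sup_right) (sup_le ?_ le_sup_right) <;>
    rw [Ideal.span_singleton_le_iff_mem]
  · rw [show a = b + (a - b) by ring]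
    exact add_mem (Ideal.mem_sup_left (Ideal.mem_span_singleton_self _)) (Ideal.mem_sup_right h)
  · rw [show b = a - (a - b) by ring]
    exact sub_mem (Ideal.mem_sup_left (Ideal.mem_span_singleton_self _)) (Ideal.mem_sup_right h)

theorem Ideal.isCoprime_iff_mul_sup {R : Type*} [CommRing R] [IsDedekindDomain R]
    {F A M : Ideal R} (hM : M ≠ ⊥) : IsCoprime F A ↔ M * F ⊔ A * M = M := by
  rw [mul_comm A, ← Ideal.mul_sup, Ideal.isCoprime_iff_sup_eq]
  constructor
  · intro h
    rw [h, Ideal.mul_top]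
  · intro h
    exact mul_left_cancel₀ (a := M) hM (h.trans (Ideal.mul_top M).symm)

theorem sq_sub_mem_congr {R : Type*} [CommRing R] {I : Ideal R} {a b : R} (h : a - b ∈ I) :
    (∃ y, y ^ 2 - a ∈ I) ↔ ∃ y, y ^ 2 - b ∈ I := by
  refine exists_congr fun y => ?_
  rw [show y ^ 2 - b = y ^ 2 - a + (a - b) by ring, I.add_mem_iff_left h]

variable (K : Type*) [Field K] [NumberField K]

/-- The numbers in the cone whose ideal is `M` times an odd squarefree ideal of bounded norm. -/
def oddConeIntegers (M : Ideal (𝓞 K)) (X : ℝ) : Set (𝓞 K) :=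
  {β | β ∈ coneIntegers K ∧ ∃ F : Ideal (𝓞 K), Ideal.span {β} = M * F ∧ Squarefree F ∧
    IsCoprime F (Ideal.span {2}) ∧ (Ideal.absNorm F : ℝ) ≤ X}

variable {K}

theorem not_exists_sq_sub_mem {𝔡 𝔟 z Y : Ideal (𝓞 K)} (h𝔡 : 𝔡 ∣ Ideal.span {2})
    (h𝔟 : IsCoprime 𝔟 (Ideal.span {2})) (hz : Squarefree z) (hY : IsCoprime Y (Ideal.span {2}))
    {c : 𝓞 K} (hc : Ideal.span {c} = 𝔟 ^ 2 * z * Y) (h𝔡z : ¬ IsCoprime 𝔡 z) :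
    ¬ ∃ y : 𝓞 K, y ^ 2 - c ∈ 𝔡 ^ 2 := by
  rintro ⟨y, hy⟩
  rw [Ideal.isCoprime_iff_sup_eq] at h𝔡z
  obtain ⟨q, hq, hle⟩ := Ideal.exists_le_maximal _ h𝔡z
  have hqd : q ∣ 𝔡 := Ideal.dvd_iff_le.2 (le_sup_left.trans hle)
  have hqz : q ∣ z := Ideal.dvd_iff_le.2 (le_sup_right.trans hle)
  have hcq : c ∈ q := by
    rw [← Ideal.dvd_span_singleton, hc]
    exact (hqz.mul_left _).mul_right _
  have hyq : y ^ 2 - c ∈ q ^ 2 := Ideal.le_of_dvd (pow_dvd_pow_of_dvd hqd 2) hy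
  have hy2 : y ∈ q := by
    refine hq.isPrime.mem_of_pow_mem 2 ?_
    rw [show y ^ 2 = y ^ 2 - c + c by ring]
    exact add_mem (Ideal.pow_le_self two_ne_zero hyq) hcq
  have hcq2 : c ∈ q ^ 2 := by
    rw [show c = y ^ 2 - (y ^ 2 - c) by ring]
    exact sub_mem (Ideal.pow_mem_pow hy2 2) hyq
  rw [← Ideal.dvd_span_singleton, hc] at hcq2
  have hq2 : q ∣ Ideal.span {2} := hqd.trans h𝔡
  have h1 : q ^ 2 ∣ z := by
    refine IsCoprime.dvd_of_dvd_mul_left ?_ (IsCoprime.dvd_of_dvd_mul_right ?_ hcq2)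
    · exact IsCoprime.pow (h𝔟.symm.of_isCoprime_of_dvd_left hq2)
    · exact IsCoprime.pow_left (hY.symm.of_isCoprime_of_dvd_left hq2)
  rw [pow_two] at h1
  exact hq.ne_top (Ideal.isUnit_iff.1 (hz q h1))

theorem exists_tendsto_card_oddConeIntegers (K : Type*) [Field K] [NumberField K] :
    ∃ κ : ℝ, 0 < κ ∧ ∀ 𝔟 z : Ideal (𝓞 K), IsCoprime 𝔟 (Ideal.span {2}) → Squarefree z →
      (∀ X, (oddConeIntegers K (𝔟 ^ 2 * z) X).Finite) ∧
      ∀ (u : (𝓞 K)ˣ) (𝔡 : Ideal (𝓞 K)), 𝔡 ∣ Ideal.span {2} →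
        Tendsto (fun X : ℝ => (Nat.card {β : 𝓞 K | β ∈ oddConeIntegers K (𝔟 ^ 2 * z) X ∧
            ∃ y : 𝓞 K, y ^ 2 - u * β ∈ 𝔡 ^ 2} : ℝ) / X) atTop
          (𝓝 (open scoped Classical in if IsCoprime 𝔡 z then κ / Ideal.absNorm 𝔡 else 0)) := by
  classical
  obtain ⟨κ, hκ, H⟩ := exists_tendsto_card_squarefree K (Ideal.span {4}) (by simp)
  have hfin4 := finite_quotient (I := Ideal.span {(4 : 𝓞 K)}) (by simp)
  have hfu : Fintype (𝓞 K ⧸ Ideal.span {(4 : 𝓞 K)})ˣ := Fintype.ofFinite _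
  have h4 : (Ideal.span {(2 : 𝓞 K)}) ^ 2 = Ideal.span {4} := by
    rw [Ideal.span_singleton_pow]; norm_num
  refine ⟨κ * Nat.card (𝓞 K ⧸ Ideal.span {(4 : 𝓞 K)})ˣ,
    mul_pos hκ (by exact_mod_cast Nat.card_pos), fun 𝔟 z h𝔟 hz => ?_⟩
  have h𝔟0 : 𝔟 ≠ 0 := by
    rintro rfl
    have := (isCoprime_zero_left.1 h𝔟)
    exact not_isUnit_two (K := K) (Ideal.span_singleton_eq_top.1 (Ideal.isUnit_iff.1 this))
  have hM : 𝔟 ^ 2 * z ≠ ⊥ := mul_ne_zero (pow_ne_zero 2 h𝔟0) hz.ne_zero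
  obtain ⟨m, hm, Y, hY, hYc⟩ := Ideal.exists_span_eq_mul_coprime hM
    (show Ideal.span {(2 : 𝓞 K)} ≠ ⊥ by simp)
  set M := 𝔟 ^ 2 * z with hMdef
  have hcop4 : ∀ {F : Ideal (𝓞 K)}, IsCoprime F (Ideal.span {4}) ↔
      IsCoprime F (Ideal.span {2}) := by
    intro F
    rw [← h4]
    exact IsCoprime.pow_right_iff two_pos
  have hMle : Ideal.span {4} * M ≤ Ideal.span {4} := Ideal.mul_le_left
  -- the residue classes
  set v : (𝓞 K ⧸ Ideal.span {(4 : 𝓞 K)})ˣ → 𝓞 K := fun x =>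
    m * Quotient.out (x : 𝓞 K ⧸ Ideal.span {(4 : 𝓞 K)}) with hv
  have hva : ∀ a : 𝓞 K, IsCoprime (Ideal.span {a}) (Ideal.span {4}) ↔
      Ideal.span {m * a} ⊔ Ideal.span {4} * M = M := by
    intro a
    rw [← Ideal.span_singleton_mul_span_singleton, hY, mul_assoc,
      ← Ideal.isCoprime_iff_mul_sup hM, IsCoprime.mul_left_iff]
    exact ⟨fun h => ⟨hcop4.2 hYc, h⟩, fun h => h.2⟩
  have hvx : ∀ x, Ideal.span {v x} ⊔ Ideal.span {4} * M = M := by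
    intro x
    rw [← hva, ← isUnit_mk_iff_isCoprime, Ideal.Quotient.mk_out]
    exact x.isUnit
  set B : (𝓞 K ⧸ Ideal.span {(4 : 𝓞 K)})ˣ → ℝ → Set (𝓞 K) := fun x X =>
    {β | β ∈ coneIntegers K ∧ β - v x ∈ Ideal.span {4} * M ∧ ∃ F : Ideal (𝓞 K),
      Ideal.span {β} = M * F ∧ Squarefree F ∧ (Ideal.absNorm F : ℝ) ≤ X} with hB
  have hBfin : ∀ x X, (B x X).Finite := fun x X => (H M hM (v x) (hvx x)).1 X
  have hBlim : ∀ x, Tendsto (fun X => (Nat.card (B x X) : ℝ) / X) atTop (𝓝 κ) := fun x =>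
    (H M hM (v x) (hvx x)).2
  have hBsub : ∀ x X, B x X ⊆ oddConeIntegers K M X := by
    rintro x X β ⟨h1, h2, F, hF, hFs, hFX⟩
    refine ⟨h1, F, hF, hFs, hcop4.1 ((Ideal.isCoprime_iff_mul_sup hM).2 ?_), hFX⟩
    rw [← hF, Ideal.span_singleton_sup_eq_of_sub_mem h2, hvx]
  have hBex : ∀ X, ∀ β ∈ oddConeIntegers K M X, ∃ x, β ∈ B x X := by
    rintro X β ⟨h1, F, hF, hFs, hFc, hFX⟩
    have hβM : β ∈ Ideal.span {m} ⊔ Ideal.span {4} * M := by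
      rw [hY, (Ideal.isCoprime_iff_mul_sup hM).1 (hcop4.2 hYc), ← Ideal.dvd_span_singleton, hF]
      exact dvd_mul_right _ _
    obtain ⟨w, hw, e, he, hwe⟩ := Submodule.mem_sup.1 hβM
    obtain ⟨a, rfl⟩ := Ideal.mem_span_singleton.1 hw
    have h2 : β - m * a ∈ Ideal.span {4} * M := by rw [← hwe]; simpa using he
    have ha : IsCoprime (Ideal.span {a}) (Ideal.span {4}) := by
      rw [hva, ← Ideal.span_singleton_sup_eq_of_sub_mem h2, hF]
      exact (Ideal.isCoprime_iff_mul_sup hM).1 (hcop4.2 hFc)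
    obtain ⟨x, hx⟩ := isUnit_mk_iff_isCoprime.2 ha
    refine ⟨x, h1, ?_, F, hF, hFs, hFX⟩
    rw [show β - v x = (β - m * a) +
      (a - Quotient.out (x : 𝓞 K ⧸ Ideal.span {(4 : 𝓞 K)})) * m by simp only [hv]; ring]
    refine add_mem h2 (Ideal.mul_mem_mul ?_ hm)
    rw [← Ideal.Quotient.eq, Ideal.Quotient.mk_out, hx]
  have hBuniq : ∀ X, ∀ β x x', β ∈ B x X → β ∈ B x' X → x = x' := by
    rintro X β x x' ⟨-, h1, -⟩ ⟨-, h2, -⟩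
    have h3 : m * (Quotient.out (x : 𝓞 K ⧸ Ideal.span {(4 : 𝓞 K)}) -
        Quotient.out (x' : 𝓞 K ⧸ Ideal.span {(4 : 𝓞 K)})) ∈ Ideal.span {4} * M := by
      have := sub_mem h2 h1
      rwa [show β - v x' - (β - v x) = m * (Quotient.out (x : 𝓞 K ⧸ Ideal.span {(4 : 𝓞 K)}) -
        Quotient.out (x' : 𝓞 K ⧸ Ideal.span {(4 : 𝓞 K)})) by simp only [hv]; ring] at this
    rw [← Ideal.dvd_span_singleton, ← Ideal.span_singleton_mul_span_singleton, hY,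
      mul_comm (Ideal.span {4}), mul_assoc M Y, mul_dvd_mul_iff_left hM] at h3
    have h5 := Ideal.dvd_span_singleton.1 ((hcop4.2 hYc).symm.dvd_of_dvd_mul_left h3)
    rw [← Ideal.Quotient.eq, Ideal.Quotient.mk_out, Ideal.Quotient.mk_out] at h5
    exact Units.ext h5
  refine ⟨fun X => ?_, fun u 𝔡 h𝔡 => ?_⟩
  · refine (Set.finite_iUnion fun x => hBfin x X).subset fun β hβ => ?_
    exact Set.mem_iUnion.2 (hBex X β hβ)
  set P : (𝓞 K ⧸ Ideal.span {(4 : 𝓞 K)})ˣ → Prop := fun x =>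
    ∃ y : 𝓞 K, y ^ 2 - (u * m) * Quotient.out (x : 𝓞 K ⧸ Ideal.span {(4 : 𝓞 K)}) ∈ 𝔡 ^ 2 with hP
  have h4d : Ideal.span {4} ≤ 𝔡 ^ 2 := by
    rw [← h4]
    exact Ideal.le_of_dvd (pow_dvd_pow_of_dvd h𝔡 2)
  have hPiff : ∀ X, ∀ x, ∀ β ∈ B x X, ((∃ y : 𝓞 K, y ^ 2 - u * β ∈ 𝔡 ^ 2) ↔ P x) := by
    rintro X x β ⟨-, h1, -⟩
    refine sq_sub_mem_congr ?_
    rw [show (u : 𝓞 K) * β - u * m * Quotient.out (x : 𝓞 K ⧸ Ideal.span {(4 : 𝓞 K)}) =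
      u * (β - v x) by simp only [hv]; ring]
    exact Ideal.mul_mem_left _ _ (h4d (hMle h1))
  have hcard : ∀ X, Nat.card {β : 𝓞 K | β ∈ oddConeIntegers K M X ∧
      ∃ y : 𝓞 K, y ^ 2 - u * β ∈ 𝔡 ^ 2} = ∑ x : {x // P x}, Nat.card (B x X) := by
    intro X
    have : ∀ x : {x // P x}, Finite (B x X) := fun x => (hBfin x X).to_subtype
    rw [← Nat.card_sigma]
    symm
    refine Nat.card_eq_of_bijective (fun s => ⟨s.2, hBsub _ _ s.2.2,
      (hPiff X _ _ s.2.2).2 s.1.2⟩) ⟨?_, ?_⟩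
    · rintro ⟨⟨x, hx⟩, ⟨β, hβ⟩⟩ ⟨⟨x', hx'⟩, ⟨β', hβ'⟩⟩ h
      obtain rfl : β = β' := congrArg Subtype.val h
      obtain rfl := hBuniq X β x x' hβ hβ'
      rfl
    · rintro ⟨β, hβ, hy⟩
      obtain ⟨x, hx⟩ := hBex X β hβ
      exact ⟨⟨⟨x, (hPiff X x β hx).1 hy⟩, ⟨β, hx⟩⟩, rfl⟩
  have hlim : Tendsto (fun X : ℝ => ∑ x : {x // P x}, (Nat.card (B x X) : ℝ) / X) atTop
      (𝓝 (∑ x : {x // P x}, κ)) := tendsto_finsetSum _ fun x _ => hBlim x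
  rw [Finset.sum_const, Finset.card_univ, nsmul_eq_mul, ← Nat.card_eq_fintype_card] at hlim
  have hval : (Nat.card {x // P x} : ℝ) * κ = if IsCoprime 𝔡 z then
      κ * Nat.card (𝓞 K ⧸ Ideal.span {(4 : 𝓞 K)})ˣ / Ideal.absNorm 𝔡 else 0 := by
    have hspan : Ideal.span {(u : 𝓞 K) * m} = 𝔟 ^ 2 * z * Y := by
      rw [Ideal.span_singleton_mul_left_unit u.isUnit, hY]
    split_ifs with h
    · have hc : IsCoprime (Ideal.span {(u : 𝓞 K) * m}) 𝔡 := by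
        rw [hspan]
        refine IsCoprime.mul_left (IsCoprime.mul_left (IsCoprime.pow_left ?_) h.symm) ?_
        · exact h𝔟.of_isCoprime_of_dvd_right h𝔡
        · exact hYc.of_isCoprime_of_dvd_right h𝔡
      rw [← absNorm_mul_card_units_sq h𝔡 hc]
      have hd0 : 𝔡 ≠ ⊥ := by
        rintro rfl
        exact (show Ideal.span {(2 : 𝓞 K)} ≠ ⊥ by simp) (zero_dvd_iff.1 h𝔡)
      have : (Ideal.absNorm 𝔡 : ℝ) ≠ 0 := by
        exact_mod_cast (Ideal.absNorm_eq_zero_iff.not.2 hd0)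
      push_cast
      field_simp
      rfl
    · have : IsEmpty {x // P x} := by
        refine ⟨fun ⟨x, hx⟩ => ?_⟩
        refine not_exists_sq_sub_mem (Y := Y * Ideal.span {Quotient.out
          (x : 𝓞 K ⧸ Ideal.span {(4 : 𝓞 K)})}) h𝔡 h𝔟 hz (IsCoprime.mul_left hYc ?_) ?_ h hx
        · rw [← hcop4, ← isUnit_mk_iff_isCoprime, Ideal.Quotient.mk_out]
          exact x.isUnit
        · rw [← Ideal.span_singleton_mul_span_singleton, hspan, mul_assoc]
      simp
  rw [hval] at hlim
  refine hlim.congr fun X => ?_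
  rw [hcard]
  push_cast
  rw [Finset.sum_div]

end ResidueCount

section JordanTotient

/-- The second Jordan totient of the `k`-th power of a prime of norm `x`. -/
def jordanPow (x : ℝ) : ℕ → ℝ
  | 0 => 1
  | k + 1 => x ^ (2 * (k + 1)) - x ^ (2 * k)

theorem sum_jordanPow (x : ℝ) (c : ℕ) :
    ∑ k ∈ Finset.range (c + 1), jordanPow x k = x ^ (2 * c) := by
  induction c with
  | zero => simp [jordanPow]
  | succ c ih => rw [Finset.sum_range_succ, ih, jordanPow]; ring

theorem sum_jordanPow_div {x : ℝ} (hx : x ≠ 0) (c : ℕ) :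
    ∑ k ∈ Finset.range (c + 1), jordanPow x k / x ^ k = x ^ c * (1 + 1 / x) - 1 / x := by
  induction c with
  | zero => simp [jordanPow]
  | succ c ih =>
    rw [Finset.sum_range_succ, ih, jordanPow]
    field_simp
    ring

variable {ι : Type*} [Fintype ι] [DecidableEq ι]

theorem sum_prod_jordanPow (x : ι → ℝ) {c e : ι → ℕ} (h : ∀ q, c q ≤ e q) :
    ∑ k ∈ Fintype.piFinset (fun q => Finset.range (e q + 1)),
      (if ∀ q, k q ≤ c q then ∏ q, jordanPow (x q) (k q) else 0) = ∏ q, x q ^ (2 * c q) := by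
  rw [← Finset.sum_filter]
  simp_rw [← sum_jordanPow]
  rw [Finset.prod_univ_sum]
  refine Finset.sum_congr ?_ fun _ _ => rfl
  ext k
  simp only [Finset.mem_filter, Fintype.mem_piFinset, Finset.mem_range]
  constructor
  · rintro ⟨-, h2⟩ q
    exact Nat.lt_succ_of_le (h2 q)
  · intro h2
    exact ⟨fun q => (h2 q).trans_le (Nat.succ_le_succ (h q)), fun q => Nat.le_of_lt_succ (h2 q)⟩

theorem sum_finset_prod_ite {ι : Type*} [Fintype ι] [DecidableEq ι] (a b : ι → ℝ) :
    ∑ s : Finset ι, ∏ q, (if q ∈ s then a q else b q) = ∏ q, (a q + b q) := by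
  rw [Finset.prod_add, Finset.powerset_univ]
  refine Finset.sum_congr rfl fun s _ => ?_
  rw [← Finset.prod_mul_prod_compl s]
  congr 1
  · exact Finset.prod_congr rfl fun q hq => if_pos hq
  · rw [← Finset.compl_eq_univ_sdiff]
    exact Finset.prod_congr rfl fun q hq => if_neg (Finset.mem_compl.1 hq)

theorem sum_sum_jordanPow {x : ι → ℝ} (hx : ∀ q, x q ≠ 0) (e : ι → ℕ) :
    ∑ s : Finset ι, ∑ k ∈ Fintype.piFinset (fun q => Finset.range (e q + 1)),
      (∏ q, jordanPow (x q) (k q)) * (if ∀ q ∈ s, k q = 0 then 1 / ∏ q, x q ^ k q else 0) /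
        ∏ q ∈ s, x q = (∏ q, x q ^ e q) * ∏ q, (1 + 1 / x q) := by
  have h1 : ∀ s : Finset ι, ∀ k : ι → ℕ,
      (∏ q, jordanPow (x q) (k q)) * (if ∀ q ∈ s, k q = 0 then 1 / ∏ q, x q ^ k q else 0) /
        ∏ q ∈ s, x q = ∏ q, (jordanPow (x q) (k q) / x q ^ k q *
          (if q ∈ s then (if k q = 0 then 1 / x q else 0) else 1)) := by
    intro s k
    rw [Finset.prod_mul_distrib, Finset.prod_div_distrib]
    have h2 : ∏ q, (if q ∈ s then (if k q = 0 then 1 / x q else 0) else 1) =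
        if ∀ q ∈ s, k q = 0 then 1 / ∏ q ∈ s, x q else 0 := by
      rw [Finset.prod_ite_mem, Finset.univ_inter]
      split_ifs with h
      · rw [one_div, ← Finset.prod_inv_distrib]
        refine Finset.prod_congr rfl fun q hq => ?_
        rw [if_pos (h q hq), one_div]
      · push Not at h
        obtain ⟨q, hq, hk⟩ := h
        exact Finset.prod_eq_zero hq (if_neg hk)
    rw [h2]
    split_ifs <;> simp [div_eq_mul_inv, mul_assoc]
  simp_rw [h1]
  have h3 : ∀ s : Finset ι, ∑ k ∈ Fintype.piFinset (fun q => Finset.range (e q + 1)),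
      ∏ q, (jordanPow (x q) (k q) / x q ^ k q *
          (if q ∈ s then (if k q = 0 then 1 / x q else 0) else 1)) =
      ∏ q, (if q ∈ s then 1 / x q else x q ^ e q * (1 + 1 / x q) - 1 / x q) := by
    intro s
    rw [← Finset.prod_univ_sum (fun q => Finset.range (e q + 1)) (fun q k =>
      jordanPow (x q) k / x q ^ k * (if q ∈ s then (if k = 0 then 1 / x q else 0) else 1))]
    refine Finset.prod_congr rfl fun q _ => ?_
    split_ifs with hq
    · rw [Finset.sum_eq_single 0]
      · simp [jordanPow]
      · intro k _ hk
        simp [hk]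
      · simp
    · simp_rw [mul_one]
      exact sum_jordanPow_div (hx q) (e q)
  simp_rw [h3]
  rw [sum_finset_prod_ite, ← Finset.prod_mul_distrib]
  exact Finset.prod_congr rfl fun q _ => by ring

end JordanTotient

section PrimesOverTwo

variable (K : Type*) [Field K] [NumberField K]

open scoped Classical in
/-- The primes above `2`. -/
noncomputable def primesOverTwo : Finset (Ideal (𝓞 K)) :=
  (UniqueFactorizationMonoid.normalizedFactors (Ideal.span {(2 : 𝓞 K)})).toFinset

variable {K}

theorem mem_primesOverTwo {q : Ideal (𝓞 K)} :
    q ∈ primesOverTwo K ↔ q.IsPrime ∧ q ∣ Ideal.span {2} := by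
  have h2 : Ideal.span {(2 : 𝓞 K)} ≠ 0 := by simp
  rw [primesOverTwo, Multiset.mem_toFinset, UniqueFactorizationMonoid.mem_normalizedFactors_iff' h2]
  constructor
  · rintro ⟨h1, -, h3⟩
    exact ⟨Ideal.isPrime_of_prime h1.prime, h3⟩
  · rintro ⟨h1, h3⟩
    refine ⟨((Ideal.prime_iff_isPrime ?_).2 h1).irreducible, normalize_eq _, h3⟩
    rintro rfl
    exact h2 (zero_dvd_iff.1 h3)

theorem prime_of_mem_primesOverTwo (q : primesOverTwo K) : Prime (q : Ideal (𝓞 K)) := by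
  obtain ⟨h1, h2⟩ := mem_primesOverTwo.1 q.2
  refine (Ideal.prime_iff_isPrime ?_).2 h1
  intro h
  rw [h] at h2
  exact (show Ideal.span {(2 : 𝓞 K)} ≠ 0 by simp) (zero_dvd_iff.1 h2)

theorem isCoprime_primesOverTwo {q q' : primesOverTwo K} (h : q ≠ q') :
    IsCoprime (q : Ideal (𝓞 K)) (q' : Ideal (𝓞 K)) := by
  refine (Ideal.isCoprime_of_not_dvd (mem_primesOverTwo.1 q'.2).1
    (prime_of_mem_primesOverTwo q').ne_zero fun hd => h ?_)
  have := (prime_of_mem_primesOverTwo q').associated_of_dvd (prime_of_mem_primesOverTwo q) hd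
  exact Subtype.ext (associated_iff_eq.1 this).symm

theorem Ideal.exists_eq_prod_primesOverTwo {I : Ideal (𝓞 K)} (hI : I ≠ 0)
    (h : ∀ p : Ideal (𝓞 K), p.IsPrime → p ∣ I → p ∣ Ideal.span {2}) :
    ∃ c : primesOverTwo K → ℕ, I = ∏ q : primesOverTwo K, (q : Ideal (𝓞 K)) ^ c q := by
  classical
  refine ⟨fun q => (UniqueFactorizationMonoid.normalizedFactors I).count (q : Ideal (𝓞 K)), ?_⟩
  rw [Finset.prod_coe_sort (primesOverTwo K)
    (fun q => q ^ (UniqueFactorizationMonoid.normalizedFactors I).count q)]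
  conv_lhs => rw [← associated_iff_eq.1 (UniqueFactorizationMonoid.prod_normalizedFactors hI)]
  rw [Finset.prod_multiset_count]
  refine Finset.prod_subset ?_ ?_
  · intro q hq
    rw [Multiset.mem_toFinset] at hq
    have h1 := Ideal.isPrime_of_prime (UniqueFactorizationMonoid.prime_of_normalized_factor q hq)
    exact mem_primesOverTwo.2
      ⟨h1, h q h1 (UniqueFactorizationMonoid.dvd_of_mem_normalizedFactors hq)⟩
  · intro q _ hq
    rw [Multiset.mem_toFinset] at hq
    rw [Multiset.count_eq_zero_of_notMem hq, pow_zero]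

theorem prod_primesOverTwo_dvd_iff {k c : primesOverTwo K → ℕ} :
    ∏ q : primesOverTwo K, (q : Ideal (𝓞 K)) ^ k q ∣
      ∏ q : primesOverTwo K, (q : Ideal (𝓞 K)) ^ c q ↔ ∀ q, k q ≤ c q := by
  classical
  constructor
  · intro h q
    have h1 : (q : Ideal (𝓞 K)) ^ k q ∣ ∏ q : primesOverTwo K, (q : Ideal (𝓞 K)) ^ c q :=
      (Finset.dvd_prod_of_mem (fun q : primesOverTwo K => (q : Ideal (𝓞 K)) ^ k q)
        (Finset.mem_univ q)).trans h
    rw [← Finset.mul_prod_erase _ _ (Finset.mem_univ q)] at h1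
    have hp := prime_of_mem_primesOverTwo q
    refine (pow_dvd_pow_iff hp.ne_zero hp.not_isUnit).1 (IsCoprime.dvd_of_dvd_mul_right ?_ h1)
    refine IsCoprime.prod_right fun q' hq' => IsCoprime.pow (isCoprime_primesOverTwo ?_)
    exact (Finset.ne_of_mem_erase hq').symm
  · intro h
    exact Finset.prod_dvd_prod_of_dvd _ _ fun q _ => pow_dvd_pow _ (h q)

theorem isCoprime_prod_primesOverTwo_iff {k : primesOverTwo K → ℕ} {s : Finset (primesOverTwo K)} :
    IsCoprime (∏ q : primesOverTwo K, (q : Ideal (𝓞 K)) ^ k q) (∏ q ∈ s, (q : Ideal (𝓞 K))) ↔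
      ∀ q ∈ s, k q = 0 := by
  classical
  rw [IsCoprime.prod_left_iff]
  constructor
  · intro h q hq
    by_contra hk
    have h1 := IsCoprime.prod_right_iff.1 (h q (Finset.mem_univ q)) q hq
    rw [IsCoprime.pow_left_iff (Nat.pos_of_ne_zero hk), isCoprime_self] at h1
    exact (prime_of_mem_primesOverTwo q).not_isUnit h1
  · intro h q _
    refine IsCoprime.prod_right fun q' hq' => ?_
    rcases eq_or_ne q q' with rfl | hqq
    · rw [h q hq', pow_zero]
      exact isCoprime_one_left
    · exact (isCoprime_primesOverTwo hqq).pow_left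

theorem prod_primesOverTwo_injective {s t : Finset (primesOverTwo K)}
    (h : ∏ q ∈ s, (q : Ideal (𝓞 K)) = ∏ q ∈ t, (q : Ideal (𝓞 K))) : s = t := by
  classical
  have key : ∀ s : Finset (primesOverTwo K), ∏ q ∈ s, (q : Ideal (𝓞 K)) =
      ∏ q : primesOverTwo K, (q : Ideal (𝓞 K)) ^ (if q ∈ s then 1 else 0) := by
    intro s
    simp only [pow_ite, pow_one, pow_zero]
    rw [Finset.prod_ite_mem, Finset.univ_inter]
  rw [key, key] at h
  have h1 := prod_primesOverTwo_dvd_iff.1 h.dvd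
  have h2 := prod_primesOverTwo_dvd_iff.1 h.symm.dvd
  ext q
  have h1 := h1 q
  have h2 := h2 q
  by_cases hs : q ∈ s <;> by_cases ht : q ∈ t <;> simp_all

theorem dvd_two_of_dvd_prod_primesOverTwo {s : Finset (primesOverTwo K)} {p : Ideal (𝓞 K)}
    (hp : p.IsPrime) (h : p ∣ ∏ q ∈ s, (q : Ideal (𝓞 K))) : p ∣ Ideal.span {2} := by
  have hp' : Prime p := by
    refine (Ideal.prime_iff_isPrime ?_).2 hp
    rintro rfl
    exact Finset.prod_ne_zero_iff.2 (fun q _ => (prime_of_mem_primesOverTwo q).ne_zero)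
      (zero_dvd_iff.1 h)
  obtain ⟨q, -, hq⟩ := (Prime.dvd_finsetProd_iff hp' _).1 h
  exact hq.trans (mem_primesOverTwo.1 q.2).2

theorem squarefree_prod_primesOverTwo (s : Finset (primesOverTwo K)) :
    Squarefree (∏ q ∈ s, (q : Ideal (𝓞 K))) := by
  classical
  induction s using Finset.induction_on with
  | empty => simp
  | insert q s hq ih =>
    rw [Finset.prod_insert hq]
    rw [squarefree_mul_iff]
    refine ⟨?_, (prime_of_mem_primesOverTwo q).irreducible.squarefree, ih⟩
    refine IsCoprime.isRelPrime (IsCoprime.prod_right fun q' hq' => isCoprime_primesOverTwo ?_)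
    rintro rfl
    exact hq hq'

theorem exists_eq_prod_primesOverTwo_of_squarefree {I : Ideal (𝓞 K)} (hI : Squarefree I)
    (h : ∀ p : Ideal (𝓞 K), p.IsPrime → p ∣ I → p ∣ Ideal.span {2}) :
    ∃ s : Finset (primesOverTwo K), I = ∏ q ∈ s, (q : Ideal (𝓞 K)) := by
  classical
  obtain ⟨c, hc⟩ := Ideal.exists_eq_prod_primesOverTwo hI.ne_zero h
  refine ⟨Finset.univ.filter fun q => c q ≠ 0, ?_⟩
  rw [hc, Finset.prod_filter]
  refine Finset.prod_congr rfl fun q _ => ?_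
  have h1 : c q ≤ 1 := by
    by_contra! h2
    refine (prime_of_mem_primesOverTwo q).not_isUnit (hI _ ?_)
    rw [← pow_two, hc]
    exact (pow_dvd_pow _ h2).trans (Finset.dvd_prod_of_mem _ (Finset.mem_univ q))
  interval_cases c q <;> simp

theorem card_squarefree_over_two :
    Nat.card {I : Ideal (𝓞 K) // Squarefree I ∧
      ∀ p : Ideal (𝓞 K), p.IsPrime → p ∣ I → p ∣ Ideal.span {(2 : 𝓞 K)}} =
    Nat.card (Finset (primesOverTwo K)) := by
  symm
  refine Nat.card_eq_of_bijective (fun s => ⟨∏ q ∈ s, (q : Ideal (𝓞 K)),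
    squarefree_prod_primesOverTwo s, fun p hp h => dvd_two_of_dvd_prod_primesOverTwo hp h⟩) ⟨?_, ?_⟩
  · intro s t h
    exact prod_primesOverTwo_injective (congrArg Subtype.val h)
  · rintro ⟨I, hI, h⟩
    obtain ⟨s, rfl⟩ := exists_eq_prod_primesOverTwo_of_squarefree hI h
    exact ⟨s, rfl⟩

end PrimesOverTwo

section QuadraticSubfields

open IntermediateField

variable {K : Type*} [Field K]

/-- The subfield of the algebraic closure generated by a square root of `a`. -/
noncomputable def sqrtField (a : K) : IntermediateField K (AlgebraicClosure K) :=
  K⟮(IsAlgClosed.exists_pow_nat_eq (algebraMap K (AlgebraicClosure K) a) two_pos).choose⟯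

theorem exists_sqrt_mem_sqrtField (a : K) :
    ∃ θ : sqrtField a, θ ^ 2 = algebraMap K (sqrtField a) a := by
  refine ⟨⟨_, mem_adjoin_simple_self K _⟩, Subtype.ext ?_⟩
  exact (IsAlgClosed.exists_pow_nat_eq (algebraMap K (AlgebraicClosure K) a) two_pos).choose_spec

theorem sqrt_notMem_range {L : Type*} [Field L] [Algebra K L] {a : K} (ha : ¬ IsSquare a) {θ : L}
    (hθ : θ ^ 2 = algebraMap K L a) : θ ∉ Set.range (algebraMap K L) := by
  rintro ⟨c, rfl⟩
  rw [← map_pow] at hθ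
  exact ha ⟨c, by rw [← (algebraMap K L).injective hθ, pow_two]⟩

theorem finrank_adjoin_sqrt {L : Type*} [Field L] [Algebra K L] {a : K} (ha : ¬ IsSquare a) {θ : L}
    (hθ : θ ^ 2 = algebraMap K L a) : Module.finrank K K⟮θ⟯ = 2 := by
  have hintegral : IsIntegral K θ := .of_pow two_pos (hθ ▸ isIntegral_algebraMap)
  have hdeg : (minpoly K θ).natDegree ≤ 2 := by
    have h := Polynomial.natDegree_le_of_dvd (minpoly.dvd K θ
      (p := Polynomial.X ^ 2 - Polynomial.C a) (by simp [hθ]))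
      (Polynomial.X_pow_sub_C_ne_zero two_pos a)
    rwa [Polynomial.natDegree_X_pow_sub_C] at h
  have h2 := (minpoly.two_le_natDegree_iff hintegral).2 (sqrt_notMem_range ha hθ)
  rw [adjoin.finrank hintegral]
  omega

theorem finrank_sqrtField {a : K} (ha : ¬ IsSquare a) : Module.finrank K (sqrtField a) = 2 :=
  finrank_adjoin_sqrt ha
    (IsAlgClosed.exists_pow_nat_eq (algebraMap K (AlgebraicClosure K) a) two_pos).choose_spec

theorem eq_sqrtField {a : K} (ha : ¬ IsSquare a) {L : IntermediateField K (AlgebraicClosure K)}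
    (hL : Module.finrank K L = 2) {x : AlgebraicClosure K} (hx : x ∈ L)
    (hxa : x ^ 2 = algebraMap K (AlgebraicClosure K) a) : L = sqrtField a := by
  have hfin : FiniteDimensional K L := .of_finrank_pos (by omega)
  refine (eq_of_le_of_finrank_eq ?_ (by rw [hL, finrank_sqrtField ha])).symm
  refine (adjoin_simple_le_iff).2 ?_
  generalize_proofs h
  rcases sq_eq_sq_iff_eq_or_eq_neg.1 (h.choose_spec.trans hxa.symm) with h' | h' <;> rw [h']
  exacts [hx, neg_mem hx]

theorem sqrtField_eq_iff [CharZero K] {a b : K} (ha : ¬ IsSquare a) (hb : ¬ IsSquare b) :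
    sqrtField a = sqrtField b ↔ IsSquare (a * b) := by
  have ha0 : a ≠ 0 := fun h => ha (h ▸ .zero)
  constructor
  · intro h
    obtain ⟨x, hx⟩ := exists_sqrt_mem_sqrtField a
    obtain ⟨y', hy'⟩ := exists_sqrt_mem_sqrtField b
    obtain ⟨y, hy⟩ : ∃ y : sqrtField a, y ^ 2 = algebraMap K (sqrtField a) b := by
      rw [h]; exact ⟨y', hy'⟩
    have hyK := sqrt_notMem_range hb hy
    obtain ⟨B, hB0, hB1⟩ := exists_eq_add_mul_sqrt (finrank_sqrtField ha) (sqrt_notMem_range ha hx)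
    have hr := B.sum_repr y
    rw [Fin.sum_univ_two, hB0, hB1, Algebra.smul_def, Algebra.smul_def, mul_one] at hr
    set u := B.repr y 0
    set v := B.repr y 1
    have h2 : algebraMap K (sqrtField a) (u ^ 2 + v ^ 2 * a - b) +
        algebraMap K (sqrtField a) (2 * u * v) * x = 0 := by
      rw [map_sub, ← hy, ← hr]
      simp only [map_add, map_mul, map_pow, ← hx, map_ofNat]
      ring
    have h3 : 2 * u * v = 0 := by
      by_contra h3
      refine sqrt_notMem_range ha hx ⟨-(u ^ 2 + v ^ 2 * a - b) / (2 * u * v), ?_⟩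
      have h3' : algebraMap K (sqrtField a) (2 * u * v) ≠ 0 := by simpa using h3
      rw [map_div₀, div_eq_iff h3', map_neg]
      linear_combination -h2
    rw [h3, map_zero, zero_mul, add_zero, map_eq_zero] at h2
    have h4 : u = 0 ∨ v = 0 := by simpa using h3
    rcases h4 with h4 | h4
    · refine ⟨v * a, ?_⟩
      rw [h4] at h2
      linear_combination (-a) * h2
    · exact absurd ⟨u, by rw [← hr, h4]; simp⟩ hyK
  · rintro ⟨c, hc⟩
    obtain ⟨x, hx⟩ := exists_sqrt_mem_sqrtField a
    have ha0' : (algebraMap K (sqrtField a) a) ≠ 0 := by simpa using ha0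
    have hx0 : x ≠ 0 := by rintro rfl; exact ha0' (by rw [← hx]; simp)
    refine eq_sqrtField hb (finrank_sqrtField ha) (x := ((algebraMap K (sqrtField a) c / x :
      sqrtField a) : AlgebraicClosure K)) (SetLike.coe_mem _) ?_
    have : (algebraMap K (sqrtField a) c / x) ^ 2 = algebraMap K (sqrtField a) b := by
      rw [div_pow, hx, div_eq_iff ha0', ← map_pow, ← map_mul, pow_two, ← hc, mul_comm]
    exact congrArg Subtype.val this

theorem exists_eq_sqrtField [NumberField K] {L : IntermediateField K (AlgebraicClosure K)}
    (hL : Module.finrank K L = 2) : ∃ α : 𝓞 K, ¬ IsSquare (α : K) ∧ L = sqrtField (α : K) := by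
  have hfin : FiniteDimensional K L := .of_finrank_pos (by omega)
  obtain ⟨θ, hθ⟩ : ∃ θ : L, θ ∉ Set.range (algebraMap K L) := by
    by_contra! h
    have := finrank_eq_one_iff'.2 ⟨(1 : L), one_ne_zero, fun w => by
      obtain ⟨c, hc⟩ := h w
      exact ⟨c, by rw [← hc, Algebra.smul_def, mul_one]⟩⟩
    omega
  obtain ⟨B, hB0, hB1⟩ := exists_eq_add_mul_sqrt hL hθ
  have hr := B.sum_repr (θ ^ 2)
  rw [Fin.sum_univ_two, hB0, hB1, Algebra.smul_def, Algebra.smul_def, mul_one] at hr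
  set p := B.repr (θ ^ 2) 0
  set q := B.repr (θ ^ 2) 1
  obtain ⟨d, hd0, hd⟩ := ((IsFractionRing.isAlgebraic_iff ℤ ℚ K).2
    (Algebra.IsAlgebraic.isAlgebraic (p + (q / 2) ^ 2))).exists_integral_multiple
  have hdK : (d : K) ≠ 0 := by exact_mod_cast hd0
  set η : L := algebraMap K L d * (θ - algebraMap K L (q / 2))
  have hη : η ^ 2 = algebraMap K L (d * (d * (p + (q / 2) ^ 2))) := by
    have h2 : algebraMap K L q = 2 * algebraMap K L (q / 2) := by
      rw [← map_ofNat (algebraMap K L) 2, ← map_mul]; congr 1; ring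
    simp only [η, mul_pow, map_mul, map_add, map_pow, map_intCast]
    rw [h2] at hr
    linear_combination (-(d : L) ^ 2) * hr
  have hηK : η ∉ Set.range (algebraMap K L) := by
    rintro ⟨c, hc⟩
    refine hθ ⟨c / d + q / 2, ?_⟩
    have hd' : algebraMap K L d ≠ 0 := by simpa using hd0
    rw [map_add, map_div₀, hc]
    simp only [η]
    field_simp
    ring
  have hintegral : IsIntegral ℤ ((d : K) * (d * (p + (q / 2) ^ 2))) := by
    refine IsIntegral.mul (map_intCast (algebraMap ℤ K) d ▸ isIntegral_algebraMap) ?_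
    rwa [zsmul_eq_mul] at hd
  have hns : ¬ IsSquare ((d : K) * (d * (p + (q / 2) ^ 2))) := by
    rintro ⟨c, hc⟩
    rw [hc, map_mul, ← pow_two] at hη
    rcases sq_eq_sq_iff_eq_or_eq_neg.1 hη with h | h
    · exact hηK ⟨c, h.symm⟩
    · exact hηK ⟨-c, by rw [h, map_neg]⟩
  exact ⟨⟨_, hintegral⟩, hns, eq_sqrtField hns hL η.2 (congrArg Subtype.val hη)⟩

end QuadraticSubfields

section SquarefreeParts

variable {R : Type*} [CommRing R] [IsDedekindDomain R]

theorem Ideal.exists_squarefree_mul_sq {I : Ideal R} (hI : I ≠ ⊥) :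
    ∃ A 𝔪 : Ideal R, Squarefree A ∧ I = A * 𝔪 ^ 2 := by
  induction I using UniqueFactorizationMonoid.induction_on_prime with
  | h₁ => exact absurd rfl hI
  | h₂ x hx => exact ⟨x, 1, hx.squarefree, by rw [one_pow, mul_one]⟩
  | h₃ a p ha hp ih =>
    obtain ⟨A, 𝔪, hA, rfl⟩ := ih ha
    by_cases hpA : p ∣ A
    · obtain ⟨A', rfl⟩ := hpA
      exact ⟨A', p * 𝔪, hA.of_mul_right, by ring⟩
    · refine ⟨p * A, 𝔪, ?_, by ring⟩
      rw [squarefree_mul_iff]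
      exact ⟨(hp.irreducible.isRelPrime_iff_not_dvd).2 hpA, hp.irreducible.squarefree, hA⟩

theorem Ideal.eq_of_squarefree_of_mul_eq_sq {A B Q : Ideal R} (hA : Squarefree A)
    (hB : Squarefree B) (h : A * B = Q ^ 2) : A = Q ∧ B = Q := by
  have hQ : Q ≠ ⊥ := by
    rintro rfl
    have : A * B = 0 := by rw [h]; exact zero_pow two_ne_zero
    exact mul_ne_zero hA.ne_zero hB.ne_zero this
  obtain ⟨B', rfl⟩ := Ideal.dvd_of_sq_dvd_squarefree_mul_sq hA hQ (J := B)
    ⟨B, by rw [← h]; ring⟩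
  obtain ⟨A', rfl⟩ := Ideal.dvd_of_sq_dvd_squarefree_mul_sq hB hQ (J := A)
    ⟨A, by rw [← h]; ring⟩
  have h1 : Q ^ 2 * (A' * B') = Q ^ 2 * 1 := by
    rw [mul_one, pow_two, ← mul_mul_mul_comm, h, pow_two]
  have h2 := mul_left_cancel₀ (pow_ne_zero 2 hQ) h1
  have hA' : A' = 1 := Ideal.isUnit_iff.1 (IsUnit.of_mul_eq_one _ h2) |>.trans Ideal.one_eq_top.symm
  have hB' : B' = 1 :=
    (Ideal.isUnit_iff.1 (IsUnit.of_mul_eq_one _ ((mul_comm _ _).trans h2))).trans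
      Ideal.one_eq_top.symm
  simp [hA', hB']

end SquarefreeParts

section Partition

variable {K : Type*} [Field K] [NumberField K]

theorem isCoprime_two_iff {F : Ideal (𝓞 K)} : IsCoprime F (Ideal.span {2}) ↔
    ∀ p : Ideal (𝓞 K), p.IsPrime → p ∣ F → ¬ p ∣ Ideal.span {2} := by
  constructor
  · intro h p hp h1 h2
    exact hp.ne_top (Ideal.isUnit_iff.1 (h.isUnit_of_dvd' h1 h2))
  · intro h
    rw [Ideal.isCoprime_iff_sup_eq]
    by_contra hne
    obtain ⟨p, hp, hle⟩ := Ideal.exists_le_maximal _ hne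
    exact h p hp.isPrime (Ideal.dvd_iff_le.2 (le_sup_left.trans hle))
      (Ideal.dvd_iff_le.2 (le_sup_right.trans hle))

theorem isCoprime_of_dvd_two {E F : Ideal (𝓞 K)}
    (hE : ∀ p : Ideal (𝓞 K), p.IsPrime → p ∣ E → p ∣ Ideal.span {2})
    (hF : ∀ p : Ideal (𝓞 K), p.IsPrime → p ∣ F → ¬ p ∣ Ideal.span {2}) : IsCoprime E F := by
  rw [Ideal.isCoprime_iff_sup_eq]
  by_contra hne
  obtain ⟨p, hp, hle⟩ := Ideal.exists_le_maximal _ hne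
  exact hF p hp.isPrime (Ideal.dvd_iff_le.2 (le_sup_right.trans hle))
    (hE p hp.isPrime (Ideal.dvd_iff_le.2 (le_sup_left.trans hle)))

theorem IsLPartition.unique {I E F E' F' : Ideal (𝓞 K)}
    (h : IsLPartition (Ideal.span {2}) I E F) (h' : IsLPartition (Ideal.span {2}) I E' F') :
    E = E' ∧ F = F' := by
  have key : ∀ {E F E' F' : Ideal (𝓞 K)}, IsLPartition (Ideal.span {2}) I E F →
      IsLPartition (Ideal.span {2}) I E' F' → E ∣ E' ∧ F ∣ F' := by
    intro E F E' F' h h'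
    constructor
    · refine (isCoprime_of_dvd_two h.2.1 h'.2.2).dvd_of_dvd_mul_right ?_
      rw [← h'.1, h.1]
      exact dvd_mul_right _ _
    · refine (isCoprime_of_dvd_two h'.2.1 h.2.2).symm.dvd_of_dvd_mul_left ?_
      rw [← h'.1, h.1]
      exact dvd_mul_left _ _
  exact ⟨dvd_antisymm (key h h').1 (key h' h).1, dvd_antisymm (key h h').2 (key h' h).2⟩

theorem exists_squarefree_partition {A : Ideal (𝓞 K)} (hA : Squarefree A) :
    ∃ (s : Finset (primesOverTwo K)) (F : Ideal (𝓞 K)), Squarefree F ∧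
      IsCoprime F (Ideal.span {2}) ∧ A = (∏ q ∈ s, (q : Ideal (𝓞 K))) * F := by
  obtain ⟨G, A', T, hG, hAG, h2, hc⟩ :=
    Ideal.exists_coprime_factors (J := Ideal.span {2}) hA.ne_zero
  have hGA : Squarefree G := (hAG ▸ hA).of_mul_left
  obtain ⟨s, hs⟩ := exists_eq_prod_primesOverTwo_of_squarefree hGA
    fun p _ hpG => hpG.trans ⟨T, h2⟩
  refine ⟨s, A', (hAG ▸ hA).of_mul_right, ?_, hs ▸ hAG⟩
  rw [h2]
  refine IsCoprime.mul_right (Ideal.isCoprime_iff_sup_eq.2 (Ideal.isUnit_iff.1 ?_)) hc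
  exact (squarefree_mul_iff.1 (hAG ▸ hA)).1 (Ideal.dvd_iff_le.2 le_sup_right)
    (Ideal.dvd_iff_le.2 le_sup_left)

end Partition

section Representatives

variable (K : Type*) [Field K] [NumberField K]

theorem finite_units_quotient_sq :
    Finite ((𝓞 K)ˣ ⧸ (powMonoidHom 2 : (𝓞 K)ˣ →* (𝓞 K)ˣ).range) := by
  have : Group.FG ((𝓞 K)ˣ) := Group.fg_iff_monoid_fg.2 inferInstance
  have : Group.FG ((𝓞 K)ˣ ⧸ (powMonoidHom 2 : (𝓞 K)ˣ →* (𝓞 K)ˣ).range) := inferInstance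
  refine CommGroup.finite_of_fg_isMulTorsion _ fun g => ?_
  induction g using QuotientGroup.induction_on with | H u => ?_
  refine isOfFinOrder_iff_pow_eq_one.2 ⟨2, two_pos, ?_⟩
  rw [← QuotientGroup.mk_pow, QuotientGroup.eq_one_iff]
  exact ⟨u, rfl⟩

/-- Each ideal class is represented by an ideal coprime to `2`. -/
theorem exists_coprime_representatives :
    ∃ 𝔟 : ClassGroup (𝓞 K) → Ideal (𝓞 K), (∀ C, 𝔟 C ≠ ⊥ ∧ IsCoprime (𝔟 C) (Ideal.span {2})) ∧
      ∀ I : Ideal (𝓞 K), I ≠ ⊥ → ∃! C, (I * 𝔟 C).IsPrincipal := by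
  have H : ∀ C : ClassGroup (𝓞 K), ∃ (J : nonZeroDivisors (Ideal (𝓞 K))),
      ClassGroup.mk0 J = C ∧ IsCoprime (J : Ideal (𝓞 K)) (Ideal.span {2}) := by
    intro C
    obtain ⟨I, hI⟩ := ClassGroup.mk0_surjective C⁻¹
    obtain ⟨y, -, Y, hY, hc⟩ := Ideal.exists_span_eq_mul_coprime
      (nonZeroDivisors.ne_zero I.2) (N := Ideal.span {(2 : 𝓞 K)}) (by simp)
    have hY0 : Y ≠ 0 := by
      rintro rfl
      rw [Ideal.zero_eq_bot, Ideal.isCoprime_iff_sup_eq, bot_sup_eq,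
        Ideal.span_singleton_eq_top] at hc
      exact not_isUnit_two hc
    refine ⟨⟨Y, mem_nonZeroDivisors_of_ne_zero hY0⟩, ?_, hc⟩
    rw [← inv_inv C, ← hI, eq_comm, inv_eq_iff_mul_eq_one, ← map_mul]
    refine (ClassGroup.mk0_eq_one_iff (Submonoid.mul_mem _ I.2
      (mem_nonZeroDivisors_of_ne_zero hY0))).2 ⟨y, ?_⟩
    exact hY.symm
  choose 𝔟 h𝔟 hc using H
  refine ⟨fun C => 𝔟 C, fun C => ⟨nonZeroDivisors.ne_zero (𝔟 C).2, hc C⟩, fun I hI => ?_⟩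
  have key : ∀ C, (I * 𝔟 C).IsPrincipal ↔
      C = (ClassGroup.mk0 ⟨I, mem_nonZeroDivisors_of_ne_zero hI⟩)⁻¹ := by
    intro C
    rw [← ClassGroup.mk0_eq_one_iff
      (Submonoid.mul_mem _ (mem_nonZeroDivisors_of_ne_zero hI) (𝔟 C).2)]
    rw [eq_inv_iff_mul_eq_one, mul_comm C]
    nth_rw 4 [← h𝔟 C]
    rw [← map_mul]
    rfl
  exact ⟨_, (key _).2 rfl, fun C hC => (key C).1 hC⟩

end Representatives

section Parametrization

variable {K : Type*} [Field K]

theorem isSquare_coe_iff {x : 𝓞 K} : IsSquare (x : K) ↔ IsSquare x := by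
  constructor
  · rintro ⟨c, hc⟩
    have hintegral : IsIntegral ℤ c := .of_pow two_pos (by rw [pow_two, ← hc]; exact x.2)
    exact ⟨⟨c, hintegral⟩, RingOfIntegers.ext hc⟩
  · rintro ⟨c, rfl⟩
    exact ⟨c, map_mul (algebraMap (𝓞 K) K) c c⟩

variable [NumberField K]

variable (K) in
/-- Ideal classes, squarefree ideals over `2`, and units modulo squares. -/
abbrev SquareClassIndex : Type _ :=
  ClassGroup (𝓞 K) × Finset (primesOverTwo K) ×
    ((𝓞 K)ˣ ⧸ (powMonoidHom 2 : (𝓞 K)ˣ →* (𝓞 K)ˣ).range)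

/-- The modulus attached to an index: the square part and the even squarefree part. -/
noncomputable def SquareClassIndex.modulus (𝔟 : ClassGroup (𝓞 K) → Ideal (𝓞 K))
    (i : SquareClassIndex K) : Ideal (𝓞 K) :=
  𝔟 i.1 ^ 2 * ∏ q ∈ i.2.1, (q : Ideal (𝓞 K))

/-- Parameters for the square classes of `K` whose odd squarefree part has norm at most `X`. -/
def squareClassParams (𝔟 : ClassGroup (𝓞 K) → Ideal (𝓞 K)) (X : ℝ) :
    Set (SquareClassIndex K × 𝓞 K) :=
  {t | t.2 ∈ oddConeIntegers K (t.1.modulus 𝔟) X}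

/-- The integer attached to a parameter. -/
noncomputable def squareClassValue (t : SquareClassIndex K × 𝓞 K) : 𝓞 K :=
  ((t.1.2.2.out : (𝓞 K)ˣ) : 𝓞 K) * t.2

theorem span_squareClassValue (t : SquareClassIndex K × 𝓞 K) :
    Ideal.span {squareClassValue t} = Ideal.span {t.2} := by
  rw [squareClassValue, Ideal.span_singleton_mul_left_unit (Units.isUnit _)]

theorem Ideal.eq_and_span_eq_of_mul_eq_sq {α₀ α γ : 𝓞 K} {A B 𝔪 𝔟 : Ideal (𝓞 K)}
    (hA : Squarefree A) (hB : Squarefree B) (h𝔪 : 𝔪 ≠ ⊥) (h𝔟 : 𝔟 ≠ ⊥)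
    (h₀ : Ideal.span {α₀} = A * 𝔪 ^ 2) (h : Ideal.span {α} = B * 𝔟 ^ 2) (hγ : α * α₀ = γ ^ 2) :
    A = B ∧ Ideal.span {γ} = A * 𝔪 * 𝔟 := by
  have h1 : (A * B) * (𝔪 * 𝔟) ^ 2 = Ideal.span {γ} ^ 2 := by
    rw [Ideal.span_singleton_pow, ← hγ, ← Ideal.span_singleton_mul_span_singleton, h, h₀]
    ring
  obtain ⟨Q, hQ⟩ := Ideal.dvd_of_sq_dvd_sq (mul_ne_zero h𝔪 h𝔟) (J := Ideal.span {γ})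
    ⟨A * B, by rw [← h1, mul_comm]⟩
  have h2 : A * B = Q ^ 2 := by
    refine mul_right_cancel₀ (pow_ne_zero 2 (mul_ne_zero h𝔪 h𝔟)) ?_
    rw [h1, hQ]
    ring
  obtain ⟨rfl, rfl⟩ := Ideal.eq_of_squarefree_of_mul_eq_sq hA hB h2
  exact ⟨rfl, by rw [hQ]; ring⟩

theorem isLPartition_squarefree (s : Finset (primesOverTwo K)) {F : Ideal (𝓞 K)}
    (hF : IsCoprime F (Ideal.span {2})) :
    IsLPartition (Ideal.span {2}) ((∏ q ∈ s, (q : Ideal (𝓞 K))) * F)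
      (∏ q ∈ s, (q : Ideal (𝓞 K))) F :=
  ⟨rfl, fun _ hp h => dvd_two_of_dvd_prod_primesOverTwo hp h, isCoprime_two_iff.1 hF⟩

theorem squarefree_prod_primesOverTwo_mul (s : Finset (primesOverTwo K)) {F : Ideal (𝓞 K)}
    (hF : Squarefree F) (hF2 : IsCoprime F (Ideal.span {2})) :
    Squarefree ((∏ q ∈ s, (q : Ideal (𝓞 K))) * F) := by
  refine squarefree_mul_iff.2 ⟨fun d h1 h2 => ?_, squarefree_prod_primesOverTwo s, hF⟩
  refine IsCoprime.isUnit_of_dvd' (isCoprime_of_dvd_two ?_ (isCoprime_two_iff.1 hF2)) h1 h2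
  exact fun _ hp h => dvd_two_of_dvd_prod_primesOverTwo hp h

/-- Each square class is parametrized exactly `torsionOrder K` times. -/
theorem card_squareClass_fiber {𝔟 : ClassGroup (𝓞 K) → Ideal (𝓞 K)} (h𝔟 : ∀ C, 𝔟 C ≠ ⊥)
    (hex : ∀ I : Ideal (𝓞 K), I ≠ ⊥ → ∃! C, (I * 𝔟 C).IsPrincipal) {α₀ : 𝓞 K} (hα₀ : α₀ ≠ 0) :
    Nat.card {t : SquareClassIndex K × 𝓞 K | (∃ X, t ∈ squareClassParams 𝔟 X) ∧
      IsSquare (squareClassValue t * α₀)} = Units.torsionOrder K := by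
  obtain ⟨A, 𝔪, hA, hα₀A⟩ :=
    Ideal.exists_squarefree_mul_sq (I := Ideal.span {α₀}) (by simpa using hα₀)
  have h𝔪 : 𝔪 ≠ ⊥ := by
    rintro rfl
    rw [← Ideal.zero_eq_bot, zero_pow two_ne_zero, mul_zero, Ideal.zero_eq_bot,
      Ideal.span_singleton_eq_bot] at hα₀A
    exact hα₀ hα₀A
  obtain ⟨s₀, F₀, hF₀, hF₀2, rfl⟩ := exists_squarefree_partition hA
  set A := (∏ q ∈ s₀, (q : Ideal (𝓞 K))) * F₀
  obtain ⟨C₀, ⟨γ₀, hγ₀⟩, hC₀⟩ := hex (A * 𝔪) (mul_ne_zero hA.ne_zero h𝔪)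
  simp only [Ideal.submodule_span_eq] at hγ₀
  obtain ⟨α₁, hα₁⟩ : α₀ ∣ γ₀ ^ 2 := by
    rw [← Ideal.span_singleton_le_span_singleton, ← Ideal.dvd_iff_le, ← Ideal.span_singleton_pow,
      ← hγ₀, hα₀A]
    exact ⟨A * 𝔟 C₀ ^ 2, by ring⟩
  have hα₁A : Ideal.span {α₁} = A * 𝔟 C₀ ^ 2 := by
    have h0 : Ideal.span {α₀} ≠ 0 := by simpa using hα₀
    refine mul_left_cancel₀ h0 ?_
    rw [Ideal.span_singleton_mul_span_singleton, ← hα₁, ← Ideal.span_singleton_pow, ← hγ₀, hα₀A]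
    ring
  have hα₁0 : α₁ ≠ 0 := by
    rintro rfl
    rw [eq_comm, Ideal.span_singleton_zero, ← Ideal.zero_eq_bot] at hα₁A
    exact mul_ne_zero hA.ne_zero (pow_ne_zero 2 (h𝔟 C₀)) hα₁A
  obtain ⟨v, hv⟩ := exists_units_mul_mem_coneIntegers hα₁0
  have hvspan : Ideal.span {(v : 𝓞 K) * α₁} = Ideal.span {α₁} :=
    Ideal.span_singleton_mul_left_unit v.isUnit _
  let f : Units.torsion K → SquareClassIndex K × 𝓞 K := fun ζ =>
    ((C₀, s₀, (((ζ : (𝓞 K)ˣ) * v : (𝓞 K)ˣ) : (𝓞 K)ˣ ⧸ _)⁻¹), ((ζ : (𝓞 K)ˣ) : 𝓞 K) * (v * α₁))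
  have hf : Function.Injective f := by
    intro ζ ζ' h
    have h2 : ((ζ : (𝓞 K)ˣ) : 𝓞 K) * (v * α₁) = ((ζ' : (𝓞 K)ˣ) : 𝓞 K) * (v * α₁) :=
      congrArg Prod.snd h
    exact Subtype.ext (Units.ext (mul_right_cancel₀ (ne_zero_of_mem_coneIntegers hv) h2))
  -- a parameter over `(C₀, s₀)` with value in the class of `α₁`
  have hunit : ∀ (g : (𝓞 K)ˣ ⧸ (powMonoidHom 2 : (𝓞 K)ˣ →* (𝓞 K)ˣ).range) (w : (𝓞 K)ˣ),
      IsSquare (((g.out : (𝓞 K)ˣ) : 𝓞 K) * (w * α₁) * α₀) ↔ g = ((w : (𝓞 K)ˣ) : (𝓞 K)ˣ ⧸ _)⁻¹ := by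
    intro g w
    have e : ((g.out : (𝓞 K)ˣ) : 𝓞 K) * (w * α₁) * α₀ = ((g.out * w : (𝓞 K)ˣ) : 𝓞 K) * γ₀ ^ 2 := by
      rw [hα₁]; push_cast; ring
    have hγ0 : γ₀ ≠ 0 := by
      rintro rfl
      rw [zero_pow two_ne_zero, eq_comm, mul_eq_zero] at hα₁
      exact hα₁.elim hα₀ hα₁0
    have e2 : g = ((w : (𝓞 K)ˣ) : (𝓞 K)ˣ ⧸ _)⁻¹ ↔
        ((g.out * w : (𝓞 K)ˣ) : (𝓞 K)ˣ ⧸ (powMonoidHom 2 : (𝓞 K)ˣ →* (𝓞 K)ˣ).range) = 1 := by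
      rw [QuotientGroup.mk_mul, QuotientGroup.out_eq', ← eq_inv_iff_mul_eq_one]
    rw [e, e2, QuotientGroup.eq_one_iff]
    constructor
    · rintro ⟨c, hc⟩
      obtain ⟨d, rfl⟩ : γ₀ ∣ c := by
        rw [← IsIntegrallyClosed.pow_dvd_pow_iff two_ne_zero]
        exact ⟨_, by rw [pow_two c, ← hc, mul_comm]⟩
      have hd : ((g.out * w : (𝓞 K)ˣ) : 𝓞 K) = d ^ 2 :=
        mul_right_cancel₀ (pow_ne_zero 2 hγ0) (by rw [hc]; ring)
      have hdu : IsUnit d := (isUnit_pow_iff two_ne_zero).1 (hd ▸ Units.isUnit _)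
      exact ⟨hdu.unit, Units.ext (by simpa using hd.symm)⟩
    · rintro ⟨d, hd⟩
      refine ⟨d * γ₀, ?_⟩
      rw [← hd]
      simp only [powMonoidHom_apply, Units.val_pow_eq_pow_val]
      ring
  have hrange : {t : SquareClassIndex K × 𝓞 K | (∃ X, t ∈ squareClassParams 𝔟 X) ∧
      IsSquare (squareClassValue t * α₀)} = Set.range f := by
    ext ⟨⟨C, s, g⟩, β⟩
    constructor
    · rintro ⟨⟨X, hβ, F, hβF, hF, hF2, -⟩, ⟨γ, hγ⟩⟩
      have hval : Ideal.span {squareClassValue ((C, s, g), β)} =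
          ((∏ q ∈ s, (q : Ideal (𝓞 K))) * F) * 𝔟 C ^ 2 := by
        rw [span_squareClassValue, hβF, SquareClassIndex.modulus]; ring
      obtain ⟨hAB, hγspan⟩ := Ideal.eq_and_span_eq_of_mul_eq_sq hA
        (squarefree_prod_primesOverTwo_mul s hF hF2) h𝔪 (h𝔟 C) hα₀A hval (hγ.trans (pow_two γ).symm)
      obtain rfl : C = C₀ := hC₀ C ⟨γ, by rw [← hγspan]⟩
      obtain ⟨hs, hFF⟩ := (isLPartition_squarefree s₀ hF₀2).unique
        (by change IsLPartition _ A _ _; rw [hAB]; exact isLPartition_squarefree s hF2)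
      obtain rfl := prod_primesOverTwo_injective hs
      have hspan : Ideal.span {(v : 𝓞 K) * α₁} = Ideal.span {β} := by
        rw [hvspan, hα₁A, hβF, hAB, SquareClassIndex.modulus]; ring
      obtain ⟨ζ, hζ⟩ := exists_torsion_of_span_eq hv hβ hspan
      refine ⟨ζ, ?_⟩
      have hsq : IsSquare (((g.out : (𝓞 K)ˣ) : 𝓞 K) *
          ((((ζ : (𝓞 K)ˣ) * v : (𝓞 K)ˣ) : 𝓞 K) * α₁) * α₀) := by
        refine ⟨γ, ?_⟩
        rw [← hγ, squareClassValue, ← hζ]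
        push_cast
        ring
      rw [hunit] at hsq
      simp only [f, hζ, hsq]
    · rintro ⟨ζ, hζ⟩
      rw [← hζ]
      refine ⟨⟨Ideal.absNorm F₀, (units_mul_mem_coneIntegers_iff hv ζ).2 ζ.2,
        F₀, ?_, hF₀, hF₀2, le_rfl⟩, ?_⟩
      · simp only [f, SquareClassIndex.modulus]
        rw [Ideal.span_singleton_mul_left_unit (Units.isUnit _), hvspan, hα₁A]
        simp only [A]
        ring
      · have := (hunit _ ((ζ : (𝓞 K)ˣ) * v)).2 rfl
        rw [Units.val_mul, mul_assoc (((ζ : (𝓞 K)ˣ)) : 𝓞 K)] at this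
        exact this
  rw [hrange, Nat.card_range_of_injective hf, Units.torsionOrder]

end Parametrization

section FiberSum

theorem sum_comp_eq_card_fiber_mul_sum {T Λ : Type*} [DecidableEq Λ] {f : T → Λ} {A : Finset T}
    {S : Set Λ} {w : ℕ} (hw : 0 < w) (hAS : ∀ t ∈ A, f t ∈ S)
    (hfib : ∀ L ∈ S, (A.filter fun t => f t = L).card = w) :
    ∃ hS : S.Finite, ∀ φ : Λ → ℝ, ∑ t ∈ A, φ (f t) = w * ∑ L ∈ hS.toFinset, φ L := by
  have hS : S = (A.image f : Finset Λ) := by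
    ext L
    rw [Finset.coe_image]
    constructor
    · intro hL
      obtain ⟨t, ht⟩ := Finset.card_pos.1 ((hfib L hL).symm ▸ hw)
      rw [Finset.mem_filter] at ht
      exact ⟨t, ht.1, ht.2⟩
    · rintro ⟨t, ht, rfl⟩
      exact hAS t ht
  have hSf : S.Finite := hS ▸ Finset.finite_toSet _
  refine ⟨hSf, fun φ => ?_⟩
  rw [← Finset.sum_fiberwise_of_maps_to (g := f) (t := hSf.toFinset) (by simpa using hAS),
    Finset.mul_sum]
  refine Finset.sum_congr rfl fun L hL => ?_
  rw [← hfib L (by simpa using hL), ← nsmul_eq_mul, ← Finset.sum_const]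
  exact Finset.sum_congr rfl fun t ht => by rw [(Finset.mem_filter.1 ht).2]

end FiberSum

section QuadraticFieldCount

variable {K : Type*} [Field K] [NumberField K]

open scoped Classical in
/-- The even part of an ideal. -/
noncomputable def Ideal.evenPart (I : Ideal (𝓞 K)) : Ideal (𝓞 K) :=
  if h : ∃ E F, IsLPartition (Ideal.span {2}) I E F then h.choose else ⊥

theorem IsLPartition.evenPart_eq {I E F : Ideal (𝓞 K)}
    (h : IsLPartition (Ideal.span {2}) I E F) : I.evenPart = E := by
  have hex : ∃ E F, IsLPartition (Ideal.span {2}) I E F := ⟨E, F, h⟩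
  rw [Ideal.evenPart, dif_pos hex]
  obtain ⟨F', hF'⟩ := hex.choose_spec
  exact (hF'.unique h).1

variable (K) in
/-- The quadratic extensions whose discriminant has odd part of norm at most `X`. -/
def quadraticFields (X : ℝ) : Set (IntermediateField K (AlgebraicClosure K)) :=
  {L | Module.finrank K L = 2 ∧ ∃ Lp F : Ideal (𝓞 K),
    IsLPartition (Ideal.span {(2 : 𝓞 K)}) (relDisc K L) Lp F ∧ (Ideal.absNorm F : ℝ) ≤ X}

theorem exists_isLPartition_relDisc {𝔟 : ClassGroup (𝓞 K) → Ideal (𝓞 K)}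
    (h𝔟 : ∀ C, IsCoprime (𝔟 C) (Ideal.span {2})) {t : SquareClassIndex K × 𝓞 K} {F : Ideal (𝓞 K)}
    (htF : Ideal.span {t.2} = t.1.modulus 𝔟 * F) (hF : Squarefree F)
    (hF2 : IsCoprime F (Ideal.span {2})) (ht : ¬ IsSquare (squareClassValue t)) :
    ∃ 𝔪 𝔠 : Ideal (𝓞 K), 𝔪 * 𝔠 = Ideal.span {2} ∧
      IsLPartition (Ideal.span {2}) (relDisc K (sqrtField (squareClassValue t : K)))
        ((∏ q ∈ t.1.2.1, (q : Ideal (𝓞 K))) * 𝔪 ^ 2) F ∧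
      ∀ 𝔡 : Ideal (𝓞 K), 𝔡 ∣ Ideal.span {2} →
        (𝔡 ∣ 𝔠 ↔ ∃ x : 𝓞 K, x ^ 2 - squareClassValue t ∈ 𝔡 ^ 2) := by
  have htK : ¬ IsSquare (squareClassValue t : K) := by rwa [isSquare_coe_iff]
  obtain ⟨θ, hθ⟩ := exists_sqrt_mem_sqrtField (squareClassValue t : K)
  obtain ⟨𝔪, 𝔠, h2, hD, hc⟩ := exists_relDisc_eq (finrank_sqrtField htK) hθ
    (sqrt_notMem_range htK hθ) (squarefree_prod_primesOverTwo_mul t.1.2.1 hF hF2) (h𝔟 t.1.1)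
    (α := squareClassValue t) (by rw [span_squareClassValue, htF, SquareClassIndex.modulus]; ring)
  refine ⟨𝔪, 𝔠, h2, ⟨by rw [hD]; ring, fun p hp hpd => ?_, isCoprime_two_iff.1 hF2⟩, hc⟩
  rcases hp.mul_le.1 (Ideal.le_of_dvd hpd) with h | h
  · exact dvd_two_of_dvd_prod_primesOverTwo hp (Ideal.dvd_iff_le.2 h)
  · exact (Ideal.dvd_iff_le.2 (hp.le_of_pow_le h)).trans ⟨𝔠, h2.symm⟩

theorem ne_zero_of_mem_squareClassParams {𝔟 : ClassGroup (𝓞 K) → Ideal (𝓞 K)} {X : ℝ}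
    {t : SquareClassIndex K × 𝓞 K} (ht : t ∈ squareClassParams 𝔟 X) : squareClassValue t ≠ 0 :=
  mul_ne_zero (Units.ne_zero _) (ne_zero_of_mem_coneIntegers ht.1)

open scoped Classical in
/-- Sums over quadratic fields are sums over nonsquare parameters. -/
theorem sum_squareClassParams_eq {𝔟 : ClassGroup (𝓞 K) → Ideal (𝓞 K)} (h𝔟0 : ∀ C, 𝔟 C ≠ ⊥)
    (h𝔟 : ∀ C, IsCoprime (𝔟 C) (Ideal.span {2}))
    (hex : ∀ I : Ideal (𝓞 K), I ≠ ⊥ → ∃! C, (I * 𝔟 C).IsPrincipal) {X : ℝ}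
    (hT : (squareClassParams 𝔟 X).Finite) :
    ∃ hS : (quadraticFields K X).Finite, ∀ φ : IntermediateField K (AlgebraicClosure K) → ℝ,
      ∑ t ∈ hT.toFinset.filter (fun t => ¬ IsSquare (squareClassValue t)),
        φ (sqrtField (squareClassValue t : K)) =
      Units.torsionOrder K * ∑ L ∈ hS.toFinset, φ L := by
  set A := hT.toFinset.filter fun t => ¬ IsSquare (squareClassValue t)
  have hAS : ∀ t ∈ A, sqrtField (squareClassValue t : K) ∈ quadraticFields K X := by
    intro t ht
    rw [Finset.mem_filter, Set.Finite.mem_toFinset] at ht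
    obtain ⟨⟨-, F, htF, hF, hF2, hFX⟩, hns⟩ := ht
    obtain ⟨𝔪, 𝔠, -, h, -⟩ := exists_isLPartition_relDisc h𝔟 htF hF hF2 hns
    exact ⟨finrank_sqrtField (by rwa [isSquare_coe_iff]), _, F, h, hFX⟩
  refine sum_comp_eq_card_fiber_mul_sum (A := A) (Units.torsionOrder_pos K) hAS ?_
  rintro L ⟨hL, E, F, hEF, hFX⟩
  obtain ⟨α₀, hα₀, rfl⟩ := exists_eq_sqrtField hL
  have hα₀0 : α₀ ≠ 0 := by
    rintro rfl
    exact hα₀ (by simp)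
  rw [← card_squareClass_fiber h𝔟0 hex hα₀0, Nat.card_coe_set_eq, ← Set.ncard_coe_finset]
  congr 1
  ext t
  rw [Finset.mem_coe, Finset.mem_filter, Finset.mem_filter, Set.Finite.mem_toFinset,
    Set.mem_ofPred_eq]
  constructor
  · rintro ⟨⟨htX, hns⟩, ht⟩
    rw [sqrtField_eq_iff (by rwa [isSquare_coe_iff]) hα₀, ← map_mul, isSquare_coe_iff] at ht
    exact ⟨⟨X, htX⟩, ht⟩
  · rintro ⟨⟨X', htX'⟩, ht⟩
    have ht0 := ne_zero_of_mem_squareClassParams htX'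
    have hns : ¬ IsSquare (squareClassValue t : K) := by
      intro h
      have ht : IsSquare ((squareClassValue t : K) * α₀) := isSquare_coe_iff.2 ht
      have h0 : (squareClassValue t : K) ≠ 0 := by simpa using ht0
      refine hα₀ ?_
      have h1 := ht.div h
      rwa [mul_div_cancel_left₀ _ h0] at h1
    have heq : sqrtField (squareClassValue t : K) = sqrtField (α₀ : K) := by
      rw [sqrtField_eq_iff hns hα₀, ← map_mul, isSquare_coe_iff]
      exact ht
    rw [isSquare_coe_iff] at hns
    refine ⟨⟨?_, hns⟩, heq⟩
    obtain ⟨hcone, F', htF, hF, hF2, -⟩ := htX'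
    obtain ⟨𝔪, 𝔠, -, h, -⟩ := exists_isLPartition_relDisc h𝔟 htF hF hF2 hns
    rw [heq] at h
    obtain ⟨-, rfl⟩ := h.unique hEF
    exact ⟨hcone, F', htF, hF, hF2, hFX⟩

end QuadraticFieldCount

section Asymptotics

variable {K : Type*} [Field K] [NumberField K] {𝔟 : ClassGroup (𝓞 K) → Ideal (𝓞 K)}

theorem finite_squareClassParams
    [Fintype ((𝓞 K)ˣ ⧸ (powMonoidHom 2 : (𝓞 K)ˣ →* (𝓞 K)ˣ).range)] {X : ℝ}
    (hfin : ∀ i : SquareClassIndex K, (oddConeIntegers K (i.modulus 𝔟) X).Finite) :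
    (squareClassParams 𝔟 X).Finite := by
  refine (Set.finite_iUnion fun i => (hfin i).image (Prod.mk i)).subset fun t ht => ?_
  exact Set.mem_iUnion.2 ⟨t.1, t.2, ht, rfl⟩

open scoped Classical in
/-- Removing the parameters with square value does not change averages. -/
theorem tendsto_sum_nonsquare (h𝔟 : ∀ C, 𝔟 C ≠ ⊥)
    (hex : ∀ I : Ideal (𝓞 K), I ≠ ⊥ → ∃! C, (I * 𝔟 C).IsPrincipal)
    (hT : ∀ X, (squareClassParams 𝔟 X).Finite) (ψ : SquareClassIndex K × 𝓞 K → ℝ) {l : ℝ}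
    (h : Tendsto (fun X : ℝ => (∑ t ∈ (hT X).toFinset, ψ t) / X) atTop (𝓝 l)) :
    Tendsto (fun X : ℝ => (∑ t ∈ (hT X).toFinset with ¬ IsSquare (squareClassValue t), ψ t) / X)
      atTop (𝓝 l) := by
  have hcard := card_squareClass_fiber h𝔟 hex (one_ne_zero : (1 : 𝓞 K) ≠ 0)
  set Φ := {t : SquareClassIndex K × 𝓞 K | (∃ X, t ∈ squareClassParams 𝔟 X) ∧
      IsSquare (squareClassValue t * 1)} with hΦ
  have hΦfin : Φ.Finite := by
    have : Finite Φ := Nat.finite_of_card_ne_zero (hcard ▸ (Units.torsionOrder_pos K).ne')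
    exact Φ.toFinite
  have hsq : Tendsto (fun X : ℝ =>
      (∑ t ∈ (hT X).toFinset with IsSquare (squareClassValue t), ψ t) / X)
      atTop (𝓝 0) := by
    refine squeeze_zero_norm' (a := fun X => (∑ t ∈ hΦfin.toFinset, |ψ t|) / X) ?_
      (tendsto_const_nhds.div_atTop tendsto_id)
    filter_upwards [eventually_gt_atTop 0] with X hX
    rw [norm_div, Real.norm_of_nonneg hX.le, Real.norm_eq_abs]
    gcongr
    refine (Finset.abs_sum_le_sum_abs _ _).trans
      (Finset.sum_le_sum_of_subset_of_nonneg (fun t ht => ?_) fun _ _ _ => abs_nonneg _)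
    rw [Finset.mem_filter, Set.Finite.mem_toFinset] at ht
    rw [Set.Finite.mem_toFinset]
    exact ⟨⟨X, ht.1⟩, by rw [mul_one]; exact ht.2⟩
  have := h.sub hsq
  rw [sub_zero] at this
  refine this.congr fun X => ?_
  rw [← sub_div, ← Finset.sum_filter_add_sum_filter_not (hT X).toFinset
    (fun t => IsSquare (squareClassValue t)) ψ, add_sub_cancel_left]

theorem sum_squareClassIndex [Fintype ((𝓞 K)ˣ ⧸ (powMonoidHom 2 : (𝓞 K)ˣ →* (𝓞 K)ˣ).range)]
    (f : Finset (primesOverTwo K) → ℝ) :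
    ∑ i : SquareClassIndex K, f i.2.1 = Fintype.card (ClassGroup (𝓞 K)) *
      Fintype.card ((𝓞 K)ˣ ⧸ (powMonoidHom 2 : (𝓞 K)ˣ →* (𝓞 K)ˣ).range) * ∑ s, f s := by
  simp only [Fintype.sum_prod_type, Finset.sum_const, Finset.card_univ, nsmul_eq_mul]
  rw [← Finset.mul_sum, mul_assoc]

open scoped Classical in
theorem tendsto_sum_squareClassParams
    [Fintype ((𝓞 K)ˣ ⧸ (powMonoidHom 2 : (𝓞 K)ˣ →* (𝓞 K)ˣ).range)] {κ : ℝ}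
    (hT : ∀ X, (squareClassParams 𝔟 X).Finite)
    (hfin : ∀ (i : SquareClassIndex K) (X : ℝ), (oddConeIntegers K (i.modulus 𝔟) X).Finite)
    (hlim : ∀ (i : SquareClassIndex K) (u : (𝓞 K)ˣ) (𝔡 : Ideal (𝓞 K)), 𝔡 ∣ Ideal.span {2} →
        Tendsto (fun X : ℝ => (Nat.card {β : 𝓞 K | β ∈ oddConeIntegers K (i.modulus 𝔟) X ∧
            ∃ y : 𝓞 K, y ^ 2 - u * β ∈ 𝔡 ^ 2} : ℝ) / X) atTop
          (𝓝 (if IsCoprime 𝔡 (∏ q ∈ i.2.1, (q : Ideal (𝓞 K))) then κ / Ideal.absNorm 𝔡 else 0)))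
    {ι : Type*} (A : Finset ι) (𝔡 : ι → Ideal (𝓞 K)) (h𝔡 : ∀ k ∈ A, 𝔡 k ∣ Ideal.span {2})
    (c : Finset (primesOverTwo K) → ι → ℝ) :
    Tendsto (fun X : ℝ => (∑ t ∈ (hT X).toFinset, ∑ k ∈ A, c t.1.2.1 k *
      (if ∃ x : 𝓞 K, x ^ 2 - squareClassValue t ∈ 𝔡 k ^ 2 then 1 else 0)) / X) atTop
      (𝓝 (Fintype.card (ClassGroup (𝓞 K)) *
        Fintype.card ((𝓞 K)ˣ ⧸ (powMonoidHom 2 : (𝓞 K)ˣ →* (𝓞 K)ˣ).range) *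
        ∑ s : Finset (primesOverTwo K), ∑ k ∈ A, c s k *
          (if IsCoprime (𝔡 k) (∏ q ∈ s, (q : Ideal (𝓞 K))) then
            κ / Ideal.absNorm (𝔡 k) else 0))) := by
  have key : Tendsto (fun X : ℝ => ∑ i : SquareClassIndex K, ∑ k ∈ A, c i.2.1 k *
      ((Nat.card {β : 𝓞 K | β ∈ oddConeIntegers K (i.modulus 𝔟) X ∧
            ∃ y : 𝓞 K, y ^ 2 - ((i.2.2.out : (𝓞 K)ˣ) : 𝓞 K) * β ∈ 𝔡 k ^ 2} : ℝ) / X)) atTop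
      (𝓝 (∑ i : SquareClassIndex K, ∑ k ∈ A, c i.2.1 k *
        (if IsCoprime (𝔡 k) (∏ q ∈ i.2.1, (q : Ideal (𝓞 K))) then
          κ / Ideal.absNorm (𝔡 k) else 0))) :=
    tendsto_finsetSum _ fun i _ => tendsto_finsetSum _ fun k hk =>
      (hlim i _ (𝔡 k) (h𝔡 k hk)).const_mul _
  convert key using 2
  · rename_i X
    rw [Finset.sum_finset_product (hT X).toFinset Finset.univ (fun i => (hfin i X).toFinset)
      (by intro t; simp [squareClassParams]), Finset.sum_div]
    refine Finset.sum_congr rfl fun i _ => ?_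
    rw [Finset.sum_comm, Finset.sum_div]
    refine Finset.sum_congr rfl fun k _ => ?_
    dsimp only
    rw [← Finset.mul_sum, mul_div_assoc, natCard_setOf_and_eq_card_filter (hfin i X),
      Finset.sum_boole]
    rfl
  · exact (sum_squareClassIndex fun s => ∑ k ∈ A, c s k *
      (if IsCoprime (𝔡 k) (∏ q ∈ s, (q : Ideal (𝓞 K))) then κ / Ideal.absNorm (𝔡 k) else 0)).symm

end Asymptotics

section Weights

variable {K : Type*} [Field K] [NumberField K]

open scoped Classical in
/-- The inverse norm of an even part as a sum of local conditions. -/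
theorem one_div_absNorm_eq {e : primesOverTwo K → ℕ}
    (he : Ideal.span {(2 : 𝓞 K)} = ∏ q : primesOverTwo K, (q : Ideal (𝓞 K)) ^ e q)
    {𝔪 𝔠 z : Ideal (𝓞 K)} (h2 : 𝔪 * 𝔠 = Ideal.span {2}) {α : 𝓞 K}
    (hα : ∀ 𝔡 : Ideal (𝓞 K), 𝔡 ∣ Ideal.span {2} → (𝔡 ∣ 𝔠 ↔ ∃ x : 𝓞 K, x ^ 2 - α ∈ 𝔡 ^ 2)) :
    1 / (Ideal.absNorm (z * 𝔪 ^ 2) : ℝ) =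
      ∑ k ∈ Fintype.piFinset (fun q => Finset.range (e q + 1)),
        (∏ q : primesOverTwo K, jordanPow (Ideal.absNorm (q : Ideal (𝓞 K))) (k q)) /
          (Ideal.absNorm z * (Ideal.absNorm (Ideal.span {(2 : 𝓞 K)}) : ℝ) ^ 2) *
        (if ∃ x : 𝓞 K, x ^ 2 - α ∈ (∏ q : primesOverTwo K, (q : Ideal (𝓞 K)) ^ k q) ^ 2
          then 1 else 0) := by
  have h20 : Ideal.span {(2 : 𝓞 K)} ≠ 0 := by simp
  have h𝔠0 : 𝔠 ≠ 0 := by rintro rfl; exact h20 (by rw [← h2, mul_zero])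
  obtain ⟨c, hc⟩ := Ideal.exists_eq_prod_primesOverTwo h𝔠0
    fun p _ hp => hp.trans ⟨𝔪, by rw [← h2, mul_comm]⟩
  have hce : ∀ q, c q ≤ e q := by
    rw [← prod_primesOverTwo_dvd_iff, ← hc, ← he, ← h2]
    exact dvd_mul_left _ _
  have hN : (Ideal.absNorm (Ideal.span {(2 : 𝓞 K)}) : ℝ) = Ideal.absNorm 𝔪 * Ideal.absNorm 𝔠 := by
    rw [← h2, map_mul, Nat.cast_mul]
  have hN𝔠 : (Ideal.absNorm 𝔠 : ℝ) ≠ 0 := by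
    simpa [Ideal.absNorm_eq_zero_iff] using h𝔠0
  have hsum := sum_prod_jordanPow
    (fun q : primesOverTwo K => (Ideal.absNorm (q : Ideal (𝓞 K)) : ℝ)) hce
  have hprod : ∏ q : primesOverTwo K, (Ideal.absNorm (q : Ideal (𝓞 K)) : ℝ) ^ (2 * c q) =
      (Ideal.absNorm 𝔠 : ℝ) ^ 2 := by
    conv_rhs => rw [hc, map_prod]
    push_cast
    rw [← Finset.prod_pow]
    refine Finset.prod_congr rfl fun q _ => ?_
    rw [map_pow]
    push_cast
    ring
  rw [hprod] at hsum
  have hrew : ∀ k ∈ Fintype.piFinset (fun q => Finset.range (e q + 1)),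
      (∏ q : primesOverTwo K, jordanPow (Ideal.absNorm (q : Ideal (𝓞 K))) (k q)) /
          (Ideal.absNorm z * (Ideal.absNorm (Ideal.span {(2 : 𝓞 K)}) : ℝ) ^ 2) *
        (if ∃ x : 𝓞 K, x ^ 2 - α ∈ (∏ q : primesOverTwo K, (q : Ideal (𝓞 K)) ^ k q) ^ 2
          then 1 else 0) =
      (if ∀ q, k q ≤ c q then
        ∏ q : primesOverTwo K, jordanPow (Ideal.absNorm (q : Ideal (𝓞 K))) (k q) else 0) /
        (Ideal.absNorm z * (Ideal.absNorm (Ideal.span {(2 : 𝓞 K)}) : ℝ) ^ 2) := by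
    intro k hk
    have hk' : ∀ q, k q ≤ e q := fun q => by
      have := Fintype.mem_piFinset.1 hk q
      rw [Finset.mem_range] at this
      omega
    rw [← hα _ (by rw [he]; exact prod_primesOverTwo_dvd_iff.2 hk'), hc, prod_primesOverTwo_dvd_iff]
    split_ifs <;> simp
  rw [Finset.sum_congr rfl hrew, ← Finset.sum_div]
  rw [hsum, hN, map_mul, map_pow]
  push_cast
  rcases eq_or_ne (Ideal.absNorm z : ℝ) 0 with hz | hz
  · simp [hz]
  rcases eq_or_ne (Ideal.absNorm 𝔪 : ℝ) 0 with hm | hm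
  · simp [hm]
  field_simp

end Weights

section MassFormula

variable (K : Type*) [Field K] [NumberField K]

/-- The average of the inverse norm of the even part of the discriminant. -/
theorem tendsto_average_evenPart :
    ∃ hS : ∀ X, (quadraticFields K X).Finite,
      Tendsto (fun X : ℝ =>
        (∑ L ∈ (hS X).toFinset, 1 / (Ideal.absNorm (relDisc K L).evenPart : ℝ)) /
        (hS X).toFinset.card) atTop
        (𝓝 ((∏ q : primesOverTwo K, (1 + 1 / (Ideal.absNorm (q : Ideal (𝓞 K)) : ℝ))) /
          (Ideal.absNorm (Ideal.span {(2 : 𝓞 K)}) * Fintype.card (Finset (primesOverTwo K))))) := by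
  classical
  obtain ⟨κ, hκ, H⟩ := exists_tendsto_card_oddConeIntegers K
  obtain ⟨𝔟, h𝔟, hex⟩ := exists_coprime_representatives K
  obtain ⟨e, he⟩ := Ideal.exists_eq_prod_primesOverTwo (I := Ideal.span {(2 : 𝓞 K)}) (by simp)
    fun _ _ h => h
  have := finite_units_quotient_sq K
  have : Fintype ((𝓞 K)ˣ ⧸ (powMonoidHom 2 : (𝓞 K)ˣ →* (𝓞 K)ˣ).range) := Fintype.ofFinite _
  have hfin : ∀ (i : SquareClassIndex K) (X : ℝ), (oddConeIntegers K (i.modulus 𝔟) X).Finite :=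
    fun i => (H (𝔟 i.1) _ (h𝔟 i.1).2 (squarefree_prod_primesOverTwo i.2.1)).1
  have hlim := fun i : SquareClassIndex K =>
    (H (𝔟 i.1) _ (h𝔟 i.1).2 (squarefree_prod_primesOverTwo i.2.1)).2
  have hT : ∀ X, (squareClassParams 𝔟 X).Finite := fun X =>
    finite_squareClassParams fun i => hfin i X
  choose hS hsum using fun X =>
    sum_squareClassParams_eq (fun C => (h𝔟 C).1) (fun C => (h𝔟 C).2) hex (hT X)
  have hw : (Units.torsionOrder K : ℝ) ≠ 0 := by exact_mod_cast (Units.torsionOrder_pos K).ne'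
  set h : ℝ := ((Fintype.card (ClassGroup (𝓞 K)) : ℕ) : ℝ)
  set g : ℝ :=
    ((Fintype.card ((𝓞 K)ˣ ⧸ (powMonoidHom 2 : (𝓞 K)ˣ →* (𝓞 K)ˣ).range) : ℕ) : ℝ)
  have hh : h ≠ 0 := by simp [h]
  have hg : g ≠ 0 := by simp [g]
  have h2 : (Ideal.absNorm (Ideal.span {(2 : 𝓞 K)}) : ℝ) ≠ 0 := by simp
  have hx : ∀ q : primesOverTwo K, (Ideal.absNorm (q : Ideal (𝓞 K)) : ℝ) ≠ 0 := fun q => by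
    simpa [Ideal.absNorm_eq_zero_iff] using (prime_of_mem_primesOverTwo q).ne_zero
  -- counting all quadratic fields
  have hcount : Tendsto (fun X : ℝ => (Units.torsionOrder K * (hS X).toFinset.card : ℝ) / X) atTop
      (𝓝 (h * g * (Fintype.card (Finset (primesOverTwo K)) * κ))) := by
    have h1 := tendsto_sum_nonsquare (fun C => (h𝔟 C).1) hex hT _
      (tendsto_sum_squareClassParams hT hfin hlim (Finset.univ : Finset Unit) (fun _ => 1)
        (fun _ _ => one_dvd _) (fun _ _ => 1))
    convert h1 using 2
    · rename_i X
      have h3 := hsum X fun _ => 1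
      rw [Finset.sum_const, Finset.sum_const, nsmul_eq_mul, nsmul_eq_mul, mul_one, mul_one] at h3
      rw [← h3]
      have h6 : ∀ t : SquareClassIndex K × 𝓞 K,
          ∃ x : 𝓞 K, x ^ 2 - squareClassValue t ∈ (1 : Ideal (𝓞 K)) ^ 2 := fun t =>
        ⟨0, by rw [one_pow, Ideal.one_eq_top]; exact Submodule.mem_top⟩
      simp only [h6, if_true, Finset.sum_const, Finset.card_univ, Fintype.card_unit, one_smul,
        nsmul_eq_mul, mul_one]
    · have h4 : ∀ s : Finset (primesOverTwo K),
          IsCoprime (1 : Ideal (𝓞 K)) (∏ q ∈ s, (q : Ideal (𝓞 K))) := fun s => isCoprime_one_left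
      have h5 : (Ideal.absNorm (1 : Ideal (𝓞 K)) : ℝ) = 1 := by simp
      simp only [h4, h5, if_true, div_one, one_mul, Finset.sum_const, Finset.card_univ,
        nsmul_eq_mul, Fintype.card_unit, Nat.cast_one]
      rfl
  -- counting with weights
  have hweight : Tendsto (fun X : ℝ => (Units.torsionOrder K *
      ∑ L ∈ (hS X).toFinset, 1 / (Ideal.absNorm (relDisc K L).evenPart : ℝ)) / X) atTop
      (𝓝 (h * g * (κ * (∏ q : primesOverTwo K, (1 + 1 / (Ideal.absNorm (q : Ideal (𝓞 K)) : ℝ))) /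
        Ideal.absNorm (Ideal.span {(2 : 𝓞 K)})))) := by
    have h1 := tendsto_sum_nonsquare (fun C => (h𝔟 C).1) hex hT _
      (tendsto_sum_squareClassParams hT hfin hlim
        (Fintype.piFinset (fun q => Finset.range (e q + 1)))
        (fun k => ∏ q : primesOverTwo K, (q : Ideal (𝓞 K)) ^ k q)
        (fun k hk => by
          rw [he, prod_primesOverTwo_dvd_iff]
          intro q
          have := Fintype.mem_piFinset.1 hk q
          rw [Finset.mem_range] at this
          omega)
        (fun s k => (∏ q : primesOverTwo K, jordanPow (Ideal.absNorm (q : Ideal (𝓞 K))) (k q)) /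
          (Ideal.absNorm (∏ q ∈ s, (q : Ideal (𝓞 K))) *
            (Ideal.absNorm (Ideal.span {(2 : 𝓞 K)}) : ℝ) ^ 2)))
    convert h1 using 2
    · rename_i X
      rw [← hsum X]
      congr 1
      refine Finset.sum_congr rfl fun t ht => ?_
      rw [Finset.mem_filter, Set.Finite.mem_toFinset] at ht
      obtain ⟨⟨-, F, htF, hF, hF2, hFX⟩, hns⟩ := ht
      obtain ⟨𝔪, 𝔠, h2, hpart, hα⟩ :=
        exists_isLPartition_relDisc (fun C => (h𝔟 C).2) htF hF hF2 hns
      rw [hpart.evenPart_eq]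
      exact one_div_absNorm_eq he h2 hα
    · congr 1
      have h3 := sum_sum_jordanPow hx e
      have h4 : ∏ q : primesOverTwo K, (Ideal.absNorm (q : Ideal (𝓞 K)) : ℝ) ^ e q =
          Ideal.absNorm (Ideal.span {(2 : 𝓞 K)}) := by
        rw [he, map_prod]
        push_cast
        exact Finset.prod_congr rfl fun q _ => by rw [map_pow]; push_cast; rfl
      rw [h4] at h3
      have h5 : κ * (∏ q : primesOverTwo K, (1 + 1 / (Ideal.absNorm (q : Ideal (𝓞 K)) : ℝ))) /
          Ideal.absNorm (Ideal.span {(2 : 𝓞 K)}) =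
          κ / (Ideal.absNorm (Ideal.span {(2 : 𝓞 K)}) : ℝ) ^ 2 *
            (Ideal.absNorm (Ideal.span {(2 : 𝓞 K)}) *
              ∏ q : primesOverTwo K, (1 + 1 / (Ideal.absNorm (q : Ideal (𝓞 K)) : ℝ))) := by
        field_simp
      rw [h5, ← h3, Finset.mul_sum]
      refine Finset.sum_congr rfl fun s _ => ?_
      rw [Finset.mul_sum]
      refine Finset.sum_congr rfl fun k _ => ?_
      have h6 : (Ideal.absNorm (∏ q ∈ s, (q : Ideal (𝓞 K))) : ℝ) =
          ∏ q ∈ s, (Ideal.absNorm (q : Ideal (𝓞 K)) : ℝ) := by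
        rw [map_prod]; push_cast; rfl
      have h7 : (Ideal.absNorm (∏ q : primesOverTwo K, (q : Ideal (𝓞 K)) ^ k q) : ℝ) =
          ∏ q : primesOverTwo K, (Ideal.absNorm (q : Ideal (𝓞 K)) : ℝ) ^ k q := by
        rw [map_prod]
        push_cast
        exact Finset.prod_congr rfl fun q _ => by rw [map_pow]; push_cast; rfl
      simp only [isCoprime_prod_primesOverTwo_iff, h6, h7]
      split_ifs <;> ring
  refine ⟨hS, ?_⟩
  have hZ : (Fintype.card (Finset (primesOverTwo K)) : ℝ) ≠ 0 := by simp
  have hratio := hweight.div hcount (mul_ne_zero (mul_ne_zero hh hg) (mul_ne_zero hZ hκ.ne'))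
  convert hratio.congr' ?_ using 2
  · have hκ' := hκ.ne'
    field_simp
  · filter_upwards [eventually_gt_atTop 0] with X hX
    simp only [Pi.div_apply]
    rw [div_div_div_cancel_right₀ hX.ne', mul_div_mul_left _ _ hw]

theorem finite_evenDiscParts : (evenDiscParts K).Finite := by
  classical
  obtain ⟨κ, -, H⟩ := exists_tendsto_card_oddConeIntegers K
  obtain ⟨𝔟, h𝔟, hex⟩ := exists_coprime_representatives K
  have := finite_units_quotient_sq K
  have : Fintype ((𝓞 K)ˣ ⧸ (powMonoidHom 2 : (𝓞 K)ˣ →* (𝓞 K)ˣ).range) := Fintype.ofFinite _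
  have hT : ∀ X, (squareClassParams 𝔟 X).Finite := fun X => finite_squareClassParams fun i =>
    (H (𝔟 i.1) _ (h𝔟 i.1).2 (squarefree_prod_primesOverTwo i.2.1)).1 X
  have hdvd : {𝔪 : Ideal (𝓞 K) | 𝔪 ∣ Ideal.span {2}}.Finite := Ideal.finite_setOf_dvd (by simp)
  refine (Set.Finite.image2 (fun (s : Finset (primesOverTwo K)) (𝔪 : Ideal (𝓞 K)) =>
    (∏ q ∈ s, (q : Ideal (𝓞 K))) * 𝔪 ^ 2) Set.finite_univ hdvd).subset ?_
  rintro 𝔔 ⟨L, hL, F, hLF⟩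
  obtain ⟨hS, hsum⟩ := sum_squareClassParams_eq (fun C => (h𝔟 C).1) (fun C => (h𝔟 C).2) hex
    (hT (Ideal.absNorm F))
  have hLS : L ∈ quadraticFields K (Ideal.absNorm F) := ⟨hL, 𝔔, F, hLF, le_rfl⟩
  have hne : ∑ t ∈ (hT (Ideal.absNorm F)).toFinset.filter
      (fun t => ¬ IsSquare (squareClassValue t)),
      (if sqrtField (squareClassValue t : K) = L then (1 : ℝ) else 0) ≠ 0 := by
    rw [hsum fun L' => if L' = L then 1 else 0, Finset.sum_ite_eq', if_pos (by simpa using hLS),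
      mul_one]
    exact_mod_cast (Units.torsionOrder_pos K).ne'
  obtain ⟨t, ht, htL⟩ := Finset.exists_ne_zero_of_sum_ne_zero hne
  rw [Finset.mem_filter, Set.Finite.mem_toFinset] at ht
  obtain ⟨⟨-, F', htF, hF, hF2, -⟩, hns⟩ := ht
  obtain ⟨𝔪, 𝔠, h2, hpart, -⟩ := exists_isLPartition_relDisc (fun C => (h𝔟 C).2) htF hF hF2 hns
  have heq : sqrtField (squareClassValue t : K) = L := by
    by_contra h
    exact htL (if_neg h)
  rw [heq] at hpart
  exact ⟨t.1.2.1, Set.mem_univ _, 𝔪, ⟨𝔠, h2.symm⟩, (hpart.unique hLF).1⟩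

theorem absNorm_span_two :
    (Ideal.absNorm (Ideal.span {(2 : 𝓞 K)}) : ℝ) =
      2 ^ (InfinitePlace.nrRealPlaces K + 2 * InfinitePlace.nrComplexPlaces K) := by
  have h : (2 : 𝓞 K) = algebraMap ℤ (𝓞 K) 2 := by simp
  rw [Ideal.absNorm_span_singleton, h, Algebra.norm_algebraMap, RingOfIntegers.rank,
    InfinitePlace.card_add_two_mul_card_eq_rank, Int.natAbs_pow]
  simp

variable {K} in
theorem mem_evenDiscParts_of_mem_quadraticFields {X : ℝ}
    {L : IntermediateField K (AlgebraicClosure K)} (hL : L ∈ quadraticFields K X) :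
    (relDisc K L).evenPart ∈ evenDiscParts K := by
  obtain ⟨h, E, F, hEF, -⟩ := hL
  rw [hEF.evenPart_eq]
  exact ⟨L, h, F, hEF⟩

open scoped Classical in
theorem card_quadraticFields_evenPart_eq {X : ℝ} (hS : (quadraticFields K X).Finite)
    (𝔔 : Ideal (𝓞 K)) :
    Nat.card {L : IntermediateField K (AlgebraicClosure K) //
      Module.finrank K L = 2 ∧ ∃ F : Ideal (𝓞 K),
        IsLPartition (Ideal.span {(2 : 𝓞 K)}) (relDisc K L) 𝔔 F ∧ (Ideal.absNorm F : ℝ) ≤ X} =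
      (hS.toFinset.filter fun L => (relDisc K L).evenPart = 𝔔).card := by
  rw [← Set.ncard_coe_finset, ← Nat.card_coe_set_eq]
  refine Nat.card_congr (Equiv.subtypeEquivRight fun L => ?_)
  rw [Finset.mem_coe, Finset.mem_filter, Set.Finite.mem_toFinset]
  constructor
  · rintro ⟨hL, F, hF, hX⟩
    exact ⟨⟨hL, 𝔔, F, hF, hX⟩, hF.evenPart_eq⟩
  · rintro ⟨⟨hL, E, F, hF, hX⟩, rfl⟩
    exact ⟨hL, F, hF.evenPart_eq.symm ▸ hF, hX⟩

end MassFormula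

/-- **A mass formula for quadratic extensions.**
With `Z` the set of squarefree ideals supported over `2`, `R` the set of possible even
parts of discriminants of quadratic extensions and `ρ_𝔔` the corresponding densities,
`2^{r₁+r₂} #Z · ∏_{𝔮∣2} N(𝔮)/(1+N(𝔮)) · ∑_{𝔔∈R} ρ_𝔔/N(𝔔) = 1/2^{r₂}`. -/
theorem quadratic_mass_formula
    (K : Type*) [Field K] [NumberField K]
    (ρ : Ideal (𝓞 K) → ℝ)
    (hρ : ∀ 𝔔 ∈ evenDiscParts K, Tendsto (fun X : ℝ =>
      (Nat.card {L : IntermediateField K (AlgebraicClosure K) //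
          Module.finrank K L = 2 ∧ ∃ F : Ideal (𝓞 K),
            IsLPartition (Ideal.span {(2 : 𝓞 K)}) (relDisc K L) 𝔔 F ∧
            (Ideal.absNorm F : ℝ) ≤ X} : ℝ) /
      (Nat.card {L : IntermediateField K (AlgebraicClosure K) //
          Module.finrank K L = 2 ∧ ∃ Lp F : Ideal (𝓞 K),
            IsLPartition (Ideal.span {(2 : 𝓞 K)}) (relDisc K L) Lp F ∧
            (Ideal.absNorm F : ℝ) ≤ X} : ℝ)) atTop (nhds (ρ 𝔔))) :
    (2 ^ (InfinitePlace.nrRealPlaces K + InfinitePlace.nrComplexPlaces K) *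
        (Nat.card {I : Ideal (𝓞 K) // Squarefree I ∧
          ∀ p : Ideal (𝓞 K), p.IsPrime → p ∣ I → p ∣ Ideal.span {(2 : 𝓞 K)}} : ℝ)) *
      (∏ᶠ q ∈ {q : Ideal (𝓞 K) | q.IsPrime ∧ q ∣ Ideal.span {(2 : 𝓞 K)}},
        (Ideal.absNorm q : ℝ) / (1 + (Ideal.absNorm q : ℝ))) *
      (∑ᶠ 𝔔 ∈ evenDiscParts K, ρ 𝔔 / (Ideal.absNorm 𝔔 : ℝ)) =
      1 / 2 ^ (InfinitePlace.nrComplexPlaces K) := by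
  classical
  obtain ⟨hS, hlim⟩ := tendsto_average_evenPart K
  have hR := finite_evenDiscParts K
  have hsum : Tendsto (fun X : ℝ =>
      (∑ L ∈ (hS X).toFinset, 1 / (Ideal.absNorm (relDisc K L).evenPart : ℝ)) /
        (hS X).toFinset.card) atTop
      (𝓝 (∑ 𝔔 ∈ hR.toFinset, ρ 𝔔 / (Ideal.absNorm 𝔔 : ℝ))) := by
    refine (tendsto_finsetSum hR.toFinset fun 𝔔 h𝔔 =>
      (hρ 𝔔 (by simpa using h𝔔)).div_const (Ideal.absNorm 𝔔 : ℝ)).congr fun X => ?_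
    rw [← Finset.sum_fiberwise_of_maps_to (g := fun L : IntermediateField K (AlgebraicClosure K) =>
        (relDisc K L).evenPart) (t := hR.toFinset) (fun L hL => by
        simpa using mem_evenDiscParts_of_mem_quadraticFields ((hS X).mem_toFinset.1 hL)),
      Finset.sum_div]
    refine Finset.sum_congr rfl fun 𝔔 _ => ?_
    have hcard : Nat.card {L : IntermediateField K (AlgebraicClosure K) //
        Module.finrank K L = 2 ∧ ∃ Lp F : Ideal (𝓞 K),
          IsLPartition (Ideal.span {(2 : 𝓞 K)}) (relDisc K L) Lp F ∧
            (Ideal.absNorm F : ℝ) ≤ X} = (hS X).toFinset.card :=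
      Nat.card_eq_card_finite_toFinset (hS X)
    rw [card_quadraticFields_evenPart_eq K (hS X), hcard, Finset.sum_congr rfl fun L hL => by
      rw [(Finset.mem_filter.1 hL).2], Finset.sum_const, nsmul_eq_mul]
    ring
  have hprod : ∏ᶠ q ∈ {q : Ideal (𝓞 K) | q.IsPrime ∧ q ∣ Ideal.span {(2 : 𝓞 K)}},
      (Ideal.absNorm q : ℝ) / (1 + (Ideal.absNorm q : ℝ)) =
      ∏ q : primesOverTwo K, (Ideal.absNorm (q : Ideal (𝓞 K)) : ℝ) /
        (1 + (Ideal.absNorm (q : Ideal (𝓞 K)) : ℝ)) := by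
    have h : {q : Ideal (𝓞 K) | q.IsPrime ∧ q ∣ Ideal.span {(2 : 𝓞 K)}} = primesOverTwo K := by
      ext q
      simp [mem_primesOverTwo]
    rw [h, finprod_mem_coe_finset]
    exact (Finset.prod_coe_sort (primesOverTwo K) _).symm
  have hcancel : (∏ q : primesOverTwo K, (Ideal.absNorm (q : Ideal (𝓞 K)) : ℝ) /
      (1 + (Ideal.absNorm (q : Ideal (𝓞 K)) : ℝ))) *
      ∏ q : primesOverTwo K, (1 + 1 / (Ideal.absNorm (q : Ideal (𝓞 K)) : ℝ)) = 1 := by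
    rw [← Finset.prod_mul_distrib]
    refine Finset.prod_eq_one fun q _ => ?_
    have h0 : (Ideal.absNorm (q : Ideal (𝓞 K)) : ℝ) ≠ 0 := by
      simpa [Ideal.absNorm_eq_zero_iff] using (prime_of_mem_primesOverTwo q).ne_zero
    have h1 : 1 + (Ideal.absNorm (q : Ideal (𝓞 K)) : ℝ) ≠ 0 := by positivity
    field_simp
    ring
  have hZ : (Fintype.card (Finset (primesOverTwo K)) : ℝ) ≠ 0 := by simp
  rw [finsum_mem_eq_finite_toFinset_sum _ hR, tendsto_nhds_unique hsum hlim, hprod,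
    card_squarefree_over_two, Nat.card_eq_fintype_card, absNorm_span_two]
  generalize (∏ q : primesOverTwo K, (Ideal.absNorm (q : Ideal (𝓞 K)) : ℝ) /
      (1 + (Ideal.absNorm (q : Ideal (𝓞 K)) : ℝ))) = P at *
  generalize ∏ q : primesOverTwo K, (1 + 1 / (Ideal.absNorm (q : Ideal (𝓞 K)) : ℝ)) = Q at *
  rw [pow_add, pow_add, two_mul, pow_add]
  field_simp
  linear_combination hcancel

end
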